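/- Let γ ∈ C³_b(ℝ^{n−1}), p ∈ [1,∞), and suppose ρ satisfies Assumptions (A1) and (A2) with M = I, and that ‖γ‖_{C¹_b(ℝ^{n−1})} is sufficiently small. Then for every u ∈ W^{2,p}_I(ℝⁿ_γ), L_ε^{ℝⁿ_γ} u → −Δu strongly in L^p(ℝⁿ_γ) as ε → 0. -/

import Mathlib

open MeasureTheory Filter Topology ENNReal Matrix

noncomputable section

abbrev EV (n : ℕ) := EuclideanSpace ℝ (Fin n)

/-- The kernel `J(x) = ρ(x)/|x|²`. -/
def kernelJ {n : ℕ} (ρ : EV n → ℝ) (x : EV n) : ℝ := ρ x / ‖x‖ ^ 2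

/-- The rescaled density `ρ_ε(x) = ε^{-n} ρ(x/ε)`. -/
def scaled {n : ℕ} (ρ : EV n → ℝ) (ε : ℝ) (x : EV n) : ℝ := (ε ^ n)⁻¹ * ρ (ε⁻¹ • x)

/-- Assumption (A1): `ρ` is measurable, nonnegative, not a.e. zero, even,
and `∫ ρ(x)(1+|x|) dx < ∞`. -/
def A1 {n : ℕ} (ρ : EV n → ℝ) : Prop :=
  Measurable ρ ∧ (∀ x, 0 ≤ ρ x) ∧ ¬ (ρ =ᵐ[volume] (fun _ => (0 : ℝ))) ∧
  (∀ᵐ x : EV n ∂volume, ρ (-x) = ρ x) ∧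
  Integrable (fun x : EV n => ρ x * (1 + ‖x‖)) volume

/-- `L_ε u (x) = ∫_{ℝⁿ} J_ε(x-y) (u(x) - u(y) - ∇u(x)·(x-y)) dy`. -/
def nlOp {n : ℕ} (ρ : EV n → ℝ) (ε : ℝ) (u : EV n → ℝ) (x : EV n) : ℝ :=
  ∫ y : EV n, kernelJ (scaled ρ ε) (x - y) * (u x - u y - fderiv ℝ u x (x - y))

/-- The classical partial derivative `∂ᵢ u`. -/
def partialD {n : ℕ} (i : Fin n) (u : EV n → ℝ) : EV n → ℝ :=
  fun x => fderiv ℝ u x (EuclideanSpace.single i 1)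

/-- Iterated classical partial derivatives along a list of directions. -/
def partialDList {n : ℕ} : List (Fin n) → (EV n → ℝ) → (EV n → ℝ)
  | [], u => u
  | i :: l, u => partialD i (partialDList l u)

/-- The momentum matrix `M = (1/2)∫_{ℝⁿ} J(z) z ⊗ z dz`. -/
def momentum {n : ℕ} (ρ : EV n → ℝ) : Matrix (Fin n) (Fin n) ℝ :=
  Matrix.of fun i j => (1 / 2 : ℝ) * ∫ z : EV n, kernelJ ρ z * z i * z j

/-- Multiplication of a vector of `ℝⁿ` by a matrix. -/
def mulVecE {m : ℕ} (Q : Matrix (Fin m) (Fin m) ℝ) (x : EV m) : EV m :=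
  (WithLp.equiv 2 (Fin m → ℝ)).symm (Q.mulVec ((WithLp.equiv 2 (Fin m → ℝ)) x))

/-- The point `(z', zₙ) ∈ ℝⁿ` with first coordinates `z' ∈ ℝ^{n-1}` and last coordinate `zₙ`. -/
def snocE {n : ℕ} (z' : EV n) (t : ℝ) : EV (n + 1) :=
  (WithLp.equiv 2 (Fin (n + 1) → ℝ)).symm
    (Fin.snoc ((WithLp.equiv 2 (Fin n → ℝ)) z') t)

/-- `v = ∂ᵢ u` weakly on `Ω`. -/
def WeakDerivOn {n : ℕ} (Ω : Set (EV n)) (i : Fin n) (u v : EV n → ℝ) : Prop :=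
  ∀ φ : EV n → ℝ, ContDiff ℝ (⊤ : ℕ∞) φ → HasCompactSupport φ → tsupport φ ⊆ Ω →
    ∫ x in Ω, u x * partialD i φ x = - ∫ x in Ω, v x * φ x

/-- `D` is a system of weak partial derivatives of `u` on `Ω` up to order `k`,
all lying in `L^p(Ω)`; i.e. `D` witnesses that `u ∈ W^{k,p}(Ω)`. -/
def IsSobDerivs {n : ℕ} (Ω : Set (EV n)) (k : ℕ) (p : ℝ≥0∞) (u : EV n → ℝ)
    (D : List (Fin n) → EV n → ℝ) : Prop :=
  D [] = u ∧
  (∀ l : List (Fin n), l.length < k → ∀ i : Fin n, WeakDerivOn Ω i (D l) (D (i :: l))) ∧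
  (∀ l : List (Fin n), l.length ≤ k → MemLp (D l) p (volume.restrict Ω))

/-- `u ∈ W^{k,p}(Ω)`. -/
def MemW {n : ℕ} (Ω : Set (EV n)) (k : ℕ) (p : ℝ≥0∞) (u : EV n → ℝ) : Prop :=
  ∃ D, IsSobDerivs Ω k p u D

/-- The `W^{k,p}`-norm computed from a system `D` of weak derivatives:
the sum of the `L^p` norms of all weak derivatives of order at most `k`. -/
def WNormD {n : ℕ} (k : ℕ) (p : ℝ≥0∞) (μ : Measure (EV n))
    (D : List (Fin n) → EV n → ℝ) : ℝ≥0∞ :=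
  ∑' l : List (Fin n), if l.length ≤ k then eLpNorm (D l) p μ else 0

/-- The first `n` coordinates of a point of `ℝ^{n+1}`. -/
def firstCoords {n : ℕ} (x : EV (n + 1)) : EV n :=
  (WithLp.equiv 2 (Fin n → ℝ)).symm (fun i => x i.castSucc)

/-- The curved half space `ℝⁿ_γ = {x : xₙ > γ(x₁,…,x_{n-1})}`. -/
def halfSpace {n : ℕ} (γ : EV n → ℝ) : Set (EV (n + 1)) :=
  {x : EV (n + 1) | γ (firstCoords x) < x (Fin.last n)}

/-- `γ ∈ C^k_b`: `γ` is `k` times continuously differentiable with bounded derivatives. -/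
def Ckb {n : ℕ} (k : ℕ) (γ : EV n → ℝ) : Prop :=
  ContDiff ℝ k γ ∧ ∀ m : ℕ, m ≤ k → ∃ C : ℝ, ∀ x, ‖iteratedFDeriv ℝ m γ x‖ ≤ C

/-- Assumption (A2): `ρ ∈ C¹(ℝⁿ∖{0})` with singularity bounds
`|ρ(x)| ≤ c₀|x|^{2-α-n}(1+|x|)^{-N}`, `|∇ρ(x)| ≤ c₁|x|^{1-α-n}(1+|x|)^{-N}` for some
`c₀, c₁ > 0`, `α ∈ (0,2)`, `N > 3-α`; and, with `A := √M`, the kernel satisfies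
`∫_{ℝ^{n-1}} J(AQ(z', zₙ)) z' dz' = 0` for all `zₙ ∈ ℝ` and `Q ∈ SO(n)`.
(The ambient dimension is `n + 1`.) -/
def A2 {n : ℕ} (ρ : EV (n + 1) → ℝ) : Prop :=
  ContDiffOn ℝ 1 ρ {(0 : EV (n + 1))}ᶜ ∧
  (∃ c₀ c₁ α N : ℝ, 0 < c₀ ∧ 0 < c₁ ∧ 0 < α ∧ α < 2 ∧ 3 - α < N ∧
    ∀ x : EV (n + 1), x ≠ 0 →
      |ρ x| ≤ c₀ * ‖x‖ ^ ((2 : ℝ) - α - (n + 1 : ℝ)) * (1 + ‖x‖) ^ (-N) ∧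
      ‖fderiv ℝ ρ x‖ ≤ c₁ * ‖x‖ ^ ((1 : ℝ) - α - (n + 1 : ℝ)) * (1 + ‖x‖) ^ (-N)) ∧
  (∃ A : Matrix (Fin (n + 1)) (Fin (n + 1)) ℝ, A.PosDef ∧ A * A = momentum ρ ∧
    ∀ t : ℝ, ∀ Q : Matrix (Fin (n + 1)) (Fin (n + 1)) ℝ, Qᵀ * Q = 1 → Q.det = 1 →
      (∫ z' : EV n, kernelJ ρ (mulVecE (A * Q) (snocE z' t)) • z') = 0)

/-- The homogeneous conormal boundary condition `M∇u · n = 0` on `∂Ω`, formulated weakly: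
for any system of weak derivatives of `u ∈ W^{2,p}(Ω)` and any test function
`φ ∈ C_c^∞(ℝⁿ)`, Green's formula holds on `Ω` with no boundary contribution. -/
def NeumannBC {m : ℕ} (Ω : Set (EV m)) (Mm : Matrix (Fin m) (Fin m) ℝ) (p : ℝ≥0∞)
    (u : EV m → ℝ) : Prop :=
  ∀ D : List (Fin m) → EV m → ℝ, IsSobDerivs Ω 2 p u D →
    ∀ φ : EV m → ℝ, ContDiff ℝ (⊤ : ℕ∞) φ → HasCompactSupport φ →
      (∑ i : Fin m, ∑ j : Fin m, Mm i j * ∫ x in Ω, D [i, j] x * φ x)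
        = - ∑ i : Fin m, ∑ j : Fin m, Mm i j * ∫ x in Ω, D [j] x * partialD i φ x

/-- `u ∈ W^{k,p}(Ω)` together with the boundary condition `M∇u · n = 0` on `∂Ω`. -/
def MemWN {m : ℕ} (Ω : Set (EV m)) (Mm : Matrix (Fin m) (Fin m) ℝ) (k : ℕ) (p : ℝ≥0∞)
    (u : EV m → ℝ) : Prop :=
  MemW Ω k p u ∧ NeumannBC Ω Mm p u

/-- `l` is the principal value `P.V. ∫_Ω J_ε(x-y)(u(x)-u(y)) dy` at the point `x`. -/
def pvAt {m : ℕ} (Ω : Set (EV m)) (ρ : EV m → ℝ) (ε : ℝ) (u : EV m → ℝ) (x : EV m)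
    (l : ℝ) : Prop :=
  Tendsto
    (fun r : ℝ =>
      ∫ y in Ω ∩ {y : EV m | r ≤ dist x y}, kernelJ (scaled ρ ε) (x - y) * (u x - u y))
    (𝓝[>] 0) (𝓝 l)

/-- `L` is a bounded linear extension to `W^{2,p}_M(Ω)` (Sobolev functions with the
boundary condition `M∇u · n = 0`), with operator bound `C`, of the nonlocal operator
`P.V. ∫_Ω J_ε(·-y)(u(·)-u(y)) dy` defined on `C_c²(cl Ω) ∩ W^{2,p}_M(Ω)`. -/
def IsNLExtOn {m : ℕ} (Ω : Set (EV m)) (Mm : Matrix (Fin m) (Fin m) ℝ) (ρ : EV m → ℝ)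
    (p : ℝ≥0∞) (ε C : ℝ) (L : (EV m → ℝ) → EV m → ℝ) : Prop :=
  (∀ u : EV m → ℝ, ContDiff ℝ 2 u → HasCompactSupport u → MemWN Ω Mm 2 p u →
    ∀ᵐ x ∂(volume.restrict Ω), pvAt Ω ρ ε u x (L u x)) ∧
  (∀ u v : EV m → ℝ, MemWN Ω Mm 2 p u → MemWN Ω Mm 2 p v → ∀ a b : ℝ,
    L (fun x => a * u x + b * v x) =ᵐ[volume.restrict Ω] fun x => a * L u x + b * L v x) ∧
  (∀ u : EV m → ℝ, MemWN Ω Mm 2 p u → MemLp (L u) p (volume.restrict Ω)) ∧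
  (∀ u D, MemWN Ω Mm 2 p u → IsSobDerivs Ω 2 p u D →
    eLpNorm (L u) p (volume.restrict Ω)
      ≤ ENNReal.ofReal C * WNormD 2 p (volume.restrict Ω) D)

/-- `Ω ⊆ ℝ^{n+1}` is an open set whose boundary is locally, up to a rotation, the region
above the graph of a `C^k` function with bounded derivatives (a domain of class `C^k`). -/
def IsGraphDomain {n : ℕ} (k : ℕ) (Ω : Set (EV (n + 1))) : Prop :=
  IsOpen Ω ∧ ∀ z ∈ frontier Ω,
    ∃ (U : Set (EV (n + 1))) (Q : Matrix (Fin (n + 1)) (Fin (n + 1)) ℝ) (γ : EV n → ℝ),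
      IsOpen U ∧ z ∈ U ∧ Qᵀ * Q = 1 ∧ Q.det = 1 ∧ Ckb k γ ∧
      Ω ∩ U = (mulVecE Q '' halfSpace γ) ∩ U

/-! ### Jensen inequality for lower integrals -/

theorem jensen_lint {Z : Type*} [MeasurableSpace Z] (ν : Measure Z) {h : Z → ℝ≥0∞}
    (hh : AEMeasurable h ν) {q : ℝ} (hq : 1 ≤ q) :
    (∫⁻ z, h z ∂ν) ^ q ≤ (ν Set.univ) ^ (q - 1) * ∫⁻ z, (h z) ^ q ∂ν := by
  rcases eq_or_lt_of_le hq with rfl | hq1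
  · simp
  have hc : q.HolderConjugate (q / (q - 1)) := Real.HolderConjugate.conjExponent hq1
  have h1 := ENNReal.lintegral_mul_le_Lp_mul_Lq ν hc hh (aemeasurable_const (b := (1 : ℝ≥0∞)))
  have h2 : (∫⁻ z, h z ∂ν) ≤ (∫⁻ z, (h z) ^ q ∂ν) ^ (1 / q) * (ν Set.univ) ^ (1 / (q / (q - 1))) := by
    simpa using h1
  have q0 : 0 < q := by linarith
  calc (∫⁻ z, h z ∂ν) ^ q
      ≤ ((∫⁻ z, (h z) ^ q ∂ν) ^ (1 / q) * (ν Set.univ) ^ (1 / (q / (q - 1)))) ^ q :=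
        ENNReal.rpow_le_rpow h2 q0.le
    _ = (ν Set.univ) ^ (q - 1) * ∫⁻ z, (h z) ^ q ∂ν := by
        rw [ENNReal.mul_rpow_of_nonneg _ _ q0.le, ← ENNReal.rpow_mul, ← ENNReal.rpow_mul]
        have e1 : 1 / q * q = 1 := by field_simp
        have e2 : 1 / (q / (q - 1)) * q = q - 1 := by field_simp
        rw [e1, e2, ENNReal.rpow_one, mul_comm]

theorem jensen_double {X Z : Type*} [MeasurableSpace X] [MeasurableSpace Z] (μ : Measure X)
    [SFinite μ] (ν : Measure Z) [SFinite ν] {h : X → Z → ℝ≥0∞}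
    (hh : Measurable (Function.uncurry h)) {q : ℝ} (hq : 1 ≤ q) :
    ∫⁻ x, (∫⁻ z, h x z ∂ν) ^ q ∂μ ≤
      (ν Set.univ) ^ (q - 1) * ∫⁻ z, ∫⁻ x, (h x z) ^ q ∂μ ∂ν := by
  have hm : Measurable (Function.uncurry fun x z => (h x z) ^ q) := hh.pow_const q
  calc ∫⁻ x, (∫⁻ z, h x z ∂ν) ^ q ∂μ
      ≤ ∫⁻ x, (ν Set.univ) ^ (q - 1) * ∫⁻ z, (h x z) ^ q ∂ν ∂μ := by
        refine lintegral_mono fun x => jensen_lint ν ?_ hq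
        exact (hh.comp measurable_prodMk_left).aemeasurable
    _ = (ν Set.univ) ^ (q - 1) * ∫⁻ x, ∫⁻ z, (h x z) ^ q ∂ν ∂μ := by
        rw [lintegral_const_mul]
        exact hm.lintegral_prod_right
    _ = _ := by
        rw [lintegral_lintegral_swap hm.aemeasurable]

/-! ### Splitting off the last coordinate -/

@[simp] theorem snocE_castSucc {n : ℕ} (z' : EV n) (t : ℝ) (i : Fin n) :
    snocE z' t i.castSucc = z' i := by
  simp [snocE]

@[simp] theorem snocE_last {n : ℕ} (z' : EV n) (t : ℝ) :
    snocE z' t (Fin.last n) = t := by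
  simp [snocE]

@[simp] theorem firstCoords_apply {n : ℕ} (x : EV (n + 1)) (i : Fin n) :
    firstCoords x i = x i.castSucc := by
  simp [firstCoords]

@[simp] theorem firstCoords_snocE {n : ℕ} (z' : EV n) (t : ℝ) :
    firstCoords (snocE z' t) = z' := by
  ext i; simp

theorem snocE_firstCoords {n : ℕ} (x : EV (n + 1)) :
    snocE (firstCoords x) (x (Fin.last n)) = x := by
  ext i
  refine Fin.lastCases ?_ (fun j => ?_) i <;> simp

/-- first coordinates as a continuous linear map -/
def fcL (n : ℕ) : EV (n + 1) →L[ℝ] EV n :=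
  LinearMap.toContinuousLinearMap
    { toFun := firstCoords
      map_add' := fun x y => by ext i; simp
      map_smul' := fun c x => by ext i; simp }

@[simp] theorem fcL_apply {n : ℕ} (x : EV (n + 1)) : fcL n x = firstCoords x := rfl

/-- last coordinate as a continuous linear map -/
def lastL (n : ℕ) : EV (n + 1) →L[ℝ] ℝ :=
  LinearMap.toContinuousLinearMap
    { toFun := fun x => x (Fin.last n)
      map_add' := fun x y => by simp
      map_smul' := fun c x => by simp }

@[simp] theorem lastL_apply {n : ℕ} (x : EV (n + 1)) : lastL n x = x (Fin.last n) := rfl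

/-- `snocE` as a continuous linear map on the product -/
def snocL (n : ℕ) : (EV n × ℝ) →L[ℝ] EV (n + 1) :=
  LinearMap.toContinuousLinearMap
    { toFun := fun q => snocE q.1 q.2
      map_add' := fun x y => by
        ext i; refine Fin.lastCases ?_ (fun j => ?_) i <;> simp
      map_smul' := fun c x => by
        ext i; refine Fin.lastCases ?_ (fun j => ?_) i <;> simp }

@[simp] theorem snocL_apply {n : ℕ} (q : EV n × ℝ) : snocL n q = snocE q.1 q.2 := rfl

theorem norm_snocE_sq {n : ℕ} (z' : EV n) (t : ℝ) : ‖snocE z' t‖ ^ 2 = ‖z'‖ ^ 2 + t ^ 2 := by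
  rw [EuclideanSpace.norm_sq_eq, EuclideanSpace.norm_sq_eq, Fin.sum_univ_castSucc]
  simp

theorem norm_sq_split {n : ℕ} (x : EV (n + 1)) :
    ‖x‖ ^ 2 = ‖firstCoords x‖ ^ 2 + (x (Fin.last n)) ^ 2 := by
  conv_lhs => rw [← snocE_firstCoords x]
  exact norm_snocE_sq _ _

theorem norm_firstCoords_le {n : ℕ} (x : EV (n + 1)) : ‖firstCoords x‖ ≤ ‖x‖ := by
  have := norm_sq_split x
  exact le_of_sq_le_sq (by nlinarith [sq_nonneg (x (Fin.last n))]) (norm_nonneg _)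

theorem abs_last_le {n : ℕ} (x : EV (n + 1)) : |x (Fin.last n)| ≤ ‖x‖ := by
  have := norm_sq_split x
  exact abs_le_of_sq_le_sq (by nlinarith [sq_nonneg ‖firstCoords x‖]) (norm_nonneg _)

theorem snoc_mp (n : ℕ) :
    MeasurePreserving (fun q : EV n × ℝ => snocE q.1 q.2)
      ((volume : Measure (EV n)).prod (volume : Measure ℝ)) volume := by
  have h1 : MeasurePreserving (fun q : EV n × ℝ => (q.2, (WithLp.equiv 2 (Fin n → ℝ)) q.1))
      ((volume : Measure (EV n)).prod (volume : Measure ℝ))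
      ((volume : Measure ℝ).prod (volume : Measure (Fin n → ℝ))) := by
    have a : MeasurePreserving (WithLp.equiv 2 (Fin n → ℝ))
        (volume : Measure (EV n)) (volume : Measure (Fin n → ℝ)) :=
      PiLp.volume_preserving_ofLp (Fin n)
    exact ((MeasurePreserving.id (volume : Measure ℝ)).prod a).comp Measure.measurePreserving_swap
  have h2 := (volume_preserving_piFinSuccAbove (fun _ : Fin (n + 1) => ℝ) (Fin.last n)).symm
  have h3 := PiLp.volume_preserving_toLp (Fin (n + 1))
  have h4 := h3.comp (h2.comp h1)
  have e : (fun q : EV n × ℝ => snocE q.1 q.2) = (WithLp.toLp 2 ∘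
      ⇑(MeasurableEquiv.piFinSuccAbove (fun _ => ℝ) (Fin.last n)).symm ∘ fun q =>
        (q.2, (WithLp.equiv 2 (Fin n → ℝ)) q.1)) := by
    funext q
    ext i
    refine Fin.lastCases ?_ (fun j => ?_) i
    · simp [MeasurableEquiv.piFinSuccAbove]
    · simp [MeasurableEquiv.piFinSuccAbove]
  rw [e]
  exact h4

theorem snoc_inj (n : ℕ) : Function.Injective (fun q : EV n × ℝ => snocE q.1 q.2) := by
  intro a b h
  have h1 : firstCoords (snocE a.1 a.2) = firstCoords (snocE b.1 b.2) := congrArg firstCoords h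
  have h2 : (snocE a.1 a.2) (Fin.last n) = (snocE b.1 b.2) (Fin.last n) :=
    congrArg (fun v => v (Fin.last n)) h
  simp at h1 h2
  exact Prod.ext h1 h2

theorem snoc_emb (n : ℕ) : MeasurableEmbedding (fun q : EV n × ℝ => snocE q.1 q.2) :=
  (snocL n).continuous.measurableEmbedding (snoc_inj n)

theorem lint_snoc {n : ℕ} {f : EV (n + 1) → ℝ≥0∞} (hf : Measurable f) :
    ∫⁻ x, f x = ∫⁻ z' : EV n, ∫⁻ t : ℝ, f (snocE z' t) := by
  rw [← (snoc_mp n).lintegral_comp hf, lintegral_prod]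
  exact (hf.comp (snoc_mp n).measurable).aemeasurable

theorem integral_snoc' {n : ℕ} {F : Type*} [NormedAddCommGroup F] [NormedSpace ℝ F]
    {f : EV (n + 1) → F} (hf : Integrable f) :
    ∫ x, f x = ∫ t : ℝ, ∫ z' : EV n, f (snocE z' t) := by
  rw [← (snoc_mp n).integral_comp (snoc_emb n), integral_prod_symm]
  exact ((snoc_mp n).integrable_comp_emb (snoc_emb n)).2 hf

theorem integral_snoc {n : ℕ} {F : Type*} [NormedAddCommGroup F] [NormedSpace ℝ F]
    {f : EV (n + 1) → F} (hf : Integrable f) :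
    ∫ x, f x = ∫ z' : EV n, ∫ t : ℝ, f (snocE z' t) := by
  rw [← (snoc_mp n).integral_comp (snoc_emb n), integral_prod]
  exact ((snoc_mp n).integrable_comp_emb (snoc_emb n)).2 hf

/-! ### Kernels -/

/-- The basic properties of the densities `ρ_ε`. -/
structure Ker {m : ℕ} (σ : EV m → ℝ) : Prop where
  meas : Measurable σ
  nonneg : ∀ x, 0 ≤ σ x
  even : ∀ᵐ x : EV m, σ (-x) = σ x
  int : Integrable σ

theorem Ker.kmeas {m : ℕ} {σ : EV m → ℝ} (h : Ker σ) : Measurable (kernelJ σ) := by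
  unfold kernelJ
  exact h.meas.div (by fun_prop)

theorem Ker.knonneg {m : ℕ} {σ : EV m → ℝ} (h : Ker σ) (z : EV m) : 0 ≤ kernelJ σ z :=
  div_nonneg (h.nonneg z) (by positivity)

theorem Ker.mul_sq_le {m : ℕ} {σ : EV m → ℝ} (h : Ker σ) (z : EV m) :
    kernelJ σ z * ‖z‖ ^ 2 ≤ σ z := by
  unfold kernelJ
  by_cases hz : ‖z‖ = 0
  · simp [hz, h.nonneg z]
  · rw [div_mul_cancel₀]; positivity

theorem Ker.mul_norm_le {m : ℕ} {σ : EV m → ℝ} (h : Ker σ) {r : ℝ} (hr : 0 < r) {z : EV m}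
    (hz : r ≤ ‖z‖) : kernelJ σ z * ‖z‖ ≤ r⁻¹ * σ z := by
  have h1 := h.mul_sq_le z
  have h2 := h.knonneg z
  rw [inv_mul_eq_div, le_div_iff₀ hr]
  calc kernelJ σ z * ‖z‖ * r ≤ kernelJ σ z * ‖z‖ * ‖z‖ := by gcongr
    _ ≤ σ z := by nlinarith

theorem Ker.le_of {m : ℕ} {σ : EV m → ℝ} (h : Ker σ) {r : ℝ} (hr : 0 < r) {z : EV m}
    (hz : r ≤ ‖z‖) : kernelJ σ z ≤ (r ^ 2)⁻¹ * σ z := by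
  have h1 := h.mul_sq_le z
  have h2 := h.knonneg z
  rw [inv_mul_eq_div, le_div_iff₀ (by positivity)]
  calc kernelJ σ z * r ^ 2 ≤ kernelJ σ z * ‖z‖ ^ 2 := by gcongr
    _ ≤ σ z := h1

theorem Ker.even_k {m : ℕ} {σ : EV m → ℝ} (h : Ker σ) :
    ∀ᵐ x : EV m, kernelJ σ (-x) = kernelJ σ x := by
  filter_upwards [h.even] with x hx
  simp [kernelJ, hx]

theorem ker_scaled {m : ℕ} {ρ : EV m → ℝ} (h : A1 ρ) {ε : ℝ} (hε : 0 < ε) : Ker (scaled ρ ε) := by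
  obtain ⟨h1, h2, h3, h4, h5⟩ := h
  refine ⟨?_, ?_, ?_, ?_⟩
  · unfold scaled
    exact (h1.comp (measurable_const_smul _)).const_mul _
  · intro x; unfold scaled; have := h2 (ε⁻¹ • x); positivity
  · have h6 : ∀ᵐ x : EV m, ρ (-(ε⁻¹ • x)) = ρ (ε⁻¹ • x) := by
      have : Measure.QuasiMeasurePreserving (fun x : EV m => ε⁻¹ • x) volume volume := by
        refine ⟨measurable_const_smul _, ?_⟩
        rw [Measure.map_addHaar_smul volume (inv_ne_zero hε.ne')]
        exact Measure.smul_absolutelyContinuous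
      exact this.ae h4
    filter_upwards [h6] with x hx
    simp [scaled, hx]
  · have h7 : Integrable ρ := by
      refine h5.mono' h1.aestronglyMeasurable (ae_of_all _ fun x => ?_)
      rw [Real.norm_of_nonneg (h2 x)]
      nlinarith [h2 x, norm_nonneg x]
    unfold scaled
    exact (h7.comp_smul (inv_ne_zero hε.ne')).const_mul _

theorem A1.int {m : ℕ} {ρ : EV m → ℝ} (h : A1 ρ) : Integrable ρ := by
  obtain ⟨h1, h2, h3, h4, h5⟩ := h
  refine h5.mono' h1.aestronglyMeasurable (ae_of_all _ fun x => ?_)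
  rw [Real.norm_of_nonneg (h2 x)]
  nlinarith [h2 x, norm_nonneg x]

theorem lint_scaled {m : ℕ} {ρ : EV m → ℝ} {ε : ℝ} (hε : 0 < ε)
    (g : EV m → ℝ≥0∞) :
    ∫⁻ z, ENNReal.ofReal (scaled ρ ε z) * g z = ∫⁻ w, ENNReal.ofReal (ρ w) * g (ε • w) := by
  have hm : ∫⁻ w : EV m, ENNReal.ofReal (scaled ρ ε (ε • w)) * g (ε • w)
      = ENNReal.ofReal ((ε ^ m)⁻¹) * ∫⁻ z, ENNReal.ofReal (scaled ρ ε z) * g z := by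
    have e1 := (MeasurableEquiv.smul₀ (α := EV m) ε hε.ne').measurableEmbedding.lintegral_map
      (μ := volume) (fun z => ENNReal.ofReal (scaled ρ ε z) * g z)
    have e2 : Measure.map (MeasurableEquiv.smul₀ (α := EV m) ε hε.ne') volume
        = ENNReal.ofReal |(ε ^ m)⁻¹| • (volume : Measure (EV m)) := by
      have := Measure.map_addHaar_smul (volume : Measure (EV m)) hε.ne'
      simpa using this
    rw [e2, lintegral_smul_measure, abs_of_nonneg (by positivity), smul_eq_mul] at e1
    exact e1.symm
  have e : ∀ w : EV m, ENNReal.ofReal (scaled ρ ε (ε • w)) * g (ε • w)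
      = ENNReal.ofReal ((ε ^ m)⁻¹) * (ENNReal.ofReal (ρ w) * g (ε • w)) := by
    intro w
    unfold scaled
    rw [smul_smul, inv_mul_cancel₀ hε.ne', one_smul, ENNReal.ofReal_mul (by positivity), mul_assoc]
  simp_rw [e] at hm
  rw [lintegral_const_mul' _ _ (by simp)] at hm
  have hp : 0 < ε ^ m := by positivity
  refine ((ENNReal.mul_right_inj ?_ ?_).1 hm).symm
  · simp [hp]
  · simp

/-! ### Taylor expansion -/

theorem taylor_two {m : ℕ} {u : EV m → ℝ} (hu : ContDiff ℝ 2 u) (x z : EV m) :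
    u x - u (x - z) - fderiv ℝ u x z
      = - ∫ t in (0 : ℝ)..1, (1 - t) * (fderiv ℝ (fderiv ℝ u) (x - t • z) z z) := by
  have hd : Differentiable ℝ u := hu.differentiable (by norm_num)
  have hu1 : ContDiff ℝ 1 (fderiv ℝ u) := hu.fderiv_right (by norm_num)
  have hd1 : Differentiable ℝ (fderiv ℝ u) := hu1.differentiable (by norm_num)
  have hc2 : Continuous (fderiv ℝ (fderiv ℝ u)) := hu1.continuous_fderiv (by norm_num)
  have hl : ∀ t : ℝ, HasDerivAt (fun t : ℝ => x - t • z) (-z) t := by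
    intro t
    have := ((hasDerivAt_id t).smul_const z).const_sub x
    simpa using this
  have h1 : ∀ t : ℝ, HasDerivAt (fun t : ℝ => u (x - t • z)) (fderiv ℝ u (x - t • z) (-z)) t :=
    fun t => (hd _).hasFDerivAt.comp_hasDerivAt t (hl t)
  have h2 : ∀ t : ℝ, HasDerivAt (fun t : ℝ => fderiv ℝ u (x - t • z) (-z))
      (fderiv ℝ (fderiv ℝ u) (x - t • z) (-z) (-z)) t := by
    intro t
    have a : HasDerivAt (fun t : ℝ => fderiv ℝ u (x - t • z))
      (fderiv ℝ (fderiv ℝ u) (x - t • z) (-z)) t :=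
      (hd1 _).hasFDerivAt.comp_hasDerivAt t (hl t)
    have := a.clm_apply (hasDerivAt_const t (-z))
    simpa using this
  have h3 : ∀ t : ℝ, HasDerivAt
      (fun t : ℝ => (1 - t) * fderiv ℝ u (x - t • z) (-z) + u (x - t • z))
      ((1 - t) * (fderiv ℝ (fderiv ℝ u) (x - t • z) z z)) t := by
    intro t
    have a : HasDerivAt (fun t : ℝ => 1 - t) (-1) t := by
      simpa using (hasDerivAt_id t).const_sub 1
    have := (a.mul (h2 t)).add (h1 t)
    refine this.congr_deriv ?_
    simp
  rw [intervalIntegral.integral_eq_sub_of_hasDerivAt (fun t _ => h3 t)]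
  · simp; ring
  · apply Continuous.intervalIntegrable
    fun_prop

theorem taylor_two_bound {m : ℕ} {u : EV m → ℝ} (hu : ContDiff ℝ 2 u) {C : ℝ}
    (hC : ∀ x, ‖fderiv ℝ (fderiv ℝ u) x‖ ≤ C) (x z : EV m) :
    |u x - u (x - z) - fderiv ℝ u x z| ≤ C * ‖z‖ ^ 2 := by
  rw [taylor_two hu, abs_neg]
  have := intervalIntegral.norm_integral_le_of_norm_le_const (a := (0 : ℝ)) (b := 1)
    (C := C * ‖z‖ ^ 2)
    (f := fun t => (1 - t) * (fderiv ℝ (fderiv ℝ u) (x - t • z) z z)) ?_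
  · simpa using this
  · intro t ht
    rw [Set.uIoc_of_le zero_le_one] at ht
    rw [norm_mul]
    have h1 : ‖1 - t‖ ≤ 1 := by
      rw [Real.norm_eq_abs, abs_le]; constructor <;> linarith [ht.1, ht.2]
    have h2 : ‖fderiv ℝ (fderiv ℝ u) (x - t • z) z z‖ ≤ C * ‖z‖ ^ 2 := by
      calc _ ≤ ‖fderiv ℝ (fderiv ℝ u) (x - t • z)‖ * ‖z‖ * ‖z‖ :=
            ContinuousLinearMap.le_opNorm₂ _ _ _
        _ ≤ C * ‖z‖ * ‖z‖ := by gcongr; exact hC _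
        _ = _ := by ring
    calc _ ≤ 1 * (C * ‖z‖ ^ 2) := by gcongr
      _ = _ := one_mul _

theorem hcs_fderiv {E F : Type*} [NormedAddCommGroup E] [NormedSpace ℝ E] [NormedAddCommGroup F] [NormedSpace ℝ F] {f : E → F}
    (h2 : HasCompactSupport f) : HasCompactSupport (fderiv ℝ f) := HasCompactSupport.fderiv (𝕜 := ℝ) h2
theorem bdd_gen {E F : Type*} [NormedAddCommGroup E] [NormedSpace ℝ E] [NormedAddCommGroup F] [NormedSpace ℝ F] {f : E → F}
   (hu : ContDiff ℝ 2 f) (hs : HasCompactSupport f) : ∃ C, ∀ x, ‖fderiv ℝ (fderiv ℝ f) x‖ ≤ C := by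
  have hu1 : ContDiff ℝ 1 (fderiv ℝ f) := hu.fderiv_right (by norm_num)
  have hc2 : Continuous (fderiv ℝ (fderiv ℝ f)) := hu1.continuous_fderiv (by norm_num)
  exact HasCompactSupport.exists_bound_of_continuous (hcs_fderiv (hcs_fderiv hs)) hc2
theorem exists_bound_fderiv2 {m : ℕ} {u : EV m → ℝ} (hu : ContDiff ℝ 2 u)
    (hs : HasCompactSupport u) : ∃ C, ∀ x, ‖fderiv ℝ (fderiv ℝ u) x‖ ≤ C := bdd_gen hu hs

/-! ### The principal value -/

/-- second order part of the operator -/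
def opR {m : ℕ} (Ω : Set (EV m)) (σ : EV m → ℝ) (u : EV m → ℝ) (x : EV m) : ℝ :=
  ∫ y in Ω, kernelJ σ (x - y) * (u x - u y - fderiv ℝ u x (x - y))

/-- drift part of the operator -/
def opB {m : ℕ} (Ω : Set (EV m)) (σ : EV m → ℝ) (u : EV m → ℝ) (x : EV m) : ℝ :=
  ∫ y in Ωᶜ, kernelJ σ (x - y) * (fderiv ℝ u x (x - y))

theorem Ker.int_sub {m : ℕ} {σ : EV m → ℝ} (h : Ker σ) (x : EV m) :
    Integrable (fun y => σ (x - y)) := h.int.comp_sub_left x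

theorem Ker.odd_zero {m : ℕ} {σ : EV m → ℝ} (h : Ker σ) (x : EV m) (D : EV m →L[ℝ] ℝ) (r : ℝ) :
    ∫ y in {y : EV m | r ≤ dist x y}, kernelJ σ (x - y) * D (x - y) = 0 := by
  have hS : MeasurableSet {y : EV m | r ≤ dist x y} :=
    measurableSet_le measurable_const (by fun_prop)
  rw [← integral_indicator hS]
  set F : EV m → ℝ := fun z => if r ≤ ‖z‖ then kernelJ σ z * D z else 0 with hF
  have e : (Set.indicator {y : EV m | r ≤ dist x y} fun y => kernelJ σ (x - y) * D (x - y))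
      = fun y => F (x - y) := by
    funext y
    simp [Set.indicator, hF, dist_eq_norm]
  rw [e, integral_sub_left_eq_self F]
  have h1 : ∫ z, F (-z) = ∫ z, F z := integral_neg_eq_self F volume
  have h2 : ∫ z, F (-z) = - ∫ z, F z := by
    rw [← integral_neg]
    refine integral_congr_ae ?_
    filter_upwards [h.even_k] with z hz
    simp only [hF, norm_neg, hz, map_neg]
    split_ifs <;> ring
  linarith

theorem Ker.intOn_far {m : ℕ} {σ : EV m → ℝ} (h : Ker σ) (x : EV m) (D : EV m →L[ℝ] ℝ) {r : ℝ}
    (hr : 0 < r) {S : Set (EV m)} (hS : MeasurableSet S) (hSr : ∀ y ∈ S, r ≤ dist x y) :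
    IntegrableOn (fun y => kernelJ σ (x - y) * D (x - y)) S := by
  have hm := h.kmeas
  refine Integrable.mono' (((h.int_sub x).integrableOn (s := S)).const_mul (‖D‖ * r⁻¹)) ?_ ?_
  · exact (((hm.comp (measurable_const.sub measurable_id)).mul
      (by fun_prop)).aestronglyMeasurable)
  · filter_upwards [ae_restrict_mem hS] with y hy
    have h1 : r ≤ ‖x - y‖ := by rw [← dist_eq_norm]; exact hSr y hy
    have h2 := h.mul_norm_le hr h1
    have h3 := h.knonneg (x - y)
    rw [norm_mul, Real.norm_of_nonneg h3]
    calc kernelJ σ (x - y) * ‖D (x - y)‖ ≤ kernelJ σ (x - y) * (‖D‖ * ‖x - y‖) := by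
          gcongr; exact D.le_opNorm _
      _ = ‖D‖ * (kernelJ σ (x - y) * ‖x - y‖) := by ring
      _ ≤ ‖D‖ * (r⁻¹ * σ (x - y)) := by gcongr
      _ = _ := by ring

theorem Ker.int_R {m : ℕ} {σ : EV m → ℝ} (h : Ker σ) {u : EV m → ℝ} (hu : ContDiff ℝ 2 u)
    (hs : HasCompactSupport u) (x : EV m) :
    Integrable (fun y => kernelJ σ (x - y) * (u x - u y - fderiv ℝ u x (x - y))) := by
  obtain ⟨C, hC⟩ := exists_bound_fderiv2 hu hs
  have hm := h.kmeas
  have hc := hu.continuous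
  refine Integrable.mono' ((h.int_sub x).const_mul C) ?_ (ae_of_all _ fun y => ?_)
  · exact (((hm.comp (measurable_const.sub measurable_id)).mul
      (by fun_prop)).aestronglyMeasurable)
  · have h1 := taylor_two_bound hu hC x (x - y)
    rw [show x - (x - y) = y by abel] at h1
    have h3 := h.knonneg (x - y)
    have hC0 : 0 ≤ C := le_trans (norm_nonneg (fderiv ℝ (fderiv ℝ u) 0)) (hC 0)
    rw [norm_mul, Real.norm_of_nonneg h3, Real.norm_eq_abs]
    calc _ ≤ kernelJ σ (x - y) * (C * ‖x - y‖ ^ 2) := by gcongr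
      _ = C * (kernelJ σ (x - y) * ‖x - y‖ ^ 2) := by ring
      _ ≤ C * σ (x - y) := by gcongr; exact h.mul_sq_le _

theorem pv_formula {m : ℕ} {σ : EV m → ℝ} (h : Ker σ) {Ω : Set (EV m)} (hΩ : IsOpen Ω)
    {u : EV m → ℝ} (hu : ContDiff ℝ 2 u) (hs : HasCompactSupport u) {x : EV m} (hx : x ∈ Ω) :
    Tendsto
      (fun r : ℝ =>
        ∫ y in Ω ∩ {y : EV m | r ≤ dist x y}, kernelJ σ (x - y) * (u x - u y))
      (𝓝[>] 0) (𝓝 (opR Ω σ u x - opB Ω σ u x)) := by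
  set D := fderiv ℝ u x with hD
  have hSm : ∀ r : ℝ, MeasurableSet {y : EV m | r ≤ dist x y} := fun r =>
    measurableSet_le measurable_const (by fun_prop)
  have hR := h.int_R hu hs x
  obtain ⟨r0, hr0, hball⟩ := Metric.isOpen_iff.1 hΩ x hx
  -- splitting
  have hsplit : ∀ᶠ r in 𝓝[>] (0 : ℝ),
      (∫ y in Ω ∩ {y : EV m | r ≤ dist x y}, kernelJ σ (x - y) * (u x - u y))
      = (∫ y in Ω ∩ {y : EV m | r ≤ dist x y}, kernelJ σ (x - y) * (u x - u y - D (x - y)))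
        - opB Ω σ u x := by
    filter_upwards [Ioo_mem_nhdsGT hr0] with r hr
    have i1 := h.intOn_far x D hr.1 (hSm r) (fun y hy => hy)
    have i2 : IntegrableOn (fun y => kernelJ σ (x - y) * D (x - y))
      (Ω ∩ {y : EV m | r ≤ dist x y}) := i1.mono_set Set.inter_subset_right
    have e1 : (∫ y in Ω ∩ {y : EV m | r ≤ dist x y}, kernelJ σ (x - y) * (u x - u y))
      = (∫ y in Ω ∩ {y : EV m | r ≤ dist x y}, kernelJ σ (x - y) * (u x - u y - D (x - y)))
       + ∫ y in Ω ∩ {y : EV m | r ≤ dist x y}, kernelJ σ (x - y) * D (x - y) := by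
      rw [← integral_add hR.integrableOn i2]
      refine integral_congr_ae (ae_of_all _ fun y => ?_)
      simp only; ring
    rw [e1]
    have e2 := h.odd_zero x D r
    have e3 : {y : EV m | r ≤ dist x y} = (Ω ∩ {y : EV m | r ≤ dist x y}) ∪ Ωᶜ := by
      ext y
      constructor
      · intro hy
        by_cases hyΩ : y ∈ Ω
        · exact Or.inl ⟨hyΩ, hy⟩
        · exact Or.inr hyΩ
      · rintro (hy | hy)
        · exact hy.2
        · by_contra hcon
          simp only [Set.mem_ofPred_eq, not_le] at hcon
          exact hy (hball (by rw [Metric.mem_ball, dist_comm]; exact hcon.trans hr.2))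
    have i3 : IntegrableOn (fun y => kernelJ σ (x - y) * D (x - y)) Ωᶜ :=
      i1.mono_set (by rw [e3]; exact Set.subset_union_right)
    rw [e3, setIntegral_union ?_ hΩ.measurableSet.compl i2 i3] at e2
    · unfold opB
      rw [← hD]
      linarith
    · rw [Set.disjoint_left]
      intro y hy hy2
      exact hy2 hy.1
  refine Tendsto.congr' (EventuallyEq.symm hsplit) ?_
  refine Tendsto.sub_const ?_ _
  unfold opR
  have e : ∀ r : ℝ, (∫ y in Ω ∩ {y : EV m | r ≤ dist x y},
      kernelJ σ (x - y) * (u x - u y - D (x - y)))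
      = ∫ y in Ω, Set.indicator {y : EV m | r ≤ dist x y}
        (fun y => kernelJ σ (x - y) * (u x - u y - D (x - y))) y := by
    intro r
    rw [setIntegral_indicator (hSm r)]
  simp_rw [e]
  refine tendsto_integral_filter_of_dominated_convergence
    (fun y => ‖kernelJ σ (x - y) * (u x - u y - D (x - y))‖) ?_ ?_ ?_ ?_
  · exact Eventually.of_forall fun r => (hR.integrableOn.aestronglyMeasurable.indicator (hSm r))
  · exact Eventually.of_forall fun r => ae_of_all _ fun y => norm_indicator_le_norm_self _ _
  · exact hR.norm.integrableOn
  · refine ae_of_all _ fun y => ?_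
    by_cases hxy : x = y
    · subst hxy
      have : ∀ r : ℝ, Set.indicator {y : EV m | r ≤ dist x y}
        (fun y => kernelJ σ (x - y) * (u x - u y - D (x - y))) x = 0 := by
        intro r; simp [Set.indicator]
      simp_rw [this]
      simp
    · have hd : 0 < dist x y := dist_pos.2 hxy
      refine tendsto_const_nhds.congr' ?_
      filter_upwards [Ioo_mem_nhdsGT hd] with r hr
      rw [Set.indicator_of_mem]
      exact hr.2.le

/-! ### The second order part -/

theorem eLpNorm_pow {X F : Type*} [MeasurableSpace X] [NormedAddCommGroup F] {μ : Measure X}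
    {p : ℝ≥0∞} (hp1 : 1 ≤ p) (hp : p ≠ ⊤) (f : X → F) :
    eLpNorm f p μ ^ p.toReal = ∫⁻ x, ‖f x‖ₑ ^ p.toReal ∂μ := by
  have h0 : p ≠ 0 := (zero_lt_one.trans_le hp1).ne'
  have h1 : p.toReal ≠ 0 := ENNReal.toReal_ne_zero.2 ⟨h0, hp⟩
  rw [eLpNorm_eq_lintegral_rpow_enorm_toReal h0 hp, ← ENNReal.rpow_mul, one_div_mul_cancel h1,
    ENNReal.rpow_one]

theorem one_le_toReal {p : ℝ≥0∞} (hp1 : 1 ≤ p) (hp : p ≠ ⊤) : 1 ≤ p.toReal := by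
  have := (ENNReal.toReal_le_toReal ENNReal.one_ne_top hp).2 hp1
  simpa using this

theorem kernelJ_scaled {m : ℕ} (ρ : EV m → ℝ) {ε : ℝ} (hε : 0 < ε) (z : EV m) :
    kernelJ (scaled ρ ε) z = (ε ^ m)⁻¹ * (ε ^ 2)⁻¹ * kernelJ ρ (ε⁻¹ • z) := by
  unfold kernelJ scaled
  rw [norm_smul, Real.norm_of_nonneg (inv_nonneg.2 hε.le)]
  by_cases hz : ‖z‖ = 0
  · simp [hz]
  · field_simp

theorem integral_scaled {m : ℕ} (ρ : EV m → ℝ) {ε : ℝ} (hε : 0 < ε) (F : EV m → ℝ) :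
    ∫ z, kernelJ (scaled ρ ε) z * F z = ∫ w, kernelJ ρ w * ((ε ^ 2)⁻¹ * F (ε • w)) := by
  have h := Measure.integral_comp_smul (volume : Measure (EV m))
    (fun z => kernelJ (scaled ρ ε) z * F z) ε
  have hp : 0 < ε ^ m := by positivity
  rw [show Module.finrank ℝ (EV m) = m by simp, abs_of_nonneg (by positivity), smul_eq_mul,
    inv_mul_eq_div, eq_div_iff hp.ne'] at h
  rw [← h, ← integral_mul_const]
  refine integral_congr_ae (ae_of_all _ fun w => ?_)
  simp only [kernelJ_scaled ρ hε, smul_smul, inv_mul_cancel₀ hε.ne', one_smul]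
  field_simp

theorem opR_eq {m : ℕ} {ρ : EV m → ℝ} {ε : ℝ} (hε : 0 < ε) {Ω : Set (EV m)}
    [DecidablePred (· ∈ Ω)] (hΩ : MeasurableSet Ω)
    (u : EV m → ℝ) (x : EV m) :
    opR Ω (scaled ρ ε) u x = ∫ w, kernelJ ρ w * ((if x - ε • w ∈ Ω then 1 else 0) *
      ((ε ^ 2)⁻¹ * (u x - u (x - ε • w) - fderiv ℝ u x (ε • w)))) := by
  unfold opR
  rw [← integral_indicator hΩ]
  set F : EV m → ℝ := fun z => kernelJ (scaled ρ ε) z * ((if x - z ∈ Ω then 1 else 0) *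
    (u x - u (x - z) - fderiv ℝ u x z)) with hF
  have e : (Ω.indicator fun y => kernelJ (scaled ρ ε) (x - y) * (u x - u y - fderiv ℝ u x (x - y)))
      = fun y => F (x - y) := by
    funext y
    by_cases hy : y ∈ Ω <;> simp [hF, hy]
  rw [e, integral_sub_left_eq_self F, hF, integral_scaled ρ hε]
  refine integral_congr_ae (ae_of_all _ fun w => ?_)
  simp only
  ring

/-- the quadratic form of the Hessian -/
def qd {E : Type*} [NormedAddCommGroup E] [NormedSpace ℝ E] (u : E → ℝ) (y w : E) : ℝ :=
  fderiv ℝ (fderiv ℝ u) y w w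

theorem taylor_eps {m : ℕ} {ε : ℝ} (hε : 0 < ε)
    {u : EV m → ℝ} (hu : ContDiff ℝ 2 u) (x w : EV m) :
    (ε ^ 2)⁻¹ * (u x - u (x - ε • w) - fderiv ℝ u x (ε • w))
      = - ∫ t in (0 : ℝ)..1, (1 - t) * qd u (x - (t * ε) • w) w := by
  rw [taylor_two hu, mul_neg, ← intervalIntegral.integral_const_mul]
  congr 1
  refine intervalIntegral.integral_congr fun t _ => ?_
  simp only [qd, map_smul, _root_.smul_apply, smul_eq_mul, smul_smul]
  field_simp

/-- the measure `ρ(w)dw ⊗ dt` on `ℝ^m × (0,1)` -/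
def nuM {m : ℕ} (ρ : EV m → ℝ) : Measure (EV m × ℝ) :=
  (volume.withDensity fun w => ENNReal.ofReal (ρ w)).prod (volume.restrict (Set.Ioc 0 1))

/-- total mass -/
def massR {m : ℕ} (ρ : EV m → ℝ) : ℝ≥0∞ := ∫⁻ w, ENNReal.ofReal (ρ w)

instance {m : ℕ} (ρ : EV m → ℝ) : SFinite (nuM ρ) := by unfold nuM; infer_instance

theorem nuM_univ {m : ℕ} (ρ : EV m → ℝ) : nuM ρ Set.univ = massR ρ := by
  unfold nuM massR
  rw [← Set.univ_prod_univ, Measure.prod_prod]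
  simp

theorem A1.mass {m : ℕ} {ρ : EV m → ℝ} (h : A1 ρ) : massR ρ ≠ ⊤ := by
  have := h.int.lintegral_lt_top
  exact this.ne

theorem lint_nuM {m : ℕ} {ρ : EV m → ℝ} (hρ : Measurable ρ) {g : EV m × ℝ → ℝ≥0∞}
    (hg : Measurable g) :
    ∫⁻ q, g q ∂(nuM ρ) = ∫⁻ w, ENNReal.ofReal (ρ w) * ∫⁻ t in Set.Ioc (0 : ℝ) 1, g (w, t) := by
  unfold nuM
  rw [lintegral_prod _ hg.aemeasurable, lintegral_withDensity_eq_lintegral_mul]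
  · rfl
  · exact hρ.ennreal_ofReal
  · exact Measurable.lintegral_prod_right' hg

theorem quad_bound {m : ℕ} {ρ : EV m → ℝ} (h : A1 ρ)
    (b : EV m → ℝ → ℝ) (g : EV m × ℝ → ℝ≥0∞) (hg : Measurable g)
    (hB : ∀ w t, 0 < t → t ≤ 1 → ‖b w t‖ₑ ≤ ENNReal.ofReal (‖w‖ ^ 2) * g (w, t)) :
    ‖∫ w, kernelJ ρ w * ∫ t in (0 : ℝ)..1, b w t‖ₑ ≤ ∫⁻ q, g q ∂(nuM ρ) := by
  have hk : Ker ρ := ⟨h.1, h.2.1, h.2.2.2.1, h.int⟩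
  rw [lint_nuM h.1 hg]
  refine (enorm_integral_le_lintegral_enorm _).trans (lintegral_mono fun w => ?_)
  have e1 : ‖∫ t in (0 : ℝ)..1, b w t‖ₑ
      ≤ ENNReal.ofReal (‖w‖ ^ 2) * ∫⁻ t in Set.Ioc (0 : ℝ) 1, g (w, t) := by
    have hgw : Measurable fun t => g (w, t) := hg.comp measurable_prodMk_left
    rw [intervalIntegral.integral_of_le zero_le_one, ← lintegral_const_mul _ hgw]
    refine (enorm_integral_le_lintegral_enorm _).trans ?_
    exact setLIntegral_mono' measurableSet_Ioc fun t ht => hB w t ht.1 ht.2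
  rw [enorm_mul, Real.enorm_of_nonneg (hk.knonneg w)]
  calc _ ≤ ENNReal.ofReal (kernelJ ρ w) *
        (ENNReal.ofReal (‖w‖ ^ 2) * ∫⁻ t in Set.Ioc (0 : ℝ) 1, g (w, t)) := by gcongr
    _ ≤ _ := by
      rw [← mul_assoc, ← ENNReal.ofReal_mul (hk.knonneg w)]
      gcongr
      exact hk.mul_sq_le w

theorem enorm_le_mul_ofReal {a b c : ℝ} (hb : 0 ≤ b) (h : |a| ≤ b * c) :
    ‖a‖ₑ ≤ ENNReal.ofReal b * ENNReal.ofReal c := by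
  rw [← ENNReal.ofReal_mul hb, ← ofReal_norm, Real.norm_eq_abs]
  exact ENNReal.ofReal_le_ofReal h

/-- a wrapper for the norm -/
def nrm {V : Type*} [NormedAddCommGroup V] (v : V) : ℝ := ‖v‖

theorem nrm_nonneg {V : Type*} [NormedAddCommGroup V] (v : V) : 0 ≤ nrm v := norm_nonneg v

theorem nrm_sub_le {V : Type*} [NormedAddCommGroup V] (v w : V) : nrm (v - w) ≤ nrm v + nrm w :=
  norm_sub_le v w

theorem nrm_add_le {V : Type*} [NormedAddCommGroup V] (v w : V) : nrm (v + w) ≤ nrm v + nrm w :=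
  norm_add_le v w

theorem nrm_zero {V : Type*} [NormedAddCommGroup V] : nrm (0 : V) = 0 := norm_zero

theorem cont_nrm {X V : Type*} [TopologicalSpace X] [NormedAddCommGroup V] {f : X → V}
    (hf : Continuous f) : Continuous fun x => nrm (f x) := hf.norm

theorem cs_nrm {X V : Type*} [TopologicalSpace X] [NormedAddCommGroup V] {f : X → V}
    (hf : HasCompactSupport f) : HasCompactSupport fun x => nrm (f x) := hf.norm

theorem nrm_bil {E F : Type*} [NormedAddCommGroup E] [NormedSpace ℝ E] [NormedAddCommGroup F]
    [NormedSpace ℝ F] (B : E →L[ℝ] E →L[ℝ] F) (v w : E) : ‖B v w‖ ≤ nrm B * ‖v‖ * ‖w‖ :=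
  ContinuousLinearMap.le_opNorm₂ B v w

theorem bil_bound {E : Type*} [NormedAddCommGroup E] [NormedSpace ℝ E] (B : E →L[ℝ] E →L[ℝ] ℝ)
    (w : E) : |B w w| ≤ ‖w‖ ^ 2 * nrm B := by
  have := nrm_bil B w w
  rw [Real.norm_eq_abs] at this
  calc _ ≤ nrm B * ‖w‖ * ‖w‖ := this
    _ = _ := by ring

/-- norm of the Hessian -/
def hn {E F : Type*} [NormedAddCommGroup E] [NormedSpace ℝ E] [NormedAddCommGroup F]
    [NormedSpace ℝ F] (u : E → F) (x : E) : ℝ := nrm (fderiv ℝ (fderiv ℝ u) x)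

/-- norm of the difference of Hessians -/
def hdn {E : Type*} [NormedAddCommGroup E] [NormedSpace ℝ E] (u : E → ℝ) (x y : E) : ℝ :=
  nrm (fderiv ℝ (fderiv ℝ u) x - fderiv ℝ (fderiv ℝ u) y)

section hn
variable {E : Type*} [NormedAddCommGroup E] [NormedSpace ℝ E] {u : E → ℝ}

theorem hn_nonneg (x : E) : 0 ≤ hn u x := nrm_nonneg _

theorem cont_hess (hu : ContDiff ℝ 2 u) : Continuous (fderiv ℝ (fderiv ℝ u)) := by
  have hu1 : ContDiff ℝ 1 (fderiv ℝ u) := hu.fderiv_right (by norm_num)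
  exact hu1.continuous_fderiv (by norm_num)

theorem cont_hn (hu : ContDiff ℝ 2 u) : Continuous (hn u) := cont_nrm (cont_hess hu)

theorem cont_hdn (hu : ContDiff ℝ 2 u) : Continuous (fun q : E × E => hdn u q.1 q.2) :=
  cont_nrm (((cont_hess hu).comp continuous_fst).sub ((cont_hess hu).comp continuous_snd))

theorem hdn_le (x y : E) : hdn u x y ≤ hn u x + hn u y := nrm_sub_le _ _

theorem hdn_self (x : E) : hdn u x x = 0 := by
  unfold hdn
  rw [sub_self, nrm_zero]

theorem hdn_nonneg (x y : E) : 0 ≤ hdn u x y := nrm_nonneg _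

theorem hn_bound (x w : E) : |qd u x w| ≤ ‖w‖ ^ 2 * hn u x := bil_bound _ _

theorem hdn_bound (x y w : E) :
    |qd u x w - qd u y w| ≤ ‖w‖ ^ 2 * hdn u x y :=
  bil_bound (fderiv ℝ (fderiv ℝ u) x - fderiv ℝ (fderiv ℝ u) y) w

theorem hn_cs (hs : HasCompactSupport u) : HasCompactSupport (hn u) :=
  cs_nrm (hcs_fderiv (hcs_fderiv hs))

theorem hn_bdd (hu : ContDiff ℝ 2 u) (hs : HasCompactSupport u) :
    ∃ C, 0 ≤ C ∧ ∀ x, hn u x ≤ C := by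
  obtain ⟨C, hC⟩ := bdd_gen hu hs
  exact ⟨C, le_trans (norm_nonneg (fderiv ℝ (fderiv ℝ u) 0)) (hC 0), hC⟩

end hn

theorem mul_t_bound {t a c : ℝ} (ht0 : 0 < t) (ht : t ≤ 1) (h : |a| ≤ c) : |(1 - t) * a| ≤ c := by
  rw [abs_mul]
  have h1 : |1 - t| ≤ 1 := by rw [abs_le]; constructor <;> linarith
  calc |1 - t| * |a| ≤ 1 * c := by gcongr
    _ = c := one_mul c

theorem opR_bound {m : ℕ} {ρ : EV m → ℝ} (h : A1 ρ) {p : ℝ≥0∞} (hp1 : 1 ≤ p) (hp : p ≠ ⊤)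
    {Ω : Set (EV m)} (hΩ : MeasurableSet Ω) {ε : ℝ} (hε : 0 < ε) {u : EV m → ℝ}
    (hu : ContDiff ℝ 2 u) :
    eLpNorm (opR Ω (scaled ρ ε) u) p volume ≤ massR ρ * eLpNorm (hn u) p volume := by
  classical
  have hq := one_le_toReal hp1 hp
  set q := p.toReal with hqdef
  have hq0 : 0 < q := by linarith
  have hc := cont_hn hu
  set H : EV m → EV m × ℝ → ℝ≥0∞ := fun x wt => ENNReal.ofReal (hn u (x - (wt.2 * ε) • wt.1))
    with hH
  have hHm : Measurable (Function.uncurry H) := by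
    apply Continuous.measurable
    exact ENNReal.continuous_ofReal.comp (hc.comp (by fun_prop))
  have hHx : ∀ x, Measurable (H x) := by
    intro x
    apply Continuous.measurable
    exact ENNReal.continuous_ofReal.comp (hc.comp (by fun_prop))
  have hpt : ∀ x, ‖opR Ω (scaled ρ ε) u x‖ₑ ≤ ∫⁻ z, H x z ∂(nuM ρ) := by
    intro x
    rw [opR_eq hε hΩ]
    refine le_trans (le_of_eq ?_) (quad_bound h (fun w t => (if x - ε • w ∈ Ω then (-1 : ℝ) else 0) *
      ((1 - t) * qd u (x - (t * ε) • w) w))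
      (H x) (hHx x) ?_)
    · congr 2
      ext w
      rw [taylor_eps hε hu, intervalIntegral.integral_const_mul]
      split_ifs <;> simp
    · intro w t ht0 ht
      refine enorm_le_mul_ofReal (by positivity) ?_
      have h0 := hn_nonneg (u := u) (x - (t * ε) • w)
      have h1 := mul_t_bound ht0 ht (hn_bound (u := u) (x - (t * ε) • w) w)
      split_ifs
      · rw [neg_one_mul, abs_neg]; exact h1
      · simp only [zero_mul, abs_zero]; positivity
  rw [← ENNReal.rpow_le_rpow_iff hq0, eLpNorm_pow hp1 hp, ENNReal.mul_rpow_of_nonneg _ _ hq0.le,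
    eLpNorm_pow hp1 hp]
  calc ∫⁻ x, ‖opR Ω (scaled ρ ε) u x‖ₑ ^ q ≤ ∫⁻ x, (∫⁻ z, H x z ∂(nuM ρ)) ^ q :=
        lintegral_mono fun x => ENNReal.rpow_le_rpow (hpt x) hq0.le
    _ ≤ (nuM ρ Set.univ) ^ (q - 1) * ∫⁻ z, ∫⁻ x, (H x z) ^ q ∂volume ∂(nuM ρ) :=
        jensen_double volume (nuM ρ) hHm hq
    _ = (nuM ρ Set.univ) ^ (q - 1) * ∫⁻ z, (∫⁻ x, ‖hn u x‖ₑ ^ q ∂volume) ∂(nuM ρ) := by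
        congr 1
        refine lintegral_congr fun z => ?_
        rw [← lintegral_sub_right_eq_self (fun x => ‖hn u x‖ₑ ^ q) ((z.2 * ε) • z.1)]
        refine lintegral_congr fun x => ?_
        simp only [hH]
        rw [Real.enorm_of_nonneg (hn_nonneg _)]
    _ = _ := by
        rw [lintegral_const, nuM_univ, mul_comm (∫⁻ x, ‖hn u x‖ₑ ^ q), ← mul_assoc]
        congr 1
        by_cases h0 : massR ρ = 0
        · rw [h0, mul_zero, ENNReal.zero_rpow_of_pos hq0]
        · conv_lhs => rw [← ENNReal.rpow_one (massR ρ), ← ENNReal.rpow_mul, one_mul]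
          rw [← ENNReal.rpow_add _ _ h0 h.mass]
          congr 1; ring

theorem taylor_eps_bound {m : ℕ} {ε : ℝ} (hε : 0 < ε)
    {u : EV m → ℝ} (hu : ContDiff ℝ 2 u) {C : ℝ} (hC : ∀ x, hn u x ≤ C) (x w : EV m) :
    |(ε ^ 2)⁻¹ * (u x - u (x - ε • w) - fderiv ℝ u x (ε • w))| ≤ C * ‖w‖ ^ 2 := by
  have h1 := taylor_two_bound hu hC x (ε • w)
  rw [abs_mul, abs_of_nonneg (by positivity), inv_mul_le_iff₀ (by positivity)]
  refine h1.trans (le_of_eq ?_)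
  rw [norm_smul, Real.norm_of_nonneg hε.le]
  ring

attribute [irreducible] hn hdn nrm

/-! ### Convergence of the second order part -/

/-- the Laplacian -/
def lap {m : ℕ} (u : EV m → ℝ) (x : EV m) : ℝ := ∑ i : Fin m, partialD i (partialD i u) x

theorem fderiv_partialD {m : ℕ} {u : EV m → ℝ} (hu : ContDiff ℝ 2 u) (j : Fin m) (x v : EV m) :
    fderiv ℝ (partialD j u) x v = fderiv ℝ (fderiv ℝ u) x v (EuclideanSpace.single j 1) := by
  have hu1 : ContDiff ℝ 1 (fderiv ℝ u) := hu.fderiv_right (by norm_num)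
  have hd1 : DifferentiableAt ℝ (fderiv ℝ u) x := hu1.differentiable (by norm_num) x
  have h := hd1.hasFDerivAt.clm_apply (hasFDerivAt_const (EuclideanSpace.single j (1 : ℝ)) x)
  have h2 := h.fderiv
  unfold partialD
  rw [h2]
  simp

theorem partialD_partialD {m : ℕ} {u : EV m → ℝ} (hu : ContDiff ℝ 2 u) (i j : Fin m) (x : EV m) :
    partialD i (partialD j u) x = fderiv ℝ (fderiv ℝ u) x (EuclideanSpace.single i 1)
      (EuclideanSpace.single j 1) := fderiv_partialD hu j x _

theorem sum_single {m : ℕ} (w : EV m) : w = ∑ i, w i • EuclideanSpace.single i (1 : ℝ) := by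
  ext j
  simp [Pi.single_apply]

theorem bil_expand {m : ℕ} (B : EV m →L[ℝ] EV m →L[ℝ] ℝ) (w : EV m) :
    B w w = ∑ i, ∑ j, w i * w j * B (EuclideanSpace.single i 1) (EuclideanSpace.single j 1) := by
  conv_lhs => rw [sum_single w]
  simp only [map_sum, map_smul, _root_.sum_apply, _root_.smul_apply, smul_eq_mul]
  simp only [Finset.mul_sum]
  rw [Finset.sum_comm]
  refine Finset.sum_congr rfl fun i _ => Finset.sum_congr rfl fun j _ => ?_
  ring

theorem A1.ker {m : ℕ} {ρ : EV m → ℝ} (h : A1 ρ) : Ker ρ := ⟨h.1, h.2.1, h.2.2.2.1, h.int⟩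

theorem int_moment {m : ℕ} {ρ : EV m → ℝ} (h : A1 ρ) (i j : Fin m) :
    Integrable fun z : EV m => kernelJ ρ z * z i * z j := by
  have hm := h.ker.kmeas
  refine h.int.mono' ((hm.mul (by fun_prop)).mul (by fun_prop)).aestronglyMeasurable
    (ae_of_all _ fun z => ?_)
  have h1 := h.ker.mul_sq_le z
  have h2 := h.ker.knonneg z
  rw [norm_mul, norm_mul, Real.norm_of_nonneg h2]
  calc kernelJ ρ z * ‖z i‖ * ‖z j‖ ≤ kernelJ ρ z * ‖z‖ * ‖z‖ := by
        gcongr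
        · exact PiLp.norm_apply_le z i
        · exact PiLp.norm_apply_le z j
    _ ≤ ρ z := by nlinarith

theorem lap_eq {m : ℕ} {ρ : EV m → ℝ} (h : A1 ρ) (hM : momentum ρ = 1) {u : EV m → ℝ}
    (hu : ContDiff ℝ 2 u) (x : EV m) :
    Integrable (fun w => kernelJ ρ w * (1 / 2 * qd u x w)) ∧
    lap u x = ∫ w, kernelJ ρ w * (1 / 2 * qd u x w) := by
  set B := fderiv ℝ (fderiv ℝ u) x with hB
  have e : ∀ w, kernelJ ρ w * (1 / 2 * qd u x w) = ∑ i, ∑ j, (kernelJ ρ w * w i * w j) *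
      (1 / 2 * B (EuclideanSpace.single i 1) (EuclideanSpace.single j 1)) := by
    intro w
    unfold qd
    rw [bil_expand, Finset.mul_sum, Finset.mul_sum]
    refine Finset.sum_congr rfl fun i _ => ?_
    rw [Finset.mul_sum, Finset.mul_sum]
    refine Finset.sum_congr rfl fun j _ => ?_
    ring
  have hi : ∀ i j, Integrable fun w : EV m => (kernelJ ρ w * w i * w j) *
      (1 / 2 * B (EuclideanSpace.single i 1) (EuclideanSpace.single j 1)) :=
    fun i j => (int_moment h i j).mul_const _
  simp_rw [e]
  refine ⟨integrable_finsetSum _ fun i _ => integrable_finsetSum _ fun j _ => hi i j, ?_⟩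
  rw [integral_finsetSum _ fun i _ => integrable_finsetSum _ fun j _ => hi i j]
  unfold lap
  refine Finset.sum_congr rfl fun i _ => ?_
  rw [integral_finsetSum _ fun j _ => hi i j]
  have hMij : ∀ j, (∫ w : EV m, (kernelJ ρ w * w i * w j) *
      (1 / 2 * B (EuclideanSpace.single i 1) (EuclideanSpace.single j 1)))
      = (if i = j then 1 else 0) * B (EuclideanSpace.single i 1) (EuclideanSpace.single j 1) := by
    intro j
    rw [integral_mul_const]
    have : momentum ρ i j = (if i = j then 1 else 0) := by rw [hM, Matrix.one_apply]
    rw [← this]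
    simp only [momentum, Matrix.of_apply]
    ring
  simp_rw [hMij]
  simp [partialD_partialD hu, hB]

theorem opR_lap_pt {m : ℕ} {ρ : EV m → ℝ} (h : A1 ρ) (hM : momentum ρ = 1)
    {Ω : Set (EV m)} [DecidablePred (· ∈ Ω)]
    (hΩ : MeasurableSet Ω) {ε : ℝ} (hε : 0 < ε) {u : EV m → ℝ}
    (hu : ContDiff ℝ 2 u) (hs : HasCompactSupport u) (x : EV m) :
    opR Ω (scaled ρ ε) u x + lap u x
      = ∫ w, kernelJ ρ w * ∫ t in (0 : ℝ)..1, (1 - t) *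
        (qd u x w - (if x - ε • w ∈ Ω then 1 else 0) * qd u (x - (t * ε) • w) w) := by
  obtain ⟨C, hC0, hC⟩ := hn_bdd hu hs
  obtain ⟨hi, he⟩ := lap_eq h hM hu x
  have hm := h.ker.kmeas
  have hmu : Measurable u := hu.continuous.measurable
  rw [opR_eq hε hΩ, he, ← integral_add]
  · refine integral_congr_ae (ae_of_all _ fun w => ?_)
    simp only
    rw [taylor_eps hε hu, ← mul_add]
    congr 1
    have hc : Continuous fun t : ℝ => qd u (x - (t * ε) • w) w := by
      unfold qd
      have := cont_hess hu
      fun_prop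
    have e1 : ∫ t in (0 : ℝ)..1, (1 - t) * qd u x w = 1 / 2 * qd u x w := by
      rw [intervalIntegral.integral_mul_const]
      congr 1
      rw [intervalIntegral.integral_sub (by simp) (by simp)]
      simp
      norm_num
    rw [← e1]
    have e2 : ∀ t : ℝ, (1 - t) *
        (qd u x w - (if x - ε • w ∈ Ω then 1 else 0) * qd u (x - (t * ε) • w) w)
        = (1 - t) * qd u x w - (if x - ε • w ∈ Ω then 1 else 0) *
          ((1 - t) * qd u (x - (t * ε) • w) w) := by intro t; ring
    simp_rw [e2]
    rw [intervalIntegral.integral_sub, intervalIntegral.integral_const_mul]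
    · ring
    · apply Continuous.intervalIntegrable; fun_prop
    · apply Continuous.intervalIntegrable; fun_prop
  · refine (h.int.const_mul C).mono' ?_ (ae_of_all _ fun w => ?_)
    · refine (hm.mul (Measurable.mul ?_ (by fun_prop))).aestronglyMeasurable
      refine Measurable.ite ?_ measurable_const measurable_const
      exact hΩ.preimage (by fun_prop : Measurable fun w : EV m => x - ε • w)
    · have h1 := taylor_eps_bound hε hu hC x w
      have h2 := h.ker.knonneg w
      have h3 := h.ker.mul_sq_le w
      rw [norm_mul, norm_mul, Real.norm_of_nonneg h2, Real.norm_eq_abs, Real.norm_eq_abs]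
      have h4 : |(if x - ε • w ∈ Ω then (1 : ℝ) else 0)| ≤ 1 := by split_ifs <;> simp
      calc _ ≤ kernelJ ρ w * (1 * (C * ‖w‖ ^ 2)) := by gcongr
        _ = C * (kernelJ ρ w * ‖w‖ ^ 2) := by ring
        _ ≤ _ := by gcongr
  · exact hi

set_option maxHeartbeats 400000 in
theorem opR_conv {m : ℕ} {ρ : EV m → ℝ} (h : A1 ρ) (hM : momentum ρ = 1)
    {p : ℝ≥0∞} (hp1 : 1 ≤ p) (hp : p ≠ ⊤) {Ω : Set (EV m)} (hΩ : IsOpen Ω) {u : EV m → ℝ}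
    (hu : ContDiff ℝ 2 u) (hs : HasCompactSupport u) :
    Tendsto (fun ε => eLpNorm (fun x => opR Ω (scaled ρ ε) u x + lap u x) p (volume.restrict Ω))
      (𝓝[>] 0) (𝓝 0) := by
  classical
  have hq := one_le_toReal hp1 hp
  set q := p.toReal with hqdef
  have hq0 : 0 < q := by linarith
  have hc := cont_hn hu
  have hcd := cont_hdn hu
  have hΩm := hΩ.measurableSet
  set H : ℝ → EV m → EV m × ℝ → ℝ := fun ε x wt => if x - ε • wt.1 ∈ Ω then
    hdn u (x - (wt.2 * ε) • wt.1) x else hn u x with hH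
  have hH0 : ∀ ε x wt, 0 ≤ H ε x wt := by
    intro ε x wt
    simp only [hH]
    split_ifs
    · exact hdn_nonneg _ _
    · exact hn_nonneg _
  have hHm : ∀ ε, Measurable (Function.uncurry (H ε)) := by
    intro ε
    refine Measurable.ite ?_ ?_ ?_
    · exact hΩm.preimage (by fun_prop : Measurable fun a : EV m × (EV m × ℝ) => a.1 - ε • a.2.1)
    · exact (hcd.comp (by fun_prop : Continuous fun a : EV m × (EV m × ℝ) =>
        ((a.1 - (a.2.2 * ε) • a.2.1, a.1) : EV m × EV m))).measurable
    · exact (hc.comp continuous_fst).measurable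
  have hHmx : ∀ ε x, Measurable (H ε x) := by
    intro ε x
    exact (hHm ε).comp (measurable_prodMk_left (x := x))
  have hHmz : ∀ ε z, Measurable (fun x => H ε x z) := by
    intro ε z
    exact (hHm ε).comp (measurable_prodMk_right (y := z))
  have hpt : ∀ ε, 0 < ε → ∀ x, ‖opR Ω (scaled ρ ε) u x + lap u x‖ₑ
      ≤ ∫⁻ z, ENNReal.ofReal (H ε x z) ∂(nuM ρ) := by
    intro ε hε x
    rw [opR_lap_pt h hM hΩm hε hu hs]
    refine quad_bound h _ (fun z => ENNReal.ofReal (H ε x z)) (hHmx ε x).ennreal_ofReal ?_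
    intro w t ht0 ht
    refine enorm_le_mul_ofReal (by positivity) (mul_t_bound ht0 ht ?_)
    simp only [hH]
    split_ifs
    · rw [abs_sub_comm, one_mul]
      exact hdn_bound _ _ _
    · rw [zero_mul, sub_zero]
      exact hn_bound _ _
  -- bounds
  obtain ⟨C, hC0, hC⟩ := hn_bdd hu hs
  have hHle : ∀ ε x z, H ε x z ≤ hn u (x - (z.2 * ε) • z.1) + hn u x := by
    intro ε x z
    simp only [hH]
    have := hn_nonneg (u := u) (x - (z.2 * ε) • z.1)
    split_ifs
    · exact hdn_le _ _
    · linarith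
  set I : ℝ≥0∞ := ∫⁻ x, ENNReal.ofReal (hn u x) ^ q with hI
  have hIfin : I ≠ ⊤ := by
    have hmem : MemLp (hn u) p volume := hc.memLp_of_hasCompactSupport (hn_cs hs)
    have h2 := hmem.eLpNorm_lt_top
    have h3 := eLpNorm_pow (μ := volume) hp1 hp (hn u)
    have h4 : I = eLpNorm (hn u) p volume ^ q := by
      rw [h3]
      refine lintegral_congr fun x => ?_
      rw [Real.enorm_of_nonneg (hn_nonneg x)]
    rw [h4]
    exact ENNReal.rpow_ne_top_of_nonneg hq0.le h2.ne
  set Kc : ℝ≥0∞ := 2 ^ (q - 1) * (I + I) with hKc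
  have hmx : Measurable fun x : EV m => ENNReal.ofReal (hn u x) ^ q :=
    (hc.measurable.ennreal_ofReal).pow_const q
  have hbd : ∀ ε z, ∫⁻ x in Ω, ENNReal.ofReal (H ε x z) ^ q ≤ Kc := by
    intro ε z
    calc ∫⁻ x in Ω, ENNReal.ofReal (H ε x z) ^ q ≤ ∫⁻ x, ENNReal.ofReal (H ε x z) ^ q :=
          setLIntegral_le_lintegral _ _
      _ ≤ ∫⁻ x, 2 ^ (q - 1) * (ENNReal.ofReal (hn u (x - (z.2 * ε) • z.1)) ^ q
            + ENNReal.ofReal (hn u x) ^ q) := by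
          refine lintegral_mono fun x => ?_
          refine le_trans ?_ (ENNReal.rpow_add_le_mul_rpow_add_rpow _ _ hq)
          refine ENNReal.rpow_le_rpow ?_ hq0.le
          rw [← ENNReal.ofReal_add (hn_nonneg _) (hn_nonneg _)]
          exact ENNReal.ofReal_le_ofReal (hHle ε x z)
      _ = Kc := by
          rw [lintegral_const_mul' _ _ (by simp), lintegral_add_right _ hmx,
            lintegral_sub_right_eq_self (fun x => ENNReal.ofReal (hn u x) ^ q)]
  have hKfin : Kc ≠ ⊤ := by
    refine ENNReal.mul_ne_top (by simp) (by simp [hIfin])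
  -- inner convergence
  have hin : ∀ z : EV m × ℝ, z.2 ∈ Set.Ioc (0 : ℝ) 1 →
      Tendsto (fun ε => ∫⁻ x in Ω, ENNReal.ofReal (H ε x z) ^ q) (𝓝[>] 0) (𝓝 0) := by
    intro z hz
    obtain ⟨R, hR⟩ := (hn_cs hs).isCompact.isBounded.subset_closedBall (0 : EV m)
    have hzero : ∀ x, R < ‖x‖ → hn u x = 0 := by
      intro x hx
      by_contra hne
      have := hR (subset_tsupport _ hne)
      rw [Metric.mem_closedBall, dist_zero_right] at this
      linarith
    have key := tendsto_lintegral_filter_of_dominated_convergence (μ := volume.restrict Ω)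
      (l := 𝓝[>] (0 : ℝ)) (F := fun ε x => ENNReal.ofReal (H ε x z) ^ q) (f := fun _ => 0)
      ((Metric.closedBall (0 : EV m) (R + ‖z.1‖)).indicator fun _ => ENNReal.ofReal (C + C) ^ q)
      (Eventually.of_forall fun ε => ((hHmz ε z).ennreal_ofReal).pow_const q) ?_ ?_ ?_
    · simpa using key
    · filter_upwards [Ioo_mem_nhdsGT (zero_lt_one : (0 : ℝ) < 1)] with ε hε
      refine ae_of_all _ fun x => ?_
      have h1 := hHle ε x z
      by_cases hx : x ∈ Metric.closedBall (0 : EV m) (R + ‖z.1‖)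
      · rw [Set.indicator_of_mem hx]
        refine ENNReal.rpow_le_rpow (ENNReal.ofReal_le_ofReal ?_) hq0.le
        linarith [hC x, hC (x - (z.2 * ε) • z.1)]
      · rw [Set.indicator_of_notMem hx]
        rw [Metric.mem_closedBall, dist_zero_right, not_le] at hx
        have h2 : hn u x = 0 := hzero x (by linarith [norm_nonneg z.1])
        have h3 : hn u (x - (z.2 * ε) • z.1) = 0 := by
          apply hzero
          have h4 : ‖(z.2 * ε) • z.1‖ ≤ ‖z.1‖ := by
            rw [norm_smul, Real.norm_of_nonneg (mul_nonneg hz.1.le hε.1.le)]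
            have : z.2 * ε ≤ 1 := by nlinarith [hz.1, hz.2, hε.1, hε.2]
            nlinarith [norm_nonneg z.1]
          have h5 := norm_sub_norm_le x ((z.2 * ε) • z.1)
          linarith
        rw [h2, h3, add_zero] at h1
        rw [ENNReal.ofReal_of_nonpos h1, ENNReal.zero_rpow_of_pos hq0]
    · rw [lintegral_indicator Metric.isClosed_closedBall.measurableSet]
      simp only [lintegral_const]
      refine ENNReal.mul_ne_top (ENNReal.rpow_ne_top_of_nonneg hq0.le ENNReal.ofReal_ne_top) ?_
      rw [Measure.restrict_apply_univ]
      refine ne_top_of_le_ne_top ?_ (Measure.restrict_apply_le _ _)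
      exact measure_closedBall_lt_top.ne
    · filter_upwards [ae_restrict_mem hΩm] with x hx
      have t1 : Tendsto (fun ε : ℝ => x - ε • z.1) (𝓝[>] 0) (𝓝 x) := by
        have : Continuous fun ε : ℝ => x - ε • z.1 := by fun_prop
        have := this.tendsto 0
        simp only [zero_smul, sub_zero] at this
        exact this.mono_left nhdsWithin_le_nhds
      have t2 : ∀ᶠ ε in 𝓝[>] (0 : ℝ), H ε x z = hdn u (x - (z.2 * ε) • z.1) x := by
        filter_upwards [t1 (hΩ.mem_nhds hx)] with ε hε
        simp only [hH]
        exact if_pos hε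
      have t3 : Tendsto (fun ε : ℝ => hdn u (x - (z.2 * ε) • z.1) x) (𝓝[>] 0) (𝓝 0) := by
        have c1 : Continuous fun ε : ℝ => ((x - (z.2 * ε) • z.1, x) : EV m × EV m) := by fun_prop
        have c2 := (hcd.comp c1).tendsto 0
        simp only [Function.comp_apply, mul_zero, zero_smul, sub_zero, hdn_self] at c2
        exact c2.mono_left nhdsWithin_le_nhds
      have t4 : Tendsto (fun ε => H ε x z) (𝓝[>] 0) (𝓝 0) :=
        t3.congr' (EventuallyEq.symm t2)
      have t5 := ((ENNReal.continuous_rpow_const (y := q)).comp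
        ENNReal.continuous_ofReal).continuousAt.tendsto.comp t4
      simpa [Function.comp_def, ENNReal.zero_rpow_of_pos hq0] using t5
  have hmz : ∀ ε, Measurable fun z => ∫⁻ x in Ω, ENNReal.ofReal (H ε x z) ^ q := by
    intro ε
    have : Measurable (Function.uncurry fun x z => ENNReal.ofReal (H ε x z) ^ q) :=
      ((hHm ε).ennreal_ofReal).pow_const q
    exact this.lintegral_prod_left
  have hae : ∀ᵐ z ∂(nuM ρ), z.2 ∈ Set.Ioc (0 : ℝ) 1 := by
    unfold nuM
    have : ∀ᵐ t ∂(volume.restrict (Set.Ioc (0 : ℝ) 1)), t ∈ Set.Ioc (0 : ℝ) 1 :=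
      ae_restrict_mem measurableSet_Ioc
    exact Measure.quasiMeasurePreserving_snd.ae this
  have hout : Tendsto (fun ε => ∫⁻ z, (∫⁻ x in Ω, ENNReal.ofReal (H ε x z) ^ q) ∂(nuM ρ))
      (𝓝[>] 0) (𝓝 0) := by
    have key := tendsto_lintegral_filter_of_dominated_convergence (μ := nuM ρ)
      (l := 𝓝[>] (0 : ℝ)) (F := fun ε z => ∫⁻ x in Ω, ENNReal.ofReal (H ε x z) ^ q)
      (f := fun _ => 0) (fun _ => Kc) (Eventually.of_forall hmz)
      (Eventually.of_forall fun ε => ae_of_all _ fun z => hbd ε z) ?_ ?_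
    · simpa using key
    · rw [lintegral_const, nuM_univ]
      exact ENNReal.mul_ne_top hKfin h.mass
    · filter_upwards [hae] with z hz
      exact hin z hz
  have hfin : Tendsto (fun ε => (massR ρ) ^ (q - 1) *
      ∫⁻ z, (∫⁻ x in Ω, ENNReal.ofReal (H ε x z) ^ q) ∂(nuM ρ)) (𝓝[>] 0) (𝓝 0) := by
    have := ENNReal.Tendsto.const_mul (a := (massR ρ) ^ (q - 1)) hout
      (Or.inr (ENNReal.rpow_ne_top_of_nonneg (by linarith) h.mass))
    simpa using this
  have hroot := ((ENNReal.continuous_rpow_const (y := 1 / q)).tendsto 0).comp hfin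
  rw [ENNReal.zero_rpow_of_pos (by positivity)] at hroot
  refine tendsto_of_tendsto_of_tendsto_of_le_of_le' tendsto_const_nhds hroot
    (Eventually.of_forall fun _ => zero_le) ?_
  filter_upwards [self_mem_nhdsWithin] with ε hε
  have h1 : eLpNorm (fun x => opR Ω (scaled ρ ε) u x + lap u x) p (volume.restrict Ω) ^ q
      ≤ (massR ρ) ^ (q - 1) * ∫⁻ z, (∫⁻ x in Ω, ENNReal.ofReal (H ε x z) ^ q) ∂(nuM ρ) := by
    rw [eLpNorm_pow hp1 hp, ← nuM_univ]
    refine le_trans ?_ (jensen_double (volume.restrict Ω) (nuM ρ)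
      (h := fun x z => ENNReal.ofReal (H ε x z)) (hHm ε).ennreal_ofReal hq)
    exact lintegral_mono fun x => ENNReal.rpow_le_rpow (hpt ε hε x) hq0.le
  have h2 := ENNReal.rpow_le_rpow h1 (by positivity : 0 ≤ 1 / q)
  rw [← ENNReal.rpow_mul, mul_one_div_cancel hq0.ne', ENNReal.rpow_one] at h2
  exact h2

/-! ### Near-boundary kernel mass -/

def hfun (c₀ α N : ℝ) (n : ℕ) (r : ℝ) : ℝ := c₀ * r ^ (-α - n) * (1 + r) ^ (-N)

theorem hfun_nonneg {c₀ α N : ℝ} (hc : 0 < c₀) (n : ℕ) {r : ℝ} (hr : 0 ≤ r) :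
    0 ≤ hfun c₀ α N n r := by unfold hfun; positivity

theorem hfun_anti {c₀ α N : ℝ} (hc : 0 < c₀) (hα : 0 < α) (hN : 0 < N) (n : ℕ) {r s : ℝ}
    (hr : 0 < r) (hrs : r ≤ s) : hfun c₀ α N n s ≤ hfun c₀ α N n r := by
  unfold hfun
  have h1 : s ^ (-α - n) ≤ r ^ (-α - n) :=
    Real.rpow_le_rpow_of_nonpos hr hrs (by have : (0 : ℝ) ≤ n := by positivity
                                           linarith)
  have h2 : (1 + s) ^ (-N) ≤ (1 + r) ^ (-N) :=
    Real.rpow_le_rpow_of_nonpos (by linarith) (by linarith) (by linarith)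
  have h3 : 0 ≤ (1 + s) ^ (-N) := Real.rpow_nonneg (by linarith) _
  gcongr

theorem hfun_int {c₀ α N : ℝ} (hα2 : α < 2) (hN : 3 - α < N) (n : ℕ) :
    Integrable (fun w : EV n => ‖w‖ ^ 2 * hfun c₀ α N n ‖w‖) := by
  rcases Nat.eq_zero_or_pos n with rfl | hn
  · exact Integrable.of_finite
  have : Nonempty (Fin n) := ⟨⟨0, hn⟩⟩
  have : Nontrivial (EV n) := inferInstance
  rw [integrable_fun_norm_addHaar (μ := volume) (E := EV n)
    (f := fun r : ℝ => r ^ 2 * hfun c₀ α N n r)]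
  have e : Set.EqOn (fun r : ℝ => c₀ * (r ^ (1 - α) * (1 + r) ^ (-N)))
      (fun y : ℝ => y ^ (Module.finrank ℝ (EV n) - 1) • (y ^ 2 * hfun c₀ α N n y)) (Set.Ioi 0) := by
    intro r hr
    have hr : 0 < r := hr
    simp only [hfun, smul_eq_mul, finrank_euclideanSpace, Fintype.card_fin]
    have e1 : r ^ (1 - α) = r ^ (n - 1) * r ^ 2 * r ^ (-α - n) := by
      rw [← pow_add, ← Real.rpow_natCast, ← Real.rpow_add hr]
      congr 1
      push_cast [Nat.cast_sub hn]
      ring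
    rw [e1]; ring
  refine IntegrableOn.congr_fun ?_ e measurableSet_Ioi
  refine Integrable.const_mul ?_ c₀
  rw [← Set.Ioc_union_Ioi_eq_Ioi (zero_le_one (α := ℝ))]
  have hm : Measurable fun r : ℝ => r ^ (1 - α) * (1 + r) ^ (-N) := by fun_prop
  refine IntegrableOn.union ?_ ?_
  · have h1 : IntegrableOn (fun r : ℝ => r ^ (1 - α)) (Set.Ioc 0 1) :=
      (intervalIntegrable_iff_integrableOn_Ioc_of_le zero_le_one).1
        (intervalIntegral.intervalIntegrable_rpow' (by linarith))
    refine Integrable.mono' h1 hm.aestronglyMeasurable ?_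
    filter_upwards [ae_restrict_mem measurableSet_Ioc] with r hr
    have h0 : 0 ≤ r ^ (1 - α) := Real.rpow_nonneg hr.1.le _
    have h2 : (1 + r) ^ (-N) ≤ 1 :=
      Real.rpow_le_one_of_one_le_of_nonpos (by linarith [hr.1]) (by linarith)
    have h3 : 0 ≤ (1 + r) ^ (-N) := Real.rpow_nonneg (by linarith [hr.1]) _
    rw [Real.norm_of_nonneg (by positivity)]
    nlinarith
  · have h1 : IntegrableOn (fun r : ℝ => r ^ (1 - α - N)) (Set.Ioi 1) :=
      integrableOn_Ioi_rpow_of_lt (by linarith) one_pos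
    refine Integrable.mono' h1 hm.aestronglyMeasurable ?_
    filter_upwards [ae_restrict_mem measurableSet_Ioi] with r hr
    have hr : 1 < r := hr
    have h0 : 0 ≤ r ^ (1 - α) := Real.rpow_nonneg (by linarith) _
    have h3 : 0 ≤ (1 + r) ^ (-N) := Real.rpow_nonneg (by linarith) _
    have h2 : (1 + r) ^ (-N) ≤ r ^ (-N) :=
      Real.rpow_le_rpow_of_nonpos (by linarith) (by linarith) (by linarith)
    rw [Real.norm_of_nonneg (by positivity), sub_eq_add_neg (1 - α) N,
      Real.rpow_add (by linarith)]
    gcongr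

theorem near_bound {n : ℕ} {ρ : EV (n + 1) → ℝ} (h1 : A1 ρ) (h2 : A2 ρ) (K : ℝ) (hK : 0 ≤ K) :
    ∃ C : ℝ≥0∞, C ≠ ⊤ ∧ ∀ (ε : ℝ), 0 < ε → ∀ (s : ℝ) (l : EV n →L[ℝ] ℝ),
      ∫⁻ z in {z : EV (n + 1) | |z (Fin.last n) - s - l (firstCoords z)| ≤ K * ‖firstCoords z‖ ^ 2},
        ENNReal.ofReal (kernelJ (scaled ρ ε) z * ‖z‖) ≤ C := by
  obtain ⟨-, ⟨c₀, c₁, α, N, hc, -, hα, hα2, hN, hb⟩, -⟩ := h2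
  have hi := hfun_int (c₀ := c₀) hα2 hN n
  refine ⟨∫⁻ w : EV n, ENNReal.ofReal (2 * K * (‖w‖ ^ 2 * hfun c₀ α N n ‖w‖)), ?_, ?_⟩
  · exact ((hi.const_mul (2 * K)).lintegral_lt_top).ne
  intro ε hε s l
  have hk := ker_scaled h1 hε
  set S := {z : EV (n + 1) | |z (Fin.last n) - s - l (firstCoords z)| ≤ K * ‖firstCoords z‖ ^ 2}
    with hS
  have hfc : Measurable (fun z : EV (n + 1) => firstCoords z) := (fcL n).measurable
  have hla : Measurable (fun z : EV (n + 1) => z (Fin.last n)) := (lastL n).measurable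
  have hSm : MeasurableSet S := by
    refine measurableSet_le ?_ ?_
    · exact ((hla.sub_const s).sub (l.measurable.comp hfc)).norm
    · exact (hfc.norm.pow_const 2).const_mul K
  have hm : Measurable fun z => ENNReal.ofReal (kernelJ (scaled ρ ε) z * ‖z‖) :=
    (hk.kmeas.mul measurable_norm).ennreal_ofReal
  rw [← lintegral_indicator hSm, lint_snoc (hm.indicator hSm)]
  have hsc := lint_scaled (ρ := fun w : EV n => 2 * K * (‖w‖ ^ 2 * hfun c₀ α N n ‖w‖)) hε
    (fun _ => 1)
  simp only [mul_one] at hsc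
  rw [← hsc]
  refine lintegral_mono fun z' => ?_
  have hpt : ∀ t : ℝ, z' ≠ 0 → kernelJ (scaled ρ ε) (snocE z' t) * ‖snocE z' t‖
      ≤ (ε ^ (n + 1))⁻¹ * ε⁻¹ * hfun c₀ α N n (ε⁻¹ * ‖z'‖) := by
    intro t hz'
    set w := ε⁻¹ • snocE z' t with hw
    have hz0 : 0 < ‖z'‖ := norm_pos_iff.2 hz'
    have hle : ‖z'‖ ≤ ‖snocE z' t‖ := by
      have := norm_firstCoords_le (snocE z' t)
      simpa using this
    have hwn : ‖w‖ = ε⁻¹ * ‖snocE z' t‖ := by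
      rw [hw, norm_smul, Real.norm_of_nonneg (by positivity)]
    have hw0 : 0 < ‖w‖ := by rw [hwn]; exact mul_pos (inv_pos.2 hε) (hz0.trans_le hle)
    have hbw := (hb w (norm_pos_iff.1 hw0)).1
    have hst : ‖snocE z' t‖ = ε * ‖w‖ := by rw [hwn]; field_simp
    rw [kernelJ_scaled ρ hε, ← hw, hst]
    have hJ : kernelJ ρ w * ‖w‖ ≤ hfun c₀ α N n ‖w‖ := by
      have e : kernelJ ρ w * ‖w‖ = ρ w / ‖w‖ := by unfold kernelJ; field_simp
      rw [e, div_le_iff₀ hw0]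
      refine (le_abs_self _).trans (hbw.trans (le_of_eq ?_))
      unfold hfun
      have : ‖w‖ ^ ((2 : ℝ) - α - (n + 1 : ℝ)) = ‖w‖ ^ (-α - n) * ‖w‖ := by
        rw [← Real.rpow_add_one hw0.ne']; congr 1; ring
      rw [this]; ring
    have h3 : hfun c₀ α N n ‖w‖ ≤ hfun c₀ α N n (ε⁻¹ * ‖z'‖) := by
      refine hfun_anti hc hα (by linarith) n (by positivity) ?_
      rw [hwn]; gcongr
    calc (ε ^ (n + 1))⁻¹ * (ε ^ 2)⁻¹ * kernelJ ρ w * (ε * ‖w‖)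
        = (ε ^ (n + 1))⁻¹ * ε⁻¹ * (kernelJ ρ w * ‖w‖) := by field_simp
      _ ≤ _ := by gcongr; exact hJ.trans h3
  have hset : ∀ t : ℝ, snocE z' t ∈ S ↔ t ∈ Metric.closedBall (s + l z') (K * ‖z'‖ ^ 2) := by
    intro t
    simp [hS, Metric.mem_closedBall, Real.dist_eq, sub_sub]
  calc ∫⁻ t : ℝ, S.indicator (fun z => ENNReal.ofReal (kernelJ (scaled ρ ε) z * ‖z‖)) (snocE z' t)
      ≤ ∫⁻ t in Metric.closedBall (s + l z') (K * ‖z'‖ ^ 2),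
        ENNReal.ofReal (kernelJ (scaled ρ ε) (snocE z' t) * ‖snocE z' t‖) := by
        rw [← lintegral_indicator Metric.isClosed_closedBall.measurableSet]
        refine lintegral_mono fun t => ?_
        by_cases ht : snocE z' t ∈ S
        · rw [Set.indicator_of_mem ht, Set.indicator_of_mem ((hset t).1 ht)]
        · rw [Set.indicator_of_notMem ht]; exact zero_le
    _ ≤ _ := ?_
  by_cases hz' : z' = 0
  · refine le_trans (le_of_eq ?_) (zero_le)
    apply setLIntegral_measure_zero
    rw [Real.volume_closedBall]; simp [hz']
  · calc _ ≤ ∫⁻ t in Metric.closedBall (s + l z') (K * ‖z'‖ ^ 2),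
        ENNReal.ofReal ((ε ^ (n + 1))⁻¹ * ε⁻¹ * hfun c₀ α N n (ε⁻¹ * ‖z'‖)) :=
          lintegral_mono fun t => ENNReal.ofReal_le_ofReal (hpt t hz')
      _ = ENNReal.ofReal ((ε ^ (n + 1))⁻¹ * ε⁻¹ * hfun c₀ α N n (ε⁻¹ * ‖z'‖))
          * ENNReal.ofReal (2 * (K * ‖z'‖ ^ 2)) := by
          rw [setLIntegral_const, Real.volume_closedBall]
      _ = _ := by
          have hh := hfun_nonneg (α := α) (N := N) hc n (r := ε⁻¹ * ‖z'‖) (by positivity)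
          rw [← ENNReal.ofReal_mul (by positivity)]
          congr 1
          simp only [scaled]
          rw [norm_smul, Real.norm_of_nonneg (by positivity : (0 : ℝ) ≤ ε⁻¹)]
          generalize hfun c₀ α N n (ε⁻¹ * ‖z'‖) = X
          field_simp
          ring

theorem exists_rot {n : ℕ} {e : EV (n+1)} (he : ‖e‖ = 1) (hl : 0 < e (Fin.last n)) :
    ∃ (T : EV (n+1) ≃ₗᵢ[ℝ] EV (n+1)) (Q : Matrix (Fin (n+1)) (Fin (n+1)) ℝ), Qᵀ * Q = 1 ∧ Q.det = 1 ∧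
      (∀ x, mulVecE Q x = T x) ∧ T (EuclideanSpace.single (Fin.last n) 1) = e := by
  set a : EV (n+1) := EuclideanSpace.single (Fin.last n) 1 with ha
  have ha1 : ‖a‖ = 1 := by simp [ha]
  set b := -a - e with hb
  have hb0 : b ≠ 0 := by
    intro h
    have : b (Fin.last n) = 0 := by rw [h]; rfl
    simp [hb, ha] at this
    linarith
  have ha0 : a ≠ 0 := by intro h; simp [h] at ha1
  set Ra := (Submodule.span ℝ {a})ᗮ.reflection
  set Rb := (Submodule.span ℝ {b})ᗮ.reflection
  set T := Ra.trans Rb with hT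
  set v := EuclideanSpace.basisFun (Fin (n+1)) ℝ
  set Q := LinearMap.toMatrix v.toBasis v.toBasis T.toLinearMap with hQ
  have hd : ∀ c : EV (n+1), c ≠ 0 →
      LinearMap.det ((Submodule.span ℝ {c})ᗮ.reflection).toLinearMap = (-1 : ℝ) := by
    intro c hc
    rw [Submodule.det_reflection, Submodule.orthogonal_orthogonal, finrank_span_singleton hc, pow_one]
  refine ⟨T, Q, ?_, ?_, ?_, ?_⟩
  · have := T.toMatrix_mem_unitaryGroup v v
    rw [Matrix.mem_unitaryGroup_iff', Matrix.star_eq_conjTranspose,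
      Matrix.conjTranspose_eq_transpose_of_trivial] at this
    exact this
  · rw [hQ, LinearMap.det_toMatrix]
    have : T.toLinearMap = Rb.toLinearMap ∘ₗ Ra.toLinearMap := rfl
    rw [this, LinearMap.det_comp, hd a ha0, hd b hb0]; norm_num
  · intro x
    have := LinearMap.toMatrix_mulVec_repr v.toBasis v.toBasis T.toLinearMap x
    unfold mulVecE
    ext i
    have h2 := congrFun this i
    have h3 : ⇑(v.toBasis.repr x) = x.ofLp := by ext j; simp [v]
    rw [h3] at h2
    simpa [v, hQ] using h2
  · show Rb (Ra a) = e
    have h1 : Ra a = -a := Submodule.reflection_orthogonalComplement_singleton_eq_neg a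
    rw [h1]
    exact Submodule.reflection_sub (by rw [norm_neg, ha1, he])

theorem sqrt_one {n : ℕ} {A : Matrix (Fin n) (Fin n) ℝ} (hA : A.PosDef) (h : A * A = 1) : A = 1 := by
  have h1 : (A + 1).PosDef := hA.add Matrix.PosDef.one
  have h2 := h1.isUnit
  have h3 : (A + 1) * (A - 1) = 0 := by
    rw [add_mul, mul_sub, mul_one, one_mul, h]; abel
  have := h2.mul_left_cancel (b := A - 1) (c := 0) (by rw [h3, mul_zero])
  exact sub_eq_zero.1 this

theorem cancel_one {n : ℕ} {ρ : EV (n + 1) → ℝ} (h1 : A1 ρ) (h2 : A2 ρ) (hM : momentum ρ = 1)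
    {e : EV (n + 1)} (he : ‖e‖ = 1) (hl : 0 < e (Fin.last n)) (G : EV (n + 1) →L[ℝ] ℝ)
    (hG : G e = 0) {s : ℝ} (hs : 0 < s) :
    ∫ z in {z : EV (n + 1) | s ≤ inner ℝ e z}, kernelJ ρ z * G z = 0 := by
  obtain ⟨-, -, A, hA, hAA, hc⟩ := h2
  obtain rfl : A = 1 := sqrt_one hA (hAA.trans hM)
  obtain ⟨T, Q, hQ1, hQ2, hQT, hTe⟩ := exists_rot he hl
  have hk := h1.ker
  set S := {z : EV (n + 1) | s ≤ inner ℝ e z} with hS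
  have hSm : MeasurableSet S := measurableSet_le measurable_const (by fun_prop)
  have hSr : ∀ z ∈ S, s ≤ ‖z‖ := by
    intro z hz
    have : inner ℝ e z ≤ ‖e‖ * ‖z‖ := real_inner_le_norm e z
    rw [he, one_mul] at this
    exact le_trans hz this
  have hNint : Integrable (S.indicator fun z => kernelJ ρ z * ‖z‖) := by
    rw [integrable_indicator_iff hSm]
    refine Integrable.mono' ((hk.int.integrableOn (s := S)).const_mul s⁻¹)
      (hk.kmeas.mul measurable_norm).aestronglyMeasurable ?_
    filter_upwards [ae_restrict_mem hSm] with z hz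
    rw [Real.norm_of_nonneg (mul_nonneg (hk.knonneg z) (norm_nonneg z))]
    exact hk.mul_norm_le hs (hSr z hz)
  have hGint : Integrable (S.indicator fun z => kernelJ ρ z * G z) := by
    refine Integrable.mono' (hNint.const_mul ‖G‖)
      ((hk.kmeas.mul G.measurable).indicator hSm).aestronglyMeasurable (ae_of_all _ fun z => ?_)
    by_cases hz : z ∈ S
    · simp only [Set.indicator_of_mem hz]
      rw [norm_mul, Real.norm_of_nonneg (hk.knonneg z)]
      have := mul_le_mul_of_nonneg_left (G.le_opNorm z) (hk.knonneg z)
      linarith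
    · simp [Set.indicator_of_notMem hz]
  rw [← integral_indicator hSm]
  have hmp := T.measurePreserving
  rw [← hmp.integral_comp T.toHomeomorph.measurableEmbedding]
  have hGi2 : Integrable (fun y => (S.indicator fun z => kernelJ ρ z * G z) (T y)) :=
    (hmp.integrable_comp_emb T.toHomeomorph.measurableEmbedding).2 hGint
  have hNi2 : Integrable (fun y => (S.indicator fun z => kernelJ ρ z * ‖z‖) (T y)) :=
    (hmp.integrable_comp_emb T.toHomeomorph.measurableEmbedding).2 hNint
  have hNi3 := (((snoc_mp n).integrable_comp_emb (snoc_emb n)).2 hNi2).prod_left_ae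
  rw [integral_snoc' hGi2]
  have hz : ∀ᵐ t : ℝ, ∫ z' : EV n, (S.indicator fun z => kernelJ ρ z * G z) (T (snocE z' t)) = 0 := by
    filter_upwards [hNi3] with t ht
    have hmem : ∀ z' : EV n, T (snocE z' t) ∈ S ↔ s ≤ t := by
      intro z'
      show s ≤ inner ℝ e (T (snocE z' t)) ↔ s ≤ t
      rw [← hTe, T.inner_map_map, EuclideanSpace.inner_single_left]
      simp
    by_cases hst : s ≤ t
    · set l : EV n →L[ℝ] ℝ := (G.comp (T.toContinuousLinearEquiv : EV (n+1) →L[ℝ] EV (n+1))).comp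
        ((snocL n).comp (ContinuousLinearMap.inl ℝ (EV n) ℝ)) with hldef
      have hGl : ∀ z' : EV n, G (T (snocE z' t)) = l z' := by
        intro z'
        have e1 : snocE z' t = snocE z' 0 + t • (EuclideanSpace.single (Fin.last n) 1 : EV (n+1)) := by
          ext i
          refine Fin.lastCases ?_ (fun j => ?_) i
          · simp
          · simp
        rw [e1, map_add, map_smul, map_add, map_smul, hTe, hG]
        simp [hldef]
      have hi : Integrable (fun z' : EV n => kernelJ ρ (T (snocE z' t)) • z') := by
        refine Integrable.mono' ht ?_ (ae_of_all _ fun z' => ?_)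
        · have m1 : Measurable (fun z' : EV n => T (snocE z' t)) := by
            have : Continuous (fun z' : EV n => snocL n (z', t)) := by fun_prop
            exact (T.continuous.comp this).measurable
          exact ((hk.kmeas.comp m1).smul measurable_id).aestronglyMeasurable
        · simp only [Function.comp, Set.indicator_of_mem ((hmem z').2 hst)]
          rw [norm_smul, Real.norm_of_nonneg (hk.knonneg _), T.norm_map]
          refine mul_le_mul_of_nonneg_left ?_ (hk.knonneg _)
          have := norm_firstCoords_le (snocE z' t)
          simpa using this
      have h0 := hc t Q hQ1 hQ2
      simp only [one_mul, hQT] at h0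
      have h5 := l.integral_comp_comm hi
      rw [h0, map_zero] at h5
      rw [← h5]
      refine integral_congr_ae (ae_of_all _ fun z' => ?_)
      simp only [Set.indicator_of_mem ((hmem z').2 hst)]
      rw [map_smul, hGl, smul_eq_mul]
    · have : ∀ z' : EV n, (S.indicator fun z => kernelJ ρ z * G z) (T (snocE z' t)) = 0 :=
        fun z' => Set.indicator_of_notMem (fun h => hst ((hmem z').1 h)) _
      simp [this]
  rw [integral_congr_ae hz]; simp

theorem cancel_eps {n : ℕ} {ρ : EV (n + 1) → ℝ} (h1 : A1 ρ) (h2 : A2 ρ) (hM : momentum ρ = 1)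
    {e : EV (n + 1)} (he : ‖e‖ = 1) (hl : 0 < e (Fin.last n)) (G : EV (n + 1) →L[ℝ] ℝ)
    (hG : G e = 0) {s : ℝ} (hs : 0 < s) {ε : ℝ} (hε : 0 < ε) :
    ∫ z in {z : EV (n + 1) | s ≤ inner ℝ e z}, kernelJ (scaled ρ ε) z * G z = 0 := by
  have hSm : ∀ s : ℝ, MeasurableSet {z : EV (n + 1) | s ≤ inner ℝ e z} := fun s =>
    measurableSet_le measurable_const (by fun_prop)
  have h := cancel_one h1 h2 hM he hl G hG (s := s / ε) (by positivity)
  rw [← integral_indicator (hSm _)] at h ⊢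
  have e1 : ({z : EV (n + 1) | s ≤ inner ℝ e z}.indicator fun z => kernelJ (scaled ρ ε) z * G z)
      = fun z => kernelJ (scaled ρ ε) z * ({z : EV (n + 1) | s ≤ inner ℝ e z}.indicator G z) := by
    ext z
    by_cases hz : z ∈ {z : EV (n + 1) | s ≤ inner ℝ e z}
    · simp only [Set.indicator_of_mem hz]
    · simp only [Set.indicator_of_notMem hz, mul_zero]
  rw [e1, integral_scaled ρ hε]
  have e2 : ∀ w, kernelJ ρ w * ((ε ^ 2)⁻¹ * {z : EV (n + 1) | s ≤ inner ℝ e z}.indicator G (ε • w))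
      = ε⁻¹ * ({z : EV (n + 1) | s / ε ≤ inner ℝ e z}.indicator (fun z => kernelJ ρ z * G z) w) := by
    intro w
    have hm : ε • w ∈ {z : EV (n + 1) | s ≤ inner ℝ e z} ↔ w ∈ {z : EV (n + 1) | s / ε ≤ inner ℝ e z} := by
      simp only [Set.mem_ofPred_eq, inner_smul_right]
      rw [div_le_iff₀ hε, mul_comm]
    by_cases hz : w ∈ {z : EV (n + 1) | s / ε ≤ inner ℝ e z}
    · rw [Set.indicator_of_mem hz, Set.indicator_of_mem (hm.2 hz), map_smul, smul_eq_mul]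
      field_simp
    · rw [Set.indicator_of_notMem hz, Set.indicator_of_notMem (fun h => hz (hm.1 h))]; simp
  simp only [e2]
  rw [integral_const_mul, h, mul_zero]

/-- geometric hypotheses on the graph function -/
structure GH {n : ℕ} (γ : EV n → ℝ) (K : ℝ) : Prop where
  c3 : ContDiff ℝ 3 γ
  K0 : 0 ≤ K
  bd : ∀ x, |γ x| ≤ 1 / 8
  d1 : ∀ x, ‖fderiv ℝ γ x‖ ≤ 1 / 8
  d2 : ∀ x, hn γ x ≤ K
  d3 : ∀ x, hn (fderiv ℝ γ) x ≤ K

theorem GH.taylor {n : ℕ} {γ : EV n → ℝ} {K : ℝ} (h : GH γ K) (x z : EV n) :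
    |γ x - γ (x - z) - fderiv ℝ γ x z| ≤ K * ‖z‖ ^ 2 :=
  taylor_two_bound (h.c3.of_le (by norm_num)) (fun x => by have := h.d2 x; unfold hn nrm at this; exact this) x z

theorem GH.diff {n : ℕ} {γ : EV n → ℝ} {K : ℝ} (h : GH γ K) : Differentiable ℝ γ :=
  h.c3.differentiable (by norm_num)

theorem GH.lip {n : ℕ} {γ : EV n → ℝ} {K : ℝ} (h : GH γ K) (x y : EV n) :
    |γ x - γ y| ≤ 1 / 8 * ‖x - y‖ := by
  have := Convex.norm_image_sub_le_of_norm_fderiv_le (𝕜 := ℝ) (f := γ) (s := Set.univ)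
    (fun z _ => h.diff z) (fun z _ => h.d1 z) convex_univ (Set.mem_univ y) (Set.mem_univ x)
  simpa using this

theorem inner_split {n : ℕ} (x y : EV (n + 1)) :
    inner ℝ x y = inner ℝ (firstCoords x) (firstCoords y) + x (Fin.last n) * y (Fin.last n) := by
  simp only [PiLp.inner_apply, Fin.sum_univ_castSucc, firstCoords_apply]
  simp [mul_comm]

/-- (unnormalized) normal vector -/
def Nvec {n : ℕ} (γ : EV n → ℝ) (x' : EV n) : EV (n + 1) :=
  snocE (-((InnerProductSpace.toDual ℝ (EV n)).symm (fderiv ℝ γ x'))) 1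

theorem inner_Nvec {n : ℕ} (γ : EV n → ℝ) (x' : EV n) (z : EV (n + 1)) :
    inner ℝ (Nvec γ x') z = z (Fin.last n) - fderiv ℝ γ x' (firstCoords z) := by
  rw [inner_split, Nvec]
  simp [sub_eq_add_neg, add_comm]

theorem norm_Nvec_ge {n : ℕ} (γ : EV n → ℝ) (x' : EV n) : 1 ≤ ‖Nvec γ x'‖ := by
  have := abs_last_le (Nvec γ x')
  simpa [Nvec] using this

theorem GH.norm_Nvec_le {n : ℕ} {γ : EV n → ℝ} {K : ℝ} (h : GH γ K) (x' : EV n) :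
    ‖Nvec γ x'‖ ≤ 2 := by
  have h1 := norm_snocE_sq (-((InnerProductSpace.toDual ℝ (EV n)).symm (fderiv ℝ γ x'))) 1
  rw [norm_neg, LinearIsometryEquiv.norm_map] at h1
  have h2 := h.d1 x'
  have h3 := norm_nonneg (fderiv ℝ γ x')
  unfold Nvec
  nlinarith [norm_nonneg (snocE (-((InnerProductSpace.toDual ℝ (EV n)).symm (fderiv ℝ γ x'))) 1)]

def Bf {m : ℕ} (σ : EV m → ℝ) (r : ℝ) : ℝ≥0∞ :=
  ∫⁻ z in {z : EV m | r ≤ ‖z‖}, ENNReal.ofReal (kernelJ σ z * ‖z‖)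

theorem meas_far {m : ℕ} (r : ℝ) : MeasurableSet {z : EV m | r ≤ ‖z‖} :=
  measurableSet_le measurable_const (by fun_prop)

theorem enorm_kG_le {m : ℕ} {σ : EV m → ℝ} (h : Ker σ) (G : EV m →L[ℝ] ℝ) (z : EV m) :
    ‖kernelJ σ z * G z‖ₑ ≤ ‖G‖ₑ * ENNReal.ofReal (kernelJ σ z * ‖z‖) := by
  rw [← ofReal_norm, ← ofReal_norm, ← ENNReal.ofReal_mul (norm_nonneg _)]
  apply ENNReal.ofReal_le_ofReal
  rw [norm_mul, Real.norm_of_nonneg (h.knonneg z)]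
  nlinarith [G.le_opNorm z, h.knonneg z]

theorem Ker.int_far {m : ℕ} {σ : EV m → ℝ} (h : Ker σ) (G : EV m →L[ℝ] ℝ) {r : ℝ} (hr : 0 < r)
    {S : Set (EV m)} (hS : MeasurableSet S) (hSr : ∀ z ∈ S, r ≤ ‖z‖) :
    IntegrableOn (fun z => kernelJ σ z * G z) S := by
  have h2 := h.intOn_far (0 : EV m) G hr (S := -S) hS.neg (fun y hy => by
    have := hSr _ hy
    rw [norm_neg] at this; rwa [dist_zero_left])
  have h3 := (Measure.measurePreserving_neg (volume : Measure (EV m))).integrableOn_comp_preimage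
    (MeasurableEquiv.neg (EV m)).measurableEmbedding
    (f := fun z => kernelJ σ z * G z) (s := S)
  rw [← h3]
  refine h2.congr_fun (fun y _ => ?_) hS.neg
  simp

theorem opB_eq {m : ℕ} {Ω : Set (EV m)} (hΩ : MeasurableSet Ω) (σ : EV m → ℝ) (u : EV m → ℝ)
    (x : EV m) : opB Ω σ u x = ∫ z in {z | x - z ∉ Ω}, kernelJ σ z * fderiv ℝ u x z := by
  have hS : MeasurableSet {z | x - z ∉ Ω} := (measurable_const.sub measurable_id) hΩ.compl
  unfold opB
  rw [← integral_indicator hΩ.compl, ← integral_indicator hS,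
    ← integral_sub_left_eq_self _ volume x]
  congr 1; ext z
  by_cases hz : x - z ∈ Ω
  · rw [Set.indicator_of_notMem (by simpa using hz), Set.indicator_of_notMem (by simpa using hz)]
  · rw [Set.indicator_of_mem (by simpa using hz), Set.indicator_of_mem (by simpa using hz)]
    simp

theorem halfSpace_open {n : ℕ} {γ : EV n → ℝ} (h : Continuous γ) : IsOpen (halfSpace γ) := by
  have h1 : Continuous (fun x : EV (n + 1) => γ (firstCoords x)) := h.comp (fcL n).continuous
  exact isOpen_lt h1 (lastL n).continuous

theorem opB_pt {n : ℕ} {ρ : EV (n + 1) → ℝ} (h1 : A1 ρ) (h2 : A2 ρ) (hM : momentum ρ = 1)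
    {γ : EV n → ℝ} {K : ℝ} (hg : GH γ K) {C : ℝ≥0∞}
    (hC : ∀ (ε : ℝ), 0 < ε → ∀ (s : ℝ) (l : EV n →L[ℝ] ℝ),
      ∫⁻ z in {z : EV (n + 1) | |z (Fin.last n) - s - l (firstCoords z)| ≤ K * ‖firstCoords z‖ ^ 2},
        ENNReal.ofReal (kernelJ (scaled ρ ε) z * ‖z‖) ≤ C)
    {ε : ℝ} (hε : 0 < ε) (u : EV (n + 1) → ℝ) {x : EV (n + 1)} (hx : x ∈ halfSpace γ) :
    ‖opB (halfSpace γ) (scaled ρ ε) u x‖ₑ ≤ 2 * C * ‖fderiv ℝ u x‖ₑ +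
      ‖fderiv ℝ u x (Nvec γ (firstCoords x))‖ₑ *
        Bf (scaled ρ ε) ((x (Fin.last n) - γ (firstCoords x)) / 2) := by
  have hk := ker_scaled h1 hε
  set d := x (Fin.last n) - γ (firstCoords x) with hd
  have hd0 : 0 < d := sub_pos.2 hx
  have hΩ := (halfSpace_open hg.diff.continuous).measurableSet
  set x' := firstCoords x with hx'
  set D := fderiv ℝ u x with hD
  set N := Nvec γ x' with hN
  have hN1 := norm_Nvec_ge γ x'
  rw [← hN] at hN1
  set e := (‖N‖)⁻¹ • N with he
  have he1 : ‖e‖ = 1 := by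
    rw [he, norm_smul, norm_inv, norm_norm, inv_mul_cancel₀ (by linarith)]
  have hel : 0 < e (Fin.last n) := by
    simp only [he, hN, Nvec, PiLp.smul_apply, snocE_last, smul_eq_mul, mul_one]
    exact inv_pos.2 (by rw [hN, Nvec] at hN1; linarith)
  set G := D - D e • innerSL ℝ e with hG
  have hGe : G e = 0 := by
    simp [hG, he1]
  have hGn : ‖G‖ ≤ 2 * ‖D‖ := by
    have a1 : ‖D e • innerSL ℝ e‖ ≤ ‖D‖ := by
      rw [norm_smul, innerSL_apply_norm, he1, mul_one]
      have := D.le_opNorm e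
      rwa [he1, mul_one] at this
    have a2 := norm_sub_le D (D e • innerSL ℝ e)
    linarith
  rw [opB_eq hΩ]
  set S := {z | x - z ∉ halfSpace γ} with hS
  have hSm : MeasurableSet S := (measurable_const.sub measurable_id) hΩ.compl
  set P := {z : EV (n + 1) | d / ‖N‖ ≤ inner ℝ e z} with hP
  have hPm : MeasurableSet P := measurableSet_le measurable_const (by fun_prop)
  have hfs : ∀ z, firstCoords (x - z) = x' - firstCoords z := fun z => map_sub (fcL n) x z
  have hSmem : ∀ z, z ∈ S ↔ d + γ x' - γ (x' - firstCoords z) ≤ z (Fin.last n) := by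
    intro z
    simp only [hS, halfSpace, Set.mem_ofPred_eq, not_lt, hfs, PiLp.sub_apply, hd]
    constructor <;> intro h <;> linarith
  have hPmem : ∀ z, z ∈ P ↔ d ≤ z (Fin.last n) - fderiv ℝ γ x' (firstCoords z) := by
    intro z
    rw [← inner_Nvec, ← hN]
    simp only [hP, Set.mem_ofPred_eq, he, inner_smul_left]
    simp only [conj_trivial, inv_mul_eq_div]
    rw [div_le_div_iff_of_pos_right (by linarith)]
  have hSr : ∀ z ∈ S, d / 2 ≤ ‖z‖ := by
    intro z hz
    have b1 := (hSmem z).1 hz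
    have b2 := hg.lip x' (x' - firstCoords z)
    rw [sub_sub_cancel x' (firstCoords z)] at b2
    have b3 := norm_firstCoords_le z
    have b4 := (abs_le.1 (abs_last_le z)).2
    have b5 := (abs_le.1 b2).1
    have := norm_nonneg z
    linarith
  have hPr : ∀ z ∈ P, d / 2 ≤ ‖z‖ := by
    intro z hz
    have b1 := (hPmem z).1 hz
    have b3 := norm_firstCoords_le z
    have b4 := (abs_le.1 (abs_last_le z)).2
    have b2 := (fderiv ℝ γ x').le_opNorm (firstCoords z)
    have b6 := hg.d1 x'
    have b5 := (abs_le.1 (Real.norm_eq_abs _ ▸ b2)).1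
    have := norm_nonneg z
    nlinarith [norm_nonneg (firstCoords z), norm_nonneg (fderiv ℝ γ x')]
  have hIS : ∀ F : EV (n + 1) →L[ℝ] ℝ, IntegrableOn (fun z => kernelJ (scaled ρ ε) z * F z) S :=
    fun F => hk.int_far F (by positivity) hSm hSr
  have hIP : ∀ F : EV (n + 1) →L[ℝ] ℝ, IntegrableOn (fun z => kernelJ (scaled ρ ε) z * F z) P :=
    fun F => hk.int_far F (by positivity) hPm hPr
  have hsplit : ∫ z in S, kernelJ (scaled ρ ε) z * D z
      = (∫ z in S, kernelJ (scaled ρ ε) z * G z)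
        + D e * ∫ z in S, kernelJ (scaled ρ ε) z * innerSL ℝ e z := by
    rw [← integral_const_mul, ← integral_add (hIS G) ((hIS _).const_mul _)]
    congr 1; ext z
    simp [hG]; ring
  have hcan : ∫ z in P, kernelJ (scaled ρ ε) z * G z = 0 :=
    cancel_eps h1 h2 hM he1 hel G hGe (by positivity) hε
  have hm : Measurable fun z => ENNReal.ofReal (kernelJ (scaled ρ ε) z * ‖z‖) :=
    (hk.kmeas.mul measurable_norm).ennreal_ofReal
  have hfirst : ‖∫ z in S, kernelJ (scaled ρ ε) z * G z‖ₑ ≤ ‖G‖ₑ * C := by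
    rw [← sub_zero (∫ z in S, kernelJ (scaled ρ ε) z * G z), ← hcan, ← integral_indicator hSm,
      ← integral_indicator hPm, ← integral_sub ((integrable_indicator_iff hSm).2 (hIS G))
        ((integrable_indicator_iff hPm).2 (hIP G))]
    refine (enorm_integral_le_lintegral_enorm _).trans ?_
    refine le_trans ?_ (mul_le_mul_right (hC ε hε d (fderiv ℝ γ x')) ‖G‖ₑ)
    set E := {z : EV (n + 1) | |z (Fin.last n) - d - fderiv ℝ γ x' (firstCoords z)|
      ≤ K * ‖firstCoords z‖ ^ 2} with hE
    have hEm : MeasurableSet E := by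
      have hfc : Measurable (fun z : EV (n + 1) => firstCoords z) := (fcL n).measurable
      have hla : Measurable (fun z : EV (n + 1) => z (Fin.last n)) := (lastL n).measurable
      refine measurableSet_le ?_ ?_
      · exact ((hla.sub_const d).sub ((fderiv ℝ γ x').measurable.comp hfc)).norm
      · exact (hfc.norm.pow_const 2).const_mul K
    rw [← lintegral_const_mul _ hm, ← lintegral_indicator hEm]
    refine lintegral_mono fun z => ?_
    have hEz : z ∈ E ↔ |z (Fin.last n) - d - fderiv ℝ γ x' (firstCoords z)|
      ≤ K * ‖firstCoords z‖ ^ 2 := Iff.rfl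
    have ht := abs_le.1 (hg.taylor x' (firstCoords z))
    by_cases hzS : z ∈ S <;> by_cases hzP : z ∈ P
    · simp [hzS, hzP]
    · have : z ∈ E := by
        have b1 := (hSmem z).1 hzS
        have b2 := fun h => hzP ((hPmem z).2 h)
        rw [hEz, abs_le]
        have b2 := not_le.1 b2
        constructor <;> linarith
      rw [Set.indicator_of_mem hzS, Set.indicator_of_notMem hzP, Set.indicator_of_mem this, sub_zero]
      exact enorm_kG_le hk G z
    · have : z ∈ E := by
        have b1 := fun h => hzS ((hSmem z).2 h)
        have b2 := (hPmem z).1 hzP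
        rw [hEz, abs_le]
        have b1 := not_le.1 b1
        constructor <;> linarith
      rw [Set.indicator_of_notMem hzS, Set.indicator_of_mem hzP, Set.indicator_of_mem this, zero_sub,
        enorm_neg]
      exact enorm_kG_le hk G z
    · simp [hzS, hzP]
  have hsecond : ‖∫ z in S, kernelJ (scaled ρ ε) z * innerSL ℝ e z‖ₑ ≤ Bf (scaled ρ ε) (d / 2) := by
    refine (enorm_integral_le_lintegral_enorm _).trans ?_
    unfold Bf
    refine (lintegral_mono fun z => enorm_kG_le hk (innerSL ℝ e) z).trans ?_
    have : ‖innerSL ℝ e‖ₑ = 1 := by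
      rw [← ofReal_norm, innerSL_apply_norm, he1, ENNReal.ofReal_one]
    simp only [this, one_mul]
    exact lintegral_mono_set hSr
  rw [hsplit]
  refine (enorm_add_le _ _).trans (add_le_add ?_ ?_)
  · refine hfirst.trans ?_
    rw [mul_comm, mul_right_comm, mul_comm _ C]
    gcongr
    have := ENNReal.ofReal_le_ofReal hGn
    rwa [ENNReal.ofReal_mul (by norm_num), ENNReal.ofReal_ofNat, ofReal_norm, ofReal_norm] at this
  · rw [enorm_mul]
    gcongr
    rw [he, map_smul, smul_eq_mul, enorm_mul]
    have hone : ‖‖N‖⁻¹‖ₑ ≤ 1 := ?_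
    · calc ‖‖N‖⁻¹‖ₑ * ‖D N‖ₑ ≤ 1 * ‖D N‖ₑ := by gcongr
        _ = _ := one_mul _
    rw [← ofReal_norm, norm_inv, norm_norm, ENNReal.ofReal_le_one]
    exact inv_le_one_of_one_le₀ hN1

theorem Ker.mN {m : ℕ} {σ : EV m → ℝ} (h : Ker σ) :
    Measurable fun z => ENNReal.ofReal (kernelJ σ z * ‖z‖) :=
  (h.kmeas.mul measurable_norm).ennreal_ofReal

theorem Bf_anti {m : ℕ} (σ : EV m → ℝ) : Antitone (Bf σ) := by
  intro r s hrs
  exact lintegral_mono_set (fun z (hz : s ≤ ‖z‖) => hrs.trans hz)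

theorem mass_scaled {m : ℕ} {ρ : EV m → ℝ} {ε : ℝ} (hε : 0 < ε) :
    ∫⁻ z, ENNReal.ofReal (scaled ρ ε z) = massR ρ := by
  have := lint_scaled (ρ := ρ) hε (fun _ => 1)
  simpa [massR] using this

theorem Bf_mul_le {m : ℕ} {σ : EV m → ℝ} (h : Ker σ) {r : ℝ} (hr : 0 < r) :
    ENNReal.ofReal r * Bf σ r ≤ ∫⁻ z, ENNReal.ofReal (σ z) := by
  unfold Bf
  rw [← lintegral_const_mul _ h.mN]
  refine le_trans ?_ (setLIntegral_le_lintegral {z : EV m | r ≤ ‖z‖} _)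
  refine setLIntegral_mono h.meas.ennreal_ofReal fun z hz => ?_
  rw [← ENNReal.ofReal_mul hr.le]
  apply ENNReal.ofReal_le_ofReal
  have := mul_le_mul_of_nonneg_left (h.mul_norm_le hr hz) hr.le
  rwa [← mul_assoc r r⁻¹, mul_inv_cancel₀ hr.ne', one_mul] at this

theorem Bf_int {m : ℕ} {σ : EV m → ℝ} (h : Ker σ) :
    ∫⁻ s in Set.Ioi (0 : ℝ), Bf σ (s / 2) ≤ 2 * ∫⁻ z, ENNReal.ofReal (σ z) := by
  set F : ℝ × EV m → ℝ≥0∞ := {q : ℝ × EV m | q.1 / 2 ≤ ‖q.2‖}.indicator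
    (fun q => ENNReal.ofReal (kernelJ σ q.2 * ‖q.2‖)) with hF
  have hFm : Measurable F := by
    refine (h.mN.comp measurable_snd).indicator (measurableSet_le ?_ ?_)
    · exact measurable_fst.div_const 2
    · exact measurable_snd.norm
  have e1 : ∀ s : ℝ, Bf σ (s / 2) = ∫⁻ z, F (s, z) := by
    intro s
    unfold Bf
    rw [← lintegral_indicator (meas_far _)]
    rfl
  simp only [e1]
  rw [lintegral_lintegral_swap (f := fun s z => F (s, z)) hFm.aemeasurable,
    ← lintegral_const_mul _ h.meas.ennreal_ofReal]
  refine lintegral_mono fun z => ?_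
  calc ∫⁻ s in Set.Ioi (0 : ℝ), F (s, z)
      ≤ ∫⁻ s in Set.Ioi (0 : ℝ), (Set.Iic (2 * ‖z‖)).indicator
          (fun _ => ENNReal.ofReal (kernelJ σ z * ‖z‖)) s := by
        refine lintegral_mono fun s => ?_
        by_cases hs : s / 2 ≤ ‖z‖
        · have : s ∈ Set.Iic (2 * ‖z‖) := by simp only [Set.mem_Iic]; linarith
          have hs' : (s, z) ∈ {q : ℝ × EV m | q.1 / 2 ≤ ‖q.2‖} := hs
          rw [Set.indicator_of_mem this, hF, Set.indicator_of_mem hs']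
        · have hs' : (s, z) ∉ {q : ℝ × EV m | q.1 / 2 ≤ ‖q.2‖} := hs
          rw [hF, Set.indicator_of_notMem hs']; exact zero_le
    _ = ENNReal.ofReal (kernelJ σ z * ‖z‖) * ENNReal.ofReal (2 * ‖z‖) := by
        rw [lintegral_indicator measurableSet_Iic, setLIntegral_const,
          Measure.restrict_apply measurableSet_Iic, Set.inter_comm, Set.Ioi_inter_Iic,
          Real.volume_Ioc, sub_zero]
    _ ≤ 2 * ENNReal.ofReal (σ z) := by
        rw [← ENNReal.ofReal_mul (mul_nonneg (h.knonneg z) (norm_nonneg z))]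
        have h0 : kernelJ σ z * ‖z‖ * (2 * ‖z‖) ≤ 2 * σ z := by nlinarith [h.mul_sq_le z]
        have := ENNReal.ofReal_le_ofReal h0
        rwa [ENNReal.ofReal_mul (p := 2) (by norm_num : (0:ℝ) ≤ 2), ENNReal.ofReal_ofNat] at this

/-- last unit vector -/
def eN (n : ℕ) : EV (n + 1) := EuclideanSpace.single (Fin.last n) 1

@[simp] theorem eN_last {n : ℕ} : eN n (Fin.last n) = 1 := by simp [eN]
@[simp] theorem eN_castSucc {n : ℕ} (i : Fin n) : eN n i.castSucc = 0 := by simp [eN]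
theorem norm_eN {n : ℕ} : ‖eN n‖ = 1 := by simp [eN]
@[simp] theorem firstCoords_eN {n : ℕ} : firstCoords (eN n) = 0 := by ext i; simp
@[simp] theorem firstCoords_add_smul {n : ℕ} (x : EV (n + 1)) (s : ℝ) :
    firstCoords (x + s • eN n) = firstCoords x := by ext i; simp
@[simp] theorem firstCoords_sub_smul {n : ℕ} (x : EV (n + 1)) (s : ℝ) :
    firstCoords (x - s • eN n) = firstCoords x := by ext i; simp

/-- the vertical distance to the graph -/
def dG {n : ℕ} (γ : EV n → ℝ) (x : EV (n + 1)) : ℝ := x (Fin.last n) - γ (firstCoords x)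

theorem dG_cont {n : ℕ} {γ : EV n → ℝ} (h : Continuous γ) : Continuous (dG γ) :=
  (lastL n).continuous.sub (h.comp (fcL n).continuous)

theorem dG_add {n : ℕ} (γ : EV n → ℝ) (x : EV (n + 1)) (s : ℝ) :
    dG γ (x + s • eN n) = dG γ x + s := by
  simp [dG]; ring

theorem mem_half {n : ℕ} {γ : EV n → ℝ} {x : EV (n + 1)} : x ∈ halfSpace γ ↔ 0 < dG γ x := by
  show γ (firstCoords x) < x (Fin.last n) ↔ 0 < x (Fin.last n) - γ (firstCoords x)
  exact sub_pos.symm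

/-- Hardy type operator -/
def hardy {n : ℕ} (γ : EV n → ℝ) (σ : EV (n + 1) → ℝ) (g : EV (n + 1) → ℝ≥0∞) (x : EV (n + 1)) :
    ℝ≥0∞ := Bf σ (dG γ x / 2) * ∫⁻ s in Set.Ioc 0 (dG γ x), g (x - s • eN n)

theorem hardy_bound {n : ℕ} {γ : EV n → ℝ} (hγ : Continuous γ) {σ : EV (n + 1) → ℝ} (h : Ker σ)
    {g : EV (n + 1) → ℝ≥0∞} (hg : Measurable g) {q : ℝ} (hq : 1 ≤ q)
    (hM : ∫⁻ z, ENNReal.ofReal (σ z) ≠ ⊤) :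
    ∫⁻ x in halfSpace γ, hardy γ σ g x ^ q
      ≤ (2 * ∫⁻ z, ENNReal.ofReal (σ z)) ^ q * ∫⁻ x, g x ^ q := by
  set M := ∫⁻ z, ENNReal.ofReal (σ z) with hMdef
  have hΩ := (halfSpace_open hγ).measurableSet
  have hBm : Measurable (Bf σ) := (Bf_anti σ).measurable
  have hdm := (dG_cont hγ).measurable
  set F : EV (n + 1) × ℝ → ℝ≥0∞ := {w : EV (n + 1) × ℝ | w.2 ≤ dG γ w.1}.indicator
    (fun w => Bf σ (dG γ w.1 / 2) * g (w.1 - w.2 • eN n) ^ q) with hF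
  have hsub : Measurable fun w : EV (n + 1) × ℝ => w.1 - w.2 • eN n := by fun_prop
  have hFm : Measurable F := by
    refine Measurable.indicator ?_ (measurableSet_le measurable_snd (hdm.comp measurable_fst))
    exact ((hBm.comp ((hdm.comp measurable_fst).div_const 2)).mul ((hg.comp hsub).pow_const q))
  have hpt : ∀ x ∈ halfSpace γ, hardy γ σ g x ^ q
      ≤ (2 * M) ^ (q - 1) * ∫⁻ s in Set.Ioi (0 : ℝ), F (x, s) := by
    intro x hx
    have hd : 0 < dG γ x := mem_half.1 hx
    have hgx : Measurable fun s : ℝ => g (x - s • eN n) :=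
      hg.comp (by fun_prop)
    set ν := Bf σ (dG γ x / 2) • (volume.restrict (Set.Ioc 0 (dG γ x))) with hν
    have hj := jensen_lint ν (h := fun s : ℝ => g (x - s • eN n)) hgx.aemeasurable hq
    have e1 : hardy γ σ g x = ∫⁻ s, g (x - s • eN n) ∂ν := by
      rw [hν, lintegral_smul_measure]; rfl
    rw [e1]
    refine hj.trans ?_
    refine mul_le_mul' (ENNReal.rpow_le_rpow ?_ (by linarith)) ?_
    · rw [hν, Measure.smul_apply, smul_eq_mul, Measure.restrict_apply_univ, Real.volume_Ioc, sub_zero]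
      have := Bf_mul_le h (r := dG γ x / 2) (by linarith)
      have e3 : dG γ x = 2 * (dG γ x / 2) := by ring
      calc Bf σ (dG γ x / 2) * ENNReal.ofReal (dG γ x)
          = 2 * (ENNReal.ofReal (dG γ x / 2) * Bf σ (dG γ x / 2)) := by
            conv_lhs => rw [e3, ENNReal.ofReal_mul (by norm_num), ENNReal.ofReal_ofNat]
            rw [← e3]; ring
        _ ≤ 2 * M := by gcongr
    · rw [hν, lintegral_smul_measure, smul_eq_mul, ← lintegral_const_mul _ (hgx.pow_const q),
        ← lintegral_indicator measurableSet_Ioc, ← lintegral_indicator measurableSet_Ioi]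
      refine lintegral_mono fun s => ?_
      by_cases hs : s ∈ Set.Ioc 0 (dG γ x)
      · have h2 : (x, s) ∈ {w : EV (n + 1) × ℝ | w.2 ≤ dG γ w.1} := hs.2
        rw [Set.indicator_of_mem hs, Set.indicator_of_mem (Set.mem_Ioi.2 hs.1), hF, Set.indicator_of_mem h2]
      · rw [Set.indicator_of_notMem hs]; exact zero_le
  calc ∫⁻ x in halfSpace γ, hardy γ σ g x ^ q
      ≤ ∫⁻ x in halfSpace γ, (2 * M) ^ (q - 1) * ∫⁻ s in Set.Ioi (0 : ℝ), F (x, s) :=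
        setLIntegral_mono' hΩ hpt
    _ = (2 * M) ^ (q - 1) * ∫⁻ x in halfSpace γ, ∫⁻ s in Set.Ioi (0 : ℝ), F (x, s) := by
        rw [lintegral_const_mul _ hFm.lintegral_prod_right']
    _ ≤ (2 * M) ^ (q - 1) * (2 * M * ∫⁻ x, g x ^ q) := by
        gcongr
        rw [lintegral_lintegral_swap (f := fun x s => F (x, s)) hFm.aemeasurable]
        calc ∫⁻ s in Set.Ioi (0 : ℝ), ∫⁻ x in halfSpace γ, F (x, s)
            ≤ ∫⁻ s in Set.Ioi (0 : ℝ), Bf σ (s / 2) * ∫⁻ x, g x ^ q := by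
              refine setLIntegral_mono' measurableSet_Ioi fun s hs => ?_
              have hs : 0 < s := hs
              refine (setLIntegral_le_lintegral _ _).trans ?_
              rw [← lintegral_const_mul _ (hg.pow_const q),
                ← lintegral_sub_right_eq_self (fun x => Bf σ (s / 2) * g x ^ q) (s • eN n)]
              refine lintegral_mono fun x => ?_
              by_cases h2 : (x, s) ∈ {w : EV (n + 1) × ℝ | w.2 ≤ dG γ w.1}
              · rw [hF, Set.indicator_of_mem h2]
                have h3 : s ≤ dG γ x := h2
                simp only
                gcongr
                exact Bf_anti σ (by linarith)
              · rw [hF, Set.indicator_of_notMem h2]; exact zero_le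
          _ ≤ 2 * M * ∫⁻ x, g x ^ q := by
              have hm2 : Measurable fun s : ℝ => Bf σ (s / 2) := hBm.comp (measurable_id.div_const 2)
              rw [lintegral_mul_const _ hm2]
              gcongr
              exact Bf_int h
    _ = _ := by
        rw [← mul_assoc]
        congr 1
        by_cases hM0 : 2 * M = 0
        · rw [hM0, mul_zero, ENNReal.zero_rpow_of_pos (by linarith)]
        · nth_rewrite 2 [← ENNReal.rpow_one (2 * M)]
          rw [← ENNReal.rpow_add _ _ hM0 (ENNReal.mul_ne_top (by norm_num) hM)]
          congr 1; ring

theorem neumann_pt {n : ℕ} {γ : EV n → ℝ} {K : ℝ} (hg : GH γ K) {v : EV (n + 1) → ℝ}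
    (hv : ContDiff ℝ 2 v) (hN : ∀ x', fderiv ℝ v (snocE x' (γ x')) (Nvec γ x') = 0)
    {x : EV (n + 1)} (hx : x ∈ halfSpace γ) :
    ‖fderiv ℝ v x (Nvec γ (firstCoords x))‖ₑ
      ≤ ∫⁻ s in Set.Ioc 0 (dG γ x), ENNReal.ofReal (2 * hn v (x - s • eN n)) := by
  have hd : 0 < dG γ x := mem_half.1 hx
  set N := Nvec γ (firstCoords x) with hNd
  have hv1 : ContDiff ℝ 1 (fderiv ℝ v) := hv.fderiv_right (by norm_num)
  have hl : ∀ t : ℝ, HasDerivAt (fun t : ℝ => x - t • eN n) (-eN n) t := by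
    intro t
    have := ((hasDerivAt_id t).smul_const (eN n)).const_sub x
    simpa using this
  have hf : ∀ t : ℝ, HasDerivAt (fun t : ℝ => fderiv ℝ v (x - t • eN n) N)
      (fderiv ℝ (fderiv ℝ v) (x - t • eN n) (-eN n) N) t := by
    intro t
    have h1 := ((hv1.differentiable (by norm_num)) (x - t • eN n)).hasFDerivAt.comp_hasDerivAt t (hl t)
    exact h1.clm_apply (hasDerivAt_const t N) |>.congr_deriv (by simp)
  have hcont : Continuous fun t : ℝ => fderiv ℝ (fderiv ℝ v) (x - t • eN n) (-eN n) N := by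
    have h1 := cont_hess hv
    have h2 : Continuous fun t : ℝ => x - t • eN n := by fun_prop
    exact ((h1.comp h2).clm_apply continuous_const).clm_apply continuous_const
  have hInt0 := intervalIntegral.integral_eq_sub_of_hasDerivAt (a := 0) (b := dG γ x)
    (fun t _ => hf t) (hcont.intervalIntegrable _ _)
  have hend : x - dG γ x • eN n = snocE (firstCoords x) (γ (firstCoords x)) := by
    ext i
    refine Fin.lastCases ?_ (fun j => ?_) i
    · simp [dG]
    · simp
  rw [hend, hNd, hN, zero_sub, zero_smul, sub_zero, ← hNd] at hInt0
  rw [← enorm_neg, ← hInt0, intervalIntegral.integral_of_le hd.le]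
  refine (enorm_integral_le_lintegral_enorm _).trans (lintegral_mono fun s => ?_)
  rw [← ofReal_norm]
  apply ENNReal.ofReal_le_ofReal
  have h3 := nrm_bil (fderiv ℝ (fderiv ℝ v) (x - s • eN n)) (-eN n) N
  have h4 : nrm (fderiv ℝ (fderiv ℝ v) (x - s • eN n)) = hn v (x - s • eN n) := by unfold hn; rfl
  rw [norm_neg, norm_eN, mul_one, h4] at h3
  have h5 := hg.norm_Nvec_le (firstCoords x)
  have h6 := hn_nonneg (u := v) (x - s • eN n)
  nlinarith

theorem eLpNorm_le_of_lint {X F G : Type*} [MeasurableSpace X] [NormedAddCommGroup F]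
    [NormedAddCommGroup G] {μ ν : Measure X}
    {p : ℝ≥0∞} (hp1 : 1 ≤ p) (hp : p ≠ ⊤) {f : X → F} {g : X → G} {A : ℝ≥0∞}
    (h : ∫⁻ x, ‖f x‖ₑ ^ p.toReal ∂μ ≤ A * ∫⁻ x, ‖g x‖ₑ ^ p.toReal ∂ν) :
    eLpNorm f p μ ≤ A ^ (1 / p.toReal) * eLpNorm g p ν := by
  have hq := one_le_toReal hp1 hp
  have h0 : p ≠ 0 := (zero_lt_one.trans_le hp1).ne'
  rw [eLpNorm_eq_lintegral_rpow_enorm_toReal h0 hp, eLpNorm_eq_lintegral_rpow_enorm_toReal h0 hp,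
    ← ENNReal.mul_rpow_of_nonneg _ _ (by positivity)]
  exact ENNReal.rpow_le_rpow h (by positivity)

theorem cont_fd_prod {m : ℕ} {u : EV m → ℝ} (hu : ContDiff ℝ 2 u) :
    Continuous fun q : EV m × EV m => fderiv ℝ u q.1 (q.1 - q.2) := by
  have h1 : Continuous (fderiv ℝ u) := hu.continuous_fderiv (by norm_num)
  exact (h1.comp continuous_fst).clm_apply (continuous_fst.sub continuous_snd)

theorem opR_meas {m : ℕ} {σ : EV m → ℝ} (h : Ker σ) (Ω : Set (EV m)) {u : EV m → ℝ}
    (hu : ContDiff ℝ 2 u) : StronglyMeasurable (opR Ω σ u) := by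
  have h1 : Measurable fun q : EV m × EV m =>
      kernelJ σ (q.1 - q.2) * (u q.1 - u q.2 - fderiv ℝ u q.1 (q.1 - q.2)) := by
    refine (h.kmeas.comp (measurable_fst.sub measurable_snd)).mul ?_
    exact ((hu.continuous.measurable.comp measurable_fst).sub
      (hu.continuous.measurable.comp measurable_snd)).sub (cont_fd_prod hu).measurable
  exact h1.stronglyMeasurable.integral_prod_right'

theorem opB_meas {m : ℕ} {σ : EV m → ℝ} (h : Ker σ) (Ω : Set (EV m)) {u : EV m → ℝ}
    (hu : ContDiff ℝ 2 u) : StronglyMeasurable (opB Ω σ u) := by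
  have h1 : Measurable fun q : EV m × EV m =>
      kernelJ σ (q.1 - q.2) * (fderiv ℝ u q.1 (q.1 - q.2)) := by
    refine (h.kmeas.comp (measurable_fst.sub measurable_snd)).mul ?_
    exact (cont_fd_prod hu).measurable
  exact h1.stronglyMeasurable.integral_prod_right'

def j2 {m : ℕ} (u : EV m → ℝ) (x : EV m) : ℝ := |u x| + ‖fderiv ℝ u x‖ + hn u x

theorem j2_nonneg {m : ℕ} (u : EV m → ℝ) (x : EV m) : 0 ≤ j2 u x := by
  unfold j2
  have := hn_nonneg (u := u) x
  positivity

theorem j2_cont {m : ℕ} {u : EV m → ℝ} (hu : ContDiff ℝ 2 u) : Continuous (j2 u) := by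
  have h1 : Continuous (fderiv ℝ u) := hu.continuous_fderiv (by norm_num)
  exact (hu.continuous.abs.add h1.norm).add (cont_hn hu)

theorem fd_le_j2 {m : ℕ} (u : EV m → ℝ) (x : EV m) : ‖fderiv ℝ u x‖ ≤ j2 u x := by
  unfold j2
  linarith [hn_nonneg (u := u) x, abs_nonneg (u x)]

theorem hn_le_j2 {m : ℕ} (u : EV m → ℝ) (x : EV m) : hn u x ≤ j2 u x := by
  unfold j2
  linarith [norm_nonneg (fderiv ℝ u x), abs_nonneg (u x)]

theorem abs_le_j2 {m : ℕ} (u : EV m → ℝ) (x : EV m) : |u x| ≤ j2 u x := by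
  unfold j2
  linarith [norm_nonneg (fderiv ℝ u x), hn_nonneg (u := u) x]

/-- classical Neumann functions -/
structure CN {n : ℕ} (γ : EV n → ℝ) (v : EV (n + 1) → ℝ) : Prop where
  cd : ContDiff ℝ 2 v
  cs : HasCompactSupport v
  bc : ∀ x', fderiv ℝ v (snocE x' (γ x')) (Nvec γ x') = 0

theorem opB_pt2 {n : ℕ} {ρ : EV (n + 1) → ℝ} (h1 : A1 ρ) (h2 : A2 ρ) (hM : momentum ρ = 1)
    {γ : EV n → ℝ} {K : ℝ} (hg : GH γ K) {C : ℝ≥0∞}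
    (hC : ∀ (ε : ℝ), 0 < ε → ∀ (s : ℝ) (l : EV n →L[ℝ] ℝ),
      ∫⁻ z in {z : EV (n + 1) | |z (Fin.last n) - s - l (firstCoords z)| ≤ K * ‖firstCoords z‖ ^ 2},
        ENNReal.ofReal (kernelJ (scaled ρ ε) z * ‖z‖) ≤ C)
    {ε : ℝ} (hε : 0 < ε) {v : EV (n + 1) → ℝ} (hv : CN γ v) {x : EV (n + 1)}
    (hx : x ∈ halfSpace γ) :
    ‖opB (halfSpace γ) (scaled ρ ε) v x‖ₑ ≤ 2 * C * ‖fderiv ℝ v x‖ₑ +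
      hardy γ (scaled ρ ε) (fun y => ENNReal.ofReal (2 * hn v y)) x := by
  refine (opB_pt h1 h2 hM hg hC hε v hx).trans ?_
  refine add_le_add le_rfl ?_
  rw [mul_comm]
  exact mul_le_mul' le_rfl (neumann_pt hg hv.cd hv.bc hx)

theorem opB_bound {n : ℕ} {ρ : EV (n + 1) → ℝ} (h1 : A1 ρ) (h2 : A2 ρ) (hM : momentum ρ = 1)
    {γ : EV n → ℝ} {K : ℝ} (hg : GH γ K) {p : ℝ≥0∞} (hp1 : 1 ≤ p) (hp : p ≠ ⊤) :
    ∃ C : ℝ≥0∞, C ≠ ⊤ ∧ ∀ ε : ℝ, 0 < ε → ∀ v, CN γ v →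
      eLpNorm (opB (halfSpace γ) (scaled ρ ε) v) p (volume.restrict (halfSpace γ))
        ≤ C * eLpNorm (j2 v) p volume := by
  obtain ⟨C, hCt, hC⟩ := near_bound h1 h2 K hg.K0
  have hq := one_le_toReal hp1 hp
  set q := p.toReal with hqdef
  have hq0 : 0 < q := by linarith
  have hΩ := (halfSpace_open hg.diff.continuous).measurableSet
  set A : ℝ≥0∞ := 2 ^ (q - 1) * ((2 * C) ^ q + (2 * massR ρ) ^ q * 2 ^ q) with hA
  have hAt : A ≠ ⊤ := by
    refine ENNReal.mul_ne_top (by simp) (ENNReal.add_ne_top.2 ⟨?_, ENNReal.mul_ne_top ?_ (by simp)⟩)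
    · exact ENNReal.rpow_ne_top_of_nonneg hq0.le (ENNReal.mul_ne_top (by simp) hCt)
    · exact ENNReal.rpow_ne_top_of_nonneg hq0.le (ENNReal.mul_ne_top (by simp) h1.mass)
  refine ⟨A ^ (1 / q), ENNReal.rpow_ne_top_of_nonneg (by positivity) hAt, ?_⟩
  intro ε hε v hv
  apply eLpNorm_le_of_lint hp1 hp
  rw [← hqdef]
  have hk := ker_scaled h1 hε
  have hDm : Measurable fun x => ‖fderiv ℝ v x‖ₑ :=
    ((hv.cd.continuous_fderiv (by norm_num)).enorm).measurable
  have hgm : Measurable fun y => ENNReal.ofReal (2 * hn v y) :=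
    ((cont_hn hv.cd).measurable.const_mul 2).ennreal_ofReal
  have hH := hardy_bound hg.diff.continuous hk hgm hq (by rw [mass_scaled hε]; exact h1.mass)
  rw [mass_scaled hε] at hH
  set I := ∫⁻ x, ‖j2 v x‖ₑ ^ q with hI
  have hI1 : ∫⁻ x in halfSpace γ, ‖fderiv ℝ v x‖ₑ ^ q ≤ I := by
    refine (setLIntegral_le_lintegral _ _).trans (lintegral_mono fun x => ?_)
    refine ENNReal.rpow_le_rpow ?_ hq0.le
    rw [Real.enorm_of_nonneg (j2_nonneg v x), ← ofReal_norm]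
    exact ENNReal.ofReal_le_ofReal (fd_le_j2 v x)
  have hI2 : ∫⁻ x, ENNReal.ofReal (2 * hn v x) ^ q ≤ 2 ^ q * I := by
    rw [hI, ← lintegral_const_mul' _ _ (by simp)]
    refine lintegral_mono fun x => ?_
    rw [← ENNReal.mul_rpow_of_nonneg _ _ hq0.le]
    refine ENNReal.rpow_le_rpow ?_ hq0.le
    rw [Real.enorm_of_nonneg (j2_nonneg v x)]
    have := ENNReal.ofReal_le_ofReal (mul_le_mul_of_nonneg_left (hn_le_j2 v x) zero_le_two)
    rwa [ENNReal.ofReal_mul (p := 2) (q := j2 v x) zero_le_two, ENNReal.ofReal_ofNat] at this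
  calc ∫⁻ x in halfSpace γ, ‖opB (halfSpace γ) (scaled ρ ε) v x‖ₑ ^ q
      ≤ ∫⁻ x in halfSpace γ, 2 ^ (q - 1) * ((2 * C * ‖fderiv ℝ v x‖ₑ) ^ q +
        hardy γ (scaled ρ ε) (fun y => ENNReal.ofReal (2 * hn v y)) x ^ q) := by
        refine setLIntegral_mono' hΩ fun x hx => ?_
        refine le_trans ?_ (ENNReal.rpow_add_le_mul_rpow_add_rpow _ _ hq)
        exact ENNReal.rpow_le_rpow (opB_pt2 h1 h2 hM hg hC hε hv hx) hq0.le
    _ = 2 ^ (q - 1) * ((2 * C) ^ q * (∫⁻ x in halfSpace γ, ‖fderiv ℝ v x‖ₑ ^ q) +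
        ∫⁻ x in halfSpace γ, hardy γ (scaled ρ ε) (fun y => ENNReal.ofReal (2 * hn v y)) x ^ q) := by
        rw [lintegral_const_mul' _ _ (by simp), lintegral_add_left]
        · congr 2
          rw [← lintegral_const_mul _ (hDm.pow_const q)]
          refine lintegral_congr fun x => ?_
          rw [ENNReal.mul_rpow_of_nonneg _ _ hq0.le]
        · exact (hDm.const_mul _).pow_const q
    _ ≤ 2 ^ (q - 1) * ((2 * C) ^ q * I + (2 * massR ρ) ^ q * (2 ^ q * I)) := by
        refine mul_le_mul' le_rfl (add_le_add (mul_le_mul' le_rfl hI1) (hH.trans ?_))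
        exact mul_le_mul' le_rfl hI2
    _ = A * I := by rw [hA]; ring

theorem op_bound {n : ℕ} {ρ : EV (n + 1) → ℝ} (h1 : A1 ρ) (h2 : A2 ρ) (hM : momentum ρ = 1)
    {γ : EV n → ℝ} {K : ℝ} (hg : GH γ K) {p : ℝ≥0∞} (hp1 : 1 ≤ p) (hp : p ≠ ⊤) :
    ∃ C : ℝ≥0∞, C ≠ ⊤ ∧ ∀ ε : ℝ, 0 < ε → ∀ v, CN γ v →
      eLpNorm (fun x => opR (halfSpace γ) (scaled ρ ε) v x - opB (halfSpace γ) (scaled ρ ε) v x) p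
        (volume.restrict (halfSpace γ)) ≤ C * eLpNorm (j2 v) p volume := by
  obtain ⟨C, hC, hb⟩ := opB_bound h1 h2 hM hg hp1 hp
  refine ⟨massR ρ + C, ENNReal.add_ne_top.2 ⟨h1.mass, hC⟩, fun ε hε v hv => ?_⟩
  have hk := ker_scaled h1 hε
  have hΩ := (halfSpace_open hg.diff.continuous).measurableSet
  refine (eLpNorm_sub_le (f := opR (halfSpace γ) (scaled ρ ε) v)
    (opR_meas hk _ hv.cd).aestronglyMeasurable
    (opB_meas hk _ hv.cd).aestronglyMeasurable hp1).trans ?_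
  rw [add_mul]
  refine add_le_add ?_ (hb ε hε v hv)
  refine (eLpNorm_mono_measure _ Measure.restrict_le_self).trans ?_
  refine (opR_bound h1 hp1 hp hΩ hε hv.cd).trans (mul_le_mul' le_rfl ?_)
  refine eLpNorm_mono_real fun x => ?_
  rw [Real.norm_of_nonneg (hn_nonneg x)]
  exact hn_le_j2 v x

theorem Bf_tendsto {m : ℕ} {ρ : EV m → ℝ} (h1 : A1 ρ) {r : ℝ} (hr : 0 < r) :
    Tendsto (fun ε => Bf (scaled ρ ε) r) (𝓝[>] 0) (𝓝 0) := by
  set I := ∫⁻ w, ENNReal.ofReal (ρ w) * ENNReal.ofReal ‖w‖ with hI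
  have hIt : I ≠ ⊤ := by
    have h3 := h1.2.2.2.2.lintegral_lt_top
    refine (lt_of_le_of_lt (lintegral_mono fun w => ?_) h3).ne
    rw [← ENNReal.ofReal_mul (h1.2.1 w)]
    apply ENNReal.ofReal_le_ofReal
    nlinarith [h1.2.1 w]
  have hb : ∀ ε : ℝ, 0 < ε → Bf (scaled ρ ε) r ≤ ENNReal.ofReal (r⁻¹ * r⁻¹ * ε) * I := by
    intro ε hε
    have hk := ker_scaled h1 hε
    calc Bf (scaled ρ ε) r ≤ ∫⁻ z in {z | r ≤ ‖z‖}, ENNReal.ofReal (scaled ρ ε z) *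
          ENNReal.ofReal (r⁻¹ * r⁻¹ * ‖z‖) := by
          unfold Bf
          refine setLIntegral_mono' (meas_far r) fun z hz => ?_
          have hz : r ≤ ‖z‖ := hz
          rw [← ENNReal.ofReal_mul (hk.nonneg z)]
          apply ENNReal.ofReal_le_ofReal
          refine (hk.mul_norm_le hr hz).trans ?_
          have h5 : 1 ≤ r⁻¹ * ‖z‖ := by rw [inv_mul_eq_div, le_div_iff₀ hr]; linarith
          have h6 := mul_nonneg (inv_pos.2 hr).le (hk.nonneg z)
          calc r⁻¹ * scaled ρ ε z ≤ (r⁻¹ * scaled ρ ε z) * (r⁻¹ * ‖z‖) :=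
                le_mul_of_one_le_right h6 h5
            _ = _ := by ring
      _ ≤ ∫⁻ z, ENNReal.ofReal (scaled ρ ε z) * ENNReal.ofReal (r⁻¹ * r⁻¹ * ‖z‖) :=
          setLIntegral_le_lintegral _ _
      _ = _ := by
          rw [lint_scaled hε, hI, ← lintegral_const_mul' _ _ ENNReal.ofReal_ne_top]
          refine lintegral_congr fun w => ?_
          rw [norm_smul, Real.norm_of_nonneg hε.le, ← mul_assoc (r⁻¹ * r⁻¹) ε,
            ENNReal.ofReal_mul (p := r⁻¹ * r⁻¹ * ε) (by positivity)]
          ring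
  have hlim : Tendsto (fun ε : ℝ => ENNReal.ofReal (r⁻¹ * r⁻¹ * ε) * I) (𝓝[>] 0) (𝓝 0) := by
    have h4 : Tendsto (fun ε : ℝ => ENNReal.ofReal (r⁻¹ * r⁻¹ * ε)) (𝓝[>] 0) (𝓝 0) := by
      have : Continuous fun ε : ℝ => ENNReal.ofReal (r⁻¹ * r⁻¹ * ε) :=
        ENNReal.continuous_ofReal.comp (continuous_const.mul continuous_id)
      have h5 := this.tendsto 0
      simp only [mul_zero, ENNReal.ofReal_zero] at h5
      exact h5.mono_left nhdsWithin_le_nhds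
    simpa using ENNReal.Tendsto.mul_const h4 (Or.inr hIt)
  refine tendsto_of_tendsto_of_tendsto_of_le_of_le' tendsto_const_nhds hlim
    (Eventually.of_forall fun _ => zero_le) ?_
  filter_upwards [self_mem_nhdsWithin] with ε hε
  exact hb ε hε

theorem opB_conv {n : ℕ} {ρ : EV (n + 1) → ℝ} (h1 : A1 ρ) (h2 : A2 ρ) (hM : momentum ρ = 1)
    {γ : EV n → ℝ} {K : ℝ} (hg : GH γ K) {p : ℝ≥0∞} (hp1 : 1 ≤ p) (hp : p ≠ ⊤)
    {v : EV (n + 1) → ℝ} (hv : CN γ v) :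
    Tendsto (fun ε => eLpNorm (opB (halfSpace γ) (scaled ρ ε) v) p
      (volume.restrict (halfSpace γ))) (𝓝[>] 0) (𝓝 0) := by
  obtain ⟨C, hCt, hC⟩ := near_bound h1 h2 K hg.K0
  have hq := one_le_toReal hp1 hp
  have hp0 : p ≠ 0 := (zero_lt_one.trans_le hp1).ne'
  set q := p.toReal with hqdef
  have hq0 : 0 < q := by linarith
  have hΩo := halfSpace_open hg.diff.continuous
  have hΩ := hΩo.measurableSet
  obtain ⟨C2, hC20, hC2⟩ := hn_bdd hv.cd hv.cs
  obtain ⟨C1, hC1⟩ := (hcs_fderiv hv.cs).exists_bound_of_continuous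
    (hv.cd.continuous_fderiv (by norm_num))
  set B : ℝ≥0∞ := 2 * C * ENNReal.ofReal C1 + 2 * massR ρ * ENNReal.ofReal (2 * C2) with hB
  have hBt : B ≠ ⊤ := by
    refine ENNReal.add_ne_top.2 ⟨?_, ?_⟩
    · exact ENNReal.mul_ne_top (ENNReal.mul_ne_top (by simp) hCt) ENNReal.ofReal_ne_top
    · exact ENNReal.mul_ne_top (ENNReal.mul_ne_top (by simp) h1.mass) ENNReal.ofReal_ne_top
  have hbd : ∀ ε : ℝ, 0 < ε → ∀ x ∈ halfSpace γ, ‖opB (halfSpace γ) (scaled ρ ε) v x‖ₑ ≤ B := by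
    intro ε hε x hx
    refine (opB_pt2 h1 h2 hM hg hC hε hv hx).trans (add_le_add (mul_le_mul' le_rfl ?_) ?_)
    · rw [← ofReal_norm]
      exact ENNReal.ofReal_le_ofReal (hC1 x)
    · unfold hardy
      have hd := mem_half.1 hx
      have h5 := Bf_mul_le (ker_scaled h1 hε) (r := dG γ x / 2) (by linarith)
      rw [mass_scaled hε] at h5
      calc Bf (scaled ρ ε) (dG γ x / 2) *
            ∫⁻ s in Set.Ioc 0 (dG γ x), ENNReal.ofReal (2 * hn v (x - s • eN n))
          ≤ Bf (scaled ρ ε) (dG γ x / 2) *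
            ∫⁻ s in Set.Ioc 0 (dG γ x), ENNReal.ofReal (2 * C2) := by
            refine mul_le_mul' le_rfl (lintegral_mono fun s => ?_)
            exact ENNReal.ofReal_le_ofReal (by linarith [hC2 (x - s • eN n)])
        _ = 2 * (ENNReal.ofReal (dG γ x / 2) * Bf (scaled ρ ε) (dG γ x / 2)) *
              ENNReal.ofReal (2 * C2) := by
            have e3 : ENNReal.ofReal (dG γ x) = 2 * ENNReal.ofReal (dG γ x / 2) := by
              have e4 : dG γ x = 2 * (dG γ x / 2) := by ring
              have e5 := congrArg ENNReal.ofReal e4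
              rwa [ENNReal.ofReal_mul zero_le_two, ENNReal.ofReal_ofNat] at e5
            rw [setLIntegral_const, Real.volume_Ioc, sub_zero, e3]
            ring
        _ ≤ _ := mul_le_mul' (mul_le_mul' le_rfl h5) le_rfl
  have hz : ∀ ε x, x ∉ tsupport v → opB (halfSpace γ) (scaled ρ ε) v x = 0 := by
    intro ε x hx
    have : fderiv ℝ v x = 0 := by
      by_contra hne
      exact hx (support_fderiv_subset ℝ hne)
    unfold opB
    simp [this]
  have key := tendsto_lintegral_filter_of_dominated_convergence
    (μ := volume.restrict (halfSpace γ))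
    (l := 𝓝[>] (0 : ℝ)) (F := fun ε x => ‖opB (halfSpace γ) (scaled ρ ε) v x‖ₑ ^ q) (f := fun _ => 0)
    ((tsupport v).indicator fun _ => B ^ q) ?_ ?_ ?_ ?_
  · simp only [eLpNorm_eq_lintegral_rpow_enorm_toReal hp0 hp]
    have h6 := (ENNReal.continuous_rpow_const (y := 1 / q)).tendsto 0 |>.comp
      (by simpa using key : Tendsto _ _ (𝓝 (0 : ℝ≥0∞)))
    rw [ENNReal.zero_rpow_of_pos (by positivity)] at h6
    exact h6
  · filter_upwards [self_mem_nhdsWithin] with ε hε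
    exact ((opB_meas (ker_scaled h1 hε) _ hv.cd).measurable.enorm).pow_const q
  · filter_upwards [self_mem_nhdsWithin] with ε hε
    filter_upwards [ae_restrict_mem hΩ] with x hx
    by_cases hxs : x ∈ tsupport v
    · rw [Set.indicator_of_mem hxs]
      exact ENNReal.rpow_le_rpow (hbd ε hε x hx) hq0.le
    · rw [hz ε x hxs, enorm_zero, ENNReal.zero_rpow_of_pos hq0]
      exact zero_le
  · rw [lintegral_indicator (isClosed_tsupport v).measurableSet, setLIntegral_const]
    refine ENNReal.mul_ne_top (ENNReal.rpow_ne_top_of_nonneg hq0.le hBt) ?_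
    exact (lt_of_le_of_lt (Measure.restrict_le_self _) hv.cs.isCompact.measure_lt_top).ne
  · filter_upwards [ae_restrict_mem hΩ] with x hx
    obtain ⟨r, hr, hball⟩ := Metric.isOpen_iff.1 hΩo x hx
    have hlim : Tendsto (fun ε => (‖fderiv ℝ v x‖ₑ * Bf (scaled ρ ε) r) ^ q) (𝓝[>] 0) (𝓝 0) := by
      have h7 := ENNReal.Tendsto.const_mul (a := ‖fderiv ℝ v x‖ₑ) (Bf_tendsto h1 hr)
        (Or.inr enorm_ne_top)
      rw [mul_zero] at h7
      have h8 := (ENNReal.continuous_rpow_const (y := q)).tendsto 0 |>.comp h7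
      rw [ENNReal.zero_rpow_of_pos hq0] at h8
      exact h8
    refine tendsto_of_tendsto_of_tendsto_of_le_of_le' tendsto_const_nhds hlim
      (Eventually.of_forall fun _ => zero_le) ?_
    filter_upwards [self_mem_nhdsWithin] with ε hε
    have hk := ker_scaled h1 hε
    refine ENNReal.rpow_le_rpow ?_ hq0.le
    rw [opB_eq hΩ]
    refine (enorm_integral_le_lintegral_enorm _).trans ?_
    unfold Bf
    rw [← lintegral_const_mul _ hk.mN]
    refine le_trans (lintegral_mono fun z => enorm_kG_le hk _ z) (lintegral_mono_set fun z hz => ?_)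
    by_contra hlt
    have hlt : ‖z‖ < r := not_le.1 hlt
    exact hz (hball (by rw [Metric.mem_ball, dist_eq_norm, sub_sub_cancel_left, norm_neg]; exact hlt))

theorem op_conv {n : ℕ} {ρ : EV (n + 1) → ℝ} (h1 : A1 ρ) (h2 : A2 ρ) (hM : momentum ρ = 1)
    {γ : EV n → ℝ} {K : ℝ} (hg : GH γ K) {p : ℝ≥0∞} (hp1 : 1 ≤ p) (hp : p ≠ ⊤)
    {v : EV (n + 1) → ℝ} (hv : CN γ v) :
    Tendsto (fun ε => eLpNorm (fun x => (opR (halfSpace γ) (scaled ρ ε) v x -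
      opB (halfSpace γ) (scaled ρ ε) v x) + lap v x) p
      (volume.restrict (halfSpace γ))) (𝓝[>] 0) (𝓝 0) := by
  have hΩo := halfSpace_open hg.diff.continuous
  have ha := opR_conv h1 hM hp1 hp hΩo hv.cd hv.cs
  have hb := opB_conv h1 h2 hM hg hp1 hp hv
  have hab := ha.add hb
  rw [add_zero] at hab
  refine tendsto_of_tendsto_of_tendsto_of_le_of_le' tendsto_const_nhds hab
    (Eventually.of_forall fun _ => zero_le) ?_
  filter_upwards [self_mem_nhdsWithin] with ε hε
  have hk := ker_scaled h1 hε
  have hl : Continuous (lap v) := by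
    unfold lap
    refine continuous_finset_sum _ fun i _ => ?_
    have : partialD i (partialD i v) = fun x => fderiv ℝ (fderiv ℝ v) x
        (EuclideanSpace.single i 1) (EuclideanSpace.single i 1) := by
      funext x
      exact partialD_partialD hv.cd i i x
    rw [this]
    exact ((cont_hess hv.cd).clm_apply continuous_const).clm_apply continuous_const
  have e : (fun x => (opR (halfSpace γ) (scaled ρ ε) v x -
      opB (halfSpace γ) (scaled ρ ε) v x) + lap v x) =
      (fun x => opR (halfSpace γ) (scaled ρ ε) v x + lap v x) - opB (halfSpace γ) (scaled ρ ε) v := by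
    funext x
    simp only [Pi.sub_apply]
    ring
  rw [e]
  exact eLpNorm_sub_le ((opR_meas hk _ hv.cd).aestronglyMeasurable.add hl.aestronglyMeasurable)
    (opB_meas hk _ hv.cd).aestronglyMeasurable hp1

/-! ### The divergence theorem over a graph domain -/

theorem snocE_add_smul {n : ℕ} (y : EV n) (t s : ℝ) : snocE y t + s • eN n = snocE y (t + s) := by
  ext i
  refine Fin.lastCases ?_ (fun j => ?_) i <;> simp

/-- shear homeomorphism -/
def shear {n : ℕ} (γ : EV n → ℝ) (hγ : Continuous γ) : EV (n + 1) ≃ₜ EV (n + 1) where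
  toFun y := y + γ (firstCoords y) • eN n
  invFun y := y - γ (firstCoords y) • eN n
  left_inv y := by simp
  right_inv y := by simp
  continuous_toFun := continuous_id.add ((hγ.comp (fcL n).continuous).smul continuous_const)
  continuous_invFun := continuous_id.sub ((hγ.comp (fcL n).continuous).smul continuous_const)

theorem half_zero_mem {n : ℕ} (y : EV n) (t : ℝ) : snocE y t ∈ halfSpace (fun _ : EV n => (0 : ℝ)) ↔ 0 < t := by
  rw [mem_half]; simp [dG]

theorem shear_mem {n : ℕ} {γ : EV n → ℝ} (hγ : Continuous γ) (y : EV (n + 1)) :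
    shear γ hγ y ∈ halfSpace γ ↔ y ∈ halfSpace (fun _ : EV n => (0 : ℝ)) := by
  rw [mem_half, mem_half]
  show 0 < dG γ (y + _) ↔ _
  rw [dG_add]
  simp [dG]

theorem int_shear {n : ℕ} {γ : EV n → ℝ} (hγ : Continuous γ) {Q : EV (n + 1) → ℝ}
    (hQ : Continuous Q) (hs : HasCompactSupport Q) :
    ∫ x in halfSpace γ, Q x = ∫ y in halfSpace (fun _ : EV n => (0 : ℝ)), Q (shear γ hγ y) := by
  have hQs : HasCompactSupport (fun y => Q (shear γ hγ y)) := hs.comp_homeomorph (shear γ hγ)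
  have hQc : Continuous (fun y => Q (shear γ hγ y)) := hQ.comp (shear γ hγ).continuous
  have hΩ := (halfSpace_open hγ).measurableSet
  have hH := (halfSpace_open (n := n) (continuous_const (y := (0 : ℝ)))).measurableSet
  have i1 := (hQ.integrable_of_hasCompactSupport hs (μ := volume)).indicator hΩ
  have i2 := (hQc.integrable_of_hasCompactSupport hQs (μ := volume)).indicator hH
  rw [← integral_indicator hΩ, ← integral_indicator hH, integral_snoc i1, integral_snoc i2]
  refine integral_congr_ae (ae_of_all _ fun y => ?_)
  simp only
  rw [← integral_add_right_eq_self (fun t => (halfSpace γ).indicator Q (snocE y t)) (γ y)]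
  refine integral_congr_ae (ae_of_all _ fun t => ?_)
  simp only
  have e : snocE y (t + γ y) = shear γ hγ (snocE y t) := by
    show _ = snocE y t + γ (firstCoords (snocE y t)) • eN n
    rw [firstCoords_snocE, snocE_add_smul]
  rw [e]
  by_cases h : snocE y t ∈ halfSpace (fun _ : EV n => (0 : ℝ))
  · rw [Set.indicator_of_mem h, Set.indicator_of_mem ((shear_mem hγ _).2 h)]
  · rw [Set.indicator_of_notMem h, Set.indicator_of_notMem (fun h' => h ((shear_mem hγ _).1 h'))]

theorem int_fderiv_zero {n : ℕ} {g : EV n → ℝ} (hg : ContDiff ℝ 1 g) (hs : HasCompactSupport g)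
    (a : EV n) : ∫ x, fderiv ℝ g x a = 0 := by
  have hc : Continuous fun x => fderiv ℝ g x a :=
    (hg.continuous_fderiv (by norm_num)).clm_apply continuous_const
  have hs1 : HasCompactSupport fun x => fderiv ℝ g x a :=
    hs.fderiv_apply (𝕜 := ℝ) a
  have := integral_mul_fderiv_eq_neg_fderiv_mul_of_integrable (μ := (volume : Measure (EV n)))
    (f := fun _ => (1 : ℝ)) (g := g) (v := a) (by simp)
    (by simpa using hc.integrable_of_hasCompactSupport hs1)
    (by simpa using hg.continuous.integrable_of_hasCompactSupport hs)
    (fun x _ => differentiableAt_const _) (fun x _ => (hg.differentiable (by norm_num)) x)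
  simpa using this

theorem flat_tan {n : ℕ} {G : EV (n + 1) → ℝ} (hG : ContDiff ℝ 1 G) (hs : HasCompactSupport G)
    (a' : EV n) : ∫ y in halfSpace (fun _ : EV n => (0 : ℝ)), fderiv ℝ G y (snocE a' 0) = 0 := by
  have hH := (halfSpace_open (n := n) (continuous_const (y := (0 : ℝ)))).measurableSet
  have hc : Continuous fun x => fderiv ℝ G x (snocE a' 0) :=
    (hG.continuous_fderiv (by norm_num)).clm_apply continuous_const
  have hs1 : HasCompactSupport fun x => fderiv ℝ G x (snocE a' 0) :=
    hs.fderiv_apply (𝕜 := ℝ) _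
  have i1 := (hc.integrable_of_hasCompactSupport hs1 (μ := volume)).indicator hH
  rw [← integral_indicator hH, integral_snoc' i1]
  refine integral_eq_zero_of_ae (ae_of_all _ fun t => ?_)
  simp only [Pi.zero_apply]
  by_cases ht : 0 < t
  · have e : ∀ z' : EV n, (halfSpace (fun _ : EV n => (0 : ℝ))).indicator
        (fun x => fderiv ℝ G x (snocE a' 0)) (snocE z' t) =
        fderiv ℝ (fun z' => G (snocE z' t)) z' a' := by
      intro z'
      rw [Set.indicator_of_mem ((half_zero_mem z' t).2 ht)]
      have hd : HasFDerivAt (fun z' : EV n => snocE z' t)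
          ((snocL n).comp (ContinuousLinearMap.inl ℝ (EV n) ℝ)) z' := by
        have h1 : HasFDerivAt (fun z' : EV n => (z', t)) (ContinuousLinearMap.inl ℝ (EV n) ℝ) z' :=
          hasFDerivAt_prodMk_left z' t
        exact (snocL n).hasFDerivAt.comp z' h1
      have h2 := ((hG.differentiable (by norm_num)) (snocE z' t)).hasFDerivAt.comp z' hd
      have h3 : fderiv ℝ (fun z' => G (snocE z' t)) z' = _ := h2.fderiv
      rw [h3]
      simp
    simp only [e]
    apply int_fderiv_zero
    · exact hG.comp ((snocL n).contDiff.comp (contDiff_id.prodMk contDiff_const))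
    · have hemb : Topology.IsClosedEmbedding fun z' : EV n => snocE z' t := by
        refine Topology.IsClosedEmbedding.of_continuous_injective_isClosedMap ?_ ?_ ?_
        · exact (snocL n).continuous.comp (continuous_id.prodMk continuous_const)
        · intro a b hab
          have := congrArg firstCoords hab
          simpa using this
        · intro S hS
          have : (fun z' : EV n => snocE z' t) '' S =
              (fcL n) ⁻¹' S ∩ {x | x (Fin.last n) = t} := by
            ext x
            constructor
            · rintro ⟨z, hz, rfl⟩
              exact ⟨by simpa using hz, by simp⟩
            · rintro ⟨h1, h2⟩
              refine ⟨firstCoords x, h1, ?_⟩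
              have h2 : x (Fin.last n) = t := h2
              simp only
              rw [← h2, snocE_firstCoords]
          rw [this]
          exact (hS.preimage (fcL n).continuous).inter
            (isClosed_eq (lastL n).continuous continuous_const)
      exact hs.comp_isClosedEmbedding hemb
  · have e : ∀ z' : EV n, (halfSpace (fun _ : EV n => (0 : ℝ))).indicator
        (fun x => fderiv ℝ G x (snocE a' 0)) (snocE z' t) = 0 := by
      intro z'
      exact Set.indicator_of_notMem (fun h => ht ((half_zero_mem z' t).1 h)) _
    simp [e]

theorem flat_nor {n : ℕ} {G : EV (n + 1) → ℝ} (hG : ContDiff ℝ 1 G) (hs : HasCompactSupport G)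
    {c : EV n → ℝ} (hcc : Continuous c) :
    ∫ y in halfSpace (fun _ : EV n => (0 : ℝ)), c (firstCoords y) * fderiv ℝ G y (eN n)
      = - ∫ y : EV n, c y * G (snocE y 0) := by
  have hH := (halfSpace_open (n := n) (continuous_const (y := (0 : ℝ)))).measurableSet
  have hc : Continuous fun x => c (firstCoords x) * fderiv ℝ G x (eN n) :=
    (hcc.comp (fcL n).continuous).mul
      ((hG.continuous_fderiv (by norm_num)).clm_apply continuous_const)
  have hs1 : HasCompactSupport fun x => c (firstCoords x) * fderiv ℝ G x (eN n) :=
    (hs.fderiv_apply (𝕜 := ℝ) _).mul_left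
  have i1 := (hc.integrable_of_hasCompactSupport hs1 (μ := volume)).indicator hH
  rw [← integral_indicator hH, integral_snoc i1, ← integral_neg]
  refine integral_congr_ae (ae_of_all _ fun y => ?_)
  simp only
  have hl : ∀ t, HasDerivAt (fun t : ℝ => snocE y t) (eN n) t := by
    intro t
    have h0 : (fun t : ℝ => snocE y t) = fun t => snocE y 0 + t • eN n := by
      funext t
      rw [snocE_add_smul, zero_add]
    rw [h0]
    simpa using ((hasDerivAt_id t).smul_const (eN n)).const_add (snocE y 0)
  have hd : ∀ t, HasDerivAt (fun t : ℝ => c y * G (snocE y t))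
      (c y * fderiv ℝ G (snocE y t) (eN n)) t := by
    intro t
    exact (((hG.differentiable (by norm_num)) (snocE y t)).hasFDerivAt.comp_hasDerivAt t
      (hl t)).const_mul (c y)
  have e : ∀ t : ℝ, (halfSpace (fun _ : EV n => (0 : ℝ))).indicator
      (fun x => c (firstCoords x) * fderiv ℝ G x (eN n)) (snocE y t) =
      (Set.Ioi (0 : ℝ)).indicator (fun t => c y * fderiv ℝ G (snocE y t) (eN n)) t := by
    intro t
    by_cases ht : 0 < t
    · rw [Set.indicator_of_mem ((half_zero_mem y t).2 ht), Set.indicator_of_mem (Set.mem_Ioi.2 ht),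
        firstCoords_snocE]
    · rw [Set.indicator_of_notMem (fun h => ht ((half_zero_mem y t).1 h)),
        Set.indicator_of_notMem (fun h => ht (Set.mem_Ioi.1 h))]
  simp only [e]
  rw [integral_indicator measurableSet_Ioi]
  obtain ⟨R, hR⟩ := hs.isCompact.isBounded.subset_closedBall (0 : EV (n + 1))
  have hz : ∀ t, R < t → G (snocE y t) = 0 := by
    intro t ht
    by_contra hne
    have h1 := hR (subset_tsupport _ hne)
    rw [Metric.mem_closedBall, dist_zero_right] at h1
    have h2 := abs_last_le (snocE y t)
    rw [snocE_last] at h2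
    linarith [le_abs_self t]
  have hz' : ∀ t, R < t → fderiv ℝ G (snocE y t) = 0 := by
    intro t ht
    by_contra hne
    have h1 := hR (support_fderiv_subset ℝ hne)
    rw [Metric.mem_closedBall, dist_zero_right] at h1
    have h2 := abs_last_le (snocE y t)
    rw [snocE_last] at h2
    linarith [le_abs_self t]
  have hcl : Continuous fun t : ℝ => c y * fderiv ℝ G (snocE y t) (eN n) := by
    have h1 : Continuous fun t : ℝ => snocE y t :=
      (snocL n).continuous.comp (continuous_const.prodMk continuous_id)
    exact continuous_const.mul
      (((hG.continuous_fderiv (by norm_num)).comp h1).clm_apply continuous_const)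
  rw [integral_Ioi_of_hasDerivAt_of_tendsto' (m := 0) (fun t _ => hd t) ?_ ?_]
  · simp
  · have h3 : IntegrableOn (fun t : ℝ => c y * fderiv ℝ G (snocE y t) (eN n)) (Set.Icc 0 |R|) :=
      hcl.continuousOn.integrableOn_Icc
    have h4 : IntegrableOn (fun t : ℝ => c y * fderiv ℝ G (snocE y t) (eN n)) (Set.Ioi |R|) := by
      refine (integrableOn_zero (μ := volume)).congr_fun (fun t ht => ?_) measurableSet_Ioi
      rw [hz' t (lt_of_le_of_lt (le_abs_self R) ht)]
      simp
    refine (h3.union h4).mono_set fun t ht => ?_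
    by_cases h5 : t ≤ |R|
    · exact Or.inl ⟨(Set.mem_Ioi.1 ht).le, h5⟩
    · exact Or.inr (not_le.1 h5)
  · refine tendsto_const_nhds.congr' ?_
    filter_upwards [eventually_gt_atTop R] with t ht
    rw [hz t ht, mul_zero]

theorem div_thm {n : ℕ} {γ : EV n → ℝ} (hγ : ContDiff ℝ 1 γ) {F : EV (n + 1) → ℝ}
    (hF : ContDiff ℝ 1 F) (hs : HasCompactSupport F) (a : EV (n + 1)) :
    ∫ x in halfSpace γ, fderiv ℝ F x a
      = - ∫ y : EV n, inner ℝ (Nvec γ y) a * F (snocE y (γ y)) := by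
  have hγc := hγ.continuous
  set G : EV (n + 1) → ℝ := fun y => F (shear γ hγc y) with hGdef
  have hSc : ContDiff ℝ 1 (fun y : EV (n + 1) => y + γ (firstCoords y) • eN n) :=
    contDiff_id.add ((hγ.comp (fcL n).contDiff).smul contDiff_const)
  have hG : ContDiff ℝ 1 G := hF.comp hSc
  have hGs : HasCompactSupport G := hs.comp_homeomorph (shear γ hγc)
  have hSd : ∀ y : EV (n + 1), ∀ b, fderiv ℝ G y b =
      fderiv ℝ F (shear γ hγc y) (b + fderiv ℝ γ (firstCoords y) (firstCoords b) • eN n) := by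
    intro y b
    have h1 : HasFDerivAt (fun y : EV (n + 1) => γ (firstCoords y))
        ((fderiv ℝ γ (firstCoords y)).comp (fcL n)) y :=
      ((hγ.differentiable (by norm_num)) (firstCoords y)).hasFDerivAt.comp y (fcL n).hasFDerivAt
    have h2 := (hasFDerivAt_id (𝕜 := ℝ) y).add (h1.smul_const (eN n))
    have h3 := ((hF.differentiable (by norm_num)) (shear γ hγc y)).hasFDerivAt.comp y h2
    have h4 : fderiv ℝ G y = _ := h3.fderiv
    rw [h4]
    simp
  have hc1 : Continuous fun x => fderiv ℝ F x a :=
    (hF.continuous_fderiv (by norm_num)).clm_apply continuous_const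
  rw [int_shear hγc hc1 (hs.fderiv_apply (𝕜 := ℝ) a)]
  have e : ∀ y : EV (n + 1), fderiv ℝ F (shear γ hγc y) a =
      fderiv ℝ G y (snocE (firstCoords a) 0) +
      (a (Fin.last n) - fderiv ℝ γ (firstCoords y) (firstCoords a)) * fderiv ℝ G y (eN n) := by
    intro y
    have ha : a = snocE (firstCoords a) 0 + a (Fin.last n) • eN n := by
      rw [snocE_add_smul, zero_add, snocE_firstCoords]
    rw [hSd, hSd]
    simp only [firstCoords_snocE, firstCoords_eN, map_zero, zero_smul, add_zero]
    conv_lhs => rw [ha]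
    simp only [map_add, map_smul, smul_eq_mul]
    ring
  simp only [e]
  have hcγ : Continuous fun y : EV n => a (Fin.last n) - fderiv ℝ γ y (firstCoords a) :=
    continuous_const.sub ((hγ.continuous_fderiv (by norm_num)).clm_apply continuous_const)
  rw [integral_add, flat_tan hG hGs, flat_nor hG hGs hcγ, zero_add]
  · congr 1
    refine integral_congr_ae (ae_of_all _ fun y => ?_)
    simp only
    rw [inner_Nvec]
    congr 2
    show F (snocE y 0 + γ (firstCoords (snocE y 0)) • eN n) = _
    rw [firstCoords_snocE, snocE_add_smul, zero_add]
  · have hc : Continuous fun x => fderiv ℝ G x (snocE (firstCoords a) 0) :=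
      (hG.continuous_fderiv (by norm_num)).clm_apply continuous_const
    exact (hc.integrable_of_hasCompactSupport (hGs.fderiv_apply (𝕜 := ℝ) _)).integrableOn
  · have hc : Continuous fun x => (a (Fin.last n) - fderiv ℝ γ (firstCoords x) (firstCoords a)) *
        fderiv ℝ G x (eN n) := (hcγ.comp (fcL n).continuous).mul
      ((hG.continuous_fderiv (by norm_num)).clm_apply continuous_const)
    exact (hc.integrable_of_hasCompactSupport (hGs.fderiv_apply (𝕜 := ℝ) _).mul_left).integrableOn

/-! Utilities : integrals against test functions and lists of derivatives -/

theorem int_mul_test {m : ℕ} {μ : Measure (EV m)} [IsFiniteMeasureOnCompacts μ] {p : ℝ≥0∞}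
    (hp1 : 1 ≤ p) {f φ : EV m → ℝ} (hf : MemLp f p μ) (hφ : Continuous φ)
    (hs : HasCompactSupport φ) : Integrable (fun x => f x * φ x) μ := by
  haveI : Fact (1 ≤ p) := ⟨hp1⟩
  have h1 : MemLp φ (ENNReal.conjExponent p) μ := hφ.memLp_of_hasCompactSupport hs
  have h := MemLp.smul (p := p) (q := ENNReal.conjExponent p) (r := 1) h1 hf
  exact memLp_one_iff_integrable.1 h

theorem int_mul_test_le {m : ℕ} {μ : Measure (EV m)} [IsFiniteMeasureOnCompacts μ] {p : ℝ≥0∞}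
    (hp1 : 1 ≤ p) {φ : EV m → ℝ} (hφ : Continuous φ)
    (hs : HasCompactSupport φ) : ∃ C : ℝ≥0∞, C ≠ ⊤ ∧ ∀ f : EV m → ℝ, AEStronglyMeasurable f μ →
      ‖∫ x, f x * φ x ∂μ‖ₑ ≤ eLpNorm f p μ * C := by
  haveI : Fact (1 ≤ p) := ⟨hp1⟩
  have h1 : MemLp φ (ENNReal.conjExponent p) μ := hφ.memLp_of_hasCompactSupport hs
  refine ⟨eLpNorm φ (ENNReal.conjExponent p) μ, h1.2.ne, fun f hf => ?_⟩
  refine (enorm_integral_le_lintegral_enorm _).trans ?_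
  have := eLpNorm_smul_le_mul_eLpNorm (p := p) (q := ENNReal.conjExponent p) (r := 1) h1.1 hf
  rw [eLpNorm_one_eq_lintegral_enorm] at this
  exact this

theorem tendsto_int_test {m : ℕ} {μ : Measure (EV m)} [IsFiniteMeasureOnCompacts μ] {p : ℝ≥0∞}
    (hp1 : 1 ≤ p) {φ : EV m → ℝ} (hφ : Continuous φ) (hs : HasCompactSupport φ)
    {ι : Type*} {l : Filter ι} {f : ι → EV m → ℝ} {g : EV m → ℝ} (hf : ∀ k, MemLp (f k) p μ)
    (hg : MemLp g p μ) (h : Tendsto (fun k => eLpNorm (f k - g) p μ) l (𝓝 0)) :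
    Tendsto (fun k => ∫ x, f k x * φ x ∂μ) l (𝓝 (∫ x, g x * φ x ∂μ)) := by
  obtain ⟨C, hC, hb⟩ := int_mul_test_le (μ := μ) hp1 hφ hs
  rw [tendsto_iff_edist_tendsto_0]
  have h0 : Tendsto (fun k => eLpNorm (f k - g) p μ * C) l (𝓝 0) := by
    have := ENNReal.Tendsto.mul_const (b := C) h (Or.inr hC)
    rwa [zero_mul] at this
  refine tendsto_of_tendsto_of_tendsto_of_le_of_le tendsto_const_nhds h0 (fun _ => zero_le)
    fun k => ?_
  have hh := hb (f k - g) ((hf k).1.sub hg.1)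
  rw [edist_eq_enorm_sub, ← integral_sub (int_mul_test hp1 (hf k) hφ hs)
    (int_mul_test hp1 hg hφ hs)]
  simpa only [Pi.sub_apply, sub_mul] using hh

theorem lp_complete {X : Type*} [MeasurableSpace X] {μ : Measure X} {p : ℝ≥0∞} (hp1 : 1 ≤ p)
    {f : ℕ → X → ℝ} (hf : ∀ k, MemLp (f k) p μ)
    (h : Tendsto (fun q : ℕ × ℕ => eLpNorm (f q.1 - f q.2) p μ) atTop (𝓝 0)) :
    ∃ g, MemLp g p μ ∧ Tendsto (fun k => eLpNorm (f k - g) p μ) atTop (𝓝 0) := by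
  haveI : Fact (1 ≤ p) := ⟨hp1⟩
  have hc : CauchySeq fun k => (hf k).toLp (f k) := by
    refine (Lp.cauchySeq_Lp_iff_cauchySeq_eLpNorm _).2 (h.congr fun q => eLpNorm_congr_ae ?_)
    filter_upwards [(hf q.1).coeFn_toLp, (hf q.2).coeFn_toLp] with x hx hy
    simp [hx, hy]
  obtain ⟨G, hG⟩ := cauchySeq_tendsto_of_complete hc
  refine ⟨G, Lp.memLp G, ?_⟩
  rw [Lp.tendsto_Lp_iff_tendsto_eLpNorm'] at hG
  refine hG.congr fun k => eLpNorm_congr_ae ?_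
  filter_upwards [(hf k).coeFn_toLp] with x hx
  simp [hx]

/-- lists of length at most two -/
def L2 (m : ℕ) : Finset (List (Fin m)) := (List.finite_length_le (Fin m) 2).toFinset

theorem mem_L2 {m : ℕ} {l : List (Fin m)} : l ∈ L2 m ↔ l.length ≤ 2 := by
  simp [L2]

theorem L2_cases {m : ℕ} {P : List (Fin m) → Prop} (h0 : P []) (h1 : ∀ i, P [i])
    (h2 : ∀ i j, P [i, j]) (l : List (Fin m)) (hl : l ∈ L2 m) : P l := by
  rw [mem_L2] at hl
  match l, hl with
  | [], _ => exact h0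
  | [i], _ => exact h1 i
  | [i, j], _ => exact h2 i j

theorem pd_nil {m : ℕ} (u : EV m → ℝ) : partialDList [] u = u := rfl

theorem pd_one {m : ℕ} (u : EV m → ℝ) (i : Fin m) : partialDList [i] u = partialD i u := rfl

theorem pd_two {m : ℕ} (u : EV m → ℝ) (i j : Fin m) :
    partialDList [i, j] u = partialD i (partialD j u) := rfl

theorem pd_two_eq {m : ℕ} {u : EV m → ℝ} (hu : ContDiff ℝ 2 u) (i j : Fin m) (x : EV m) :
    partialDList [i, j] u x = fderiv ℝ (fderiv ℝ u) x (EuclideanSpace.single i 1)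
      (EuclideanSpace.single j 1) := partialD_partialD hu i j x

theorem pd_cont {m : ℕ} {u : EV m → ℝ} (hu : ContDiff ℝ 2 u) :
    ∀ l ∈ L2 m, Continuous (partialDList l u) := by
  refine L2_cases hu.continuous (fun i => ?_) (fun i j => ?_)
  · exact (hu.continuous_fderiv (by norm_num)).clm_apply continuous_const
  · simp_rw [funext (pd_two_eq hu i j)]
    exact ((cont_hess hu).clm_apply continuous_const).clm_apply continuous_const

theorem pd_c1 {m : ℕ} {u : EV m → ℝ} (hu : ContDiff ℝ 2 u) (i : Fin m) :
    ContDiff ℝ 1 (partialD i u) :=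
  (hu.fderiv_right (m := 1) (by norm_num)).clm_apply contDiff_const

theorem pd_sub {m : ℕ} {u v : EV m → ℝ} (hu : ContDiff ℝ 2 u) (hv : ContDiff ℝ 2 v) :
    ∀ l ∈ L2 m, partialDList l (u - v) = partialDList l u - partialDList l v := by
  have h1 : ∀ i, partialD i (u - v) = partialD i u - partialD i v := by
    intro i
    funext x
    simp only [partialD, Pi.sub_apply]
    rw [fderiv_sub (hu.differentiable (by norm_num) x) (hv.differentiable (by norm_num) x)]
    rfl
  refine L2_cases rfl h1 fun i j => ?_
  rw [pd_two, pd_two, pd_two, h1]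
  funext x
  simp only [partialD, Pi.sub_apply]
  have ha := (pd_c1 hu j).differentiable (by norm_num) x
  have hb := (pd_c1 hv j).differentiable (by norm_num) x
  unfold partialD at ha hb
  show fderiv ℝ ((fun x => fderiv ℝ u x (EuclideanSpace.single j 1)) -
    fun x => fderiv ℝ v x (EuclideanSpace.single j 1)) x (EuclideanSpace.single i 1) = _
  rw [fderiv_sub ha hb]
  rfl

theorem norm_single {m : ℕ} (i : Fin m) : ‖(EuclideanSpace.single i (1 : ℝ) : EV m)‖ = 1 := by
  simp

theorem pd_le_j2 {m : ℕ} {u : EV m → ℝ} (hu : ContDiff ℝ 2 u) (x : EV m) :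
    ∀ l ∈ L2 m, |partialDList l u x| ≤ j2 u x := by
  refine L2_cases (abs_le_j2 u x) (fun i => ?_) fun i j => ?_
  · have := (fderiv ℝ u x).le_opNorm (EuclideanSpace.single i 1)
    rw [norm_single, mul_one] at this
    exact this.trans (fd_le_j2 u x)
  · rw [pd_two_eq hu]
    have := nrm_bil (fderiv ℝ (fderiv ℝ u) x) (EuclideanSpace.single i 1)
      (EuclideanSpace.single j 1)
    have h4 : nrm (fderiv ℝ (fderiv ℝ u) x) = hn u x := by unfold hn; rfl
    rw [norm_single, norm_single, mul_one, mul_one, h4] at this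
    exact this.trans (hn_le_j2 u x)

theorem clm_norm_le_sum {m : ℕ} {F : Type*} [NormedAddCommGroup F] [NormedSpace ℝ F]
    (A : EV m →L[ℝ] F) : ‖A‖ ≤ ∑ i, ‖A (EuclideanSpace.single i 1)‖ := by
  refine A.opNorm_le_bound (Finset.sum_nonneg fun i _ => norm_nonneg _) fun w => ?_
  conv_lhs => rw [sum_single w]
  rw [map_sum, Finset.sum_mul]
  refine (norm_sum_le _ _).trans (Finset.sum_le_sum fun i _ => ?_)
  rw [map_smul, norm_smul, mul_comm]
  exact mul_le_mul_of_nonneg_left (PiLp.norm_apply_le w i) (norm_nonneg _)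

theorem j2_le_pd {m : ℕ} {u : EV m → ℝ} (hu : ContDiff ℝ 2 u) (x : EV m) :
    j2 u x ≤ (1 + m + m * m) * ∑ l ∈ L2 m, |partialDList l u x| := by
  set S := ∑ l ∈ L2 m, |partialDList l u x|
  have hS : ∀ l ∈ L2 m, |partialDList l u x| ≤ S := fun l hl =>
    Finset.single_le_sum (f := fun l => |partialDList l u x|) (fun _ _ => abs_nonneg _) hl
  have h0 : |u x| ≤ S := hS [] (by simp [mem_L2])
  have h1 : ‖fderiv ℝ u x‖ ≤ m * S := by
    refine (clm_norm_le_sum _).trans ?_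
    refine (Finset.sum_le_sum fun i _ => hS [i] (by simp [mem_L2])).trans ?_
    simp
  have h2 : hn u x ≤ m * m * S := by
    unfold hn nrm
    refine (clm_norm_le_sum _).trans ?_
    have : ∀ i, ‖fderiv ℝ (fderiv ℝ u) x (EuclideanSpace.single i 1)‖ ≤ m * S := by
      intro i
      refine (clm_norm_le_sum _).trans ?_
      refine (Finset.sum_le_sum fun j _ => ?_ : _ ≤ ∑ j : Fin m, S).trans (by simp)
      have := hS [i, j] (by simp [mem_L2])
      rwa [pd_two_eq hu] at this
    refine (Finset.sum_le_sum fun i _ => this i).trans ?_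
    simp [mul_assoc]
  unfold j2
  nlinarith

theorem eLp_j2_le {m : ℕ} {u : EV m → ℝ} (hu : ContDiff ℝ 2 u) {p : ℝ≥0∞} (hp1 : 1 ≤ p)
    (μ : Measure (EV m)) : eLpNorm (j2 u) p μ ≤
      ENNReal.ofReal (1 + m + m * m) * ∑ l ∈ L2 m, eLpNorm (partialDList l u) p μ := by
  have h1 : eLpNorm (j2 u) p μ ≤
      eLpNorm (fun x => ((1 : ℝ) + m + m * m) * ∑ l ∈ L2 m, |partialDList l u x|) p μ := by
    refine eLpNorm_mono_real fun x => ?_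
    rw [Real.norm_of_nonneg (j2_nonneg u x)]
    exact j2_le_pd hu x
  refine h1.trans ?_
  have h2 := eLpNorm_const_smul ((1 : ℝ) + m + m * m) (fun x => ∑ l ∈ L2 m, |partialDList l u x|) p μ
  refine (le_of_eq h2).trans ?_
  rw [← ofReal_norm, Real.norm_of_nonneg (by positivity)]
  refine mul_le_mul' le_rfl ?_
  have h3 := eLpNorm_sum_le (f := fun l x => |partialDList l u x|) (s := L2 m) (p := p) (μ := μ)
    (fun l hl => (pd_cont hu l hl).abs.aestronglyMeasurable) hp1
  have e : (∑ l ∈ L2 m, fun x => |partialDList l u x|) = fun x => ∑ l ∈ L2 m, |partialDList l u x| := by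
    funext x
    simp
  rw [e] at h3
  refine h3.trans (Finset.sum_le_sum fun l _ => ?_)
  exact (eLpNorm_norm (partialDList l u)).le

theorem eLp_pd_le {m : ℕ} {u : EV m → ℝ} (hu : ContDiff ℝ 2 u) {p : ℝ≥0∞}
    (μ : Measure (EV m)) (l) (hl : l ∈ L2 m) :
    eLpNorm (partialDList l u) p μ ≤ eLpNorm (j2 u) p μ :=
  eLpNorm_mono_real fun x => pd_le_j2 hu x l hl

theorem WNormD_eq {m : ℕ} (p : ℝ≥0∞) (μ : Measure (EV m)) (D : List (Fin m) → EV m → ℝ) :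
    WNormD 2 p μ D = ∑ l ∈ L2 m, eLpNorm (D l) p μ := by
  unfold WNormD
  rw [tsum_eq_sum (s := L2 m)]
  · refine Finset.sum_congr rfl fun l hl => ?_
    rw [if_pos (mem_L2.1 hl)]
  · intro l hl
    rw [mem_L2] at hl
    rw [if_neg hl]

theorem int_parts {n : ℕ} {γ : EV n → ℝ} (hγ : ContDiff ℝ 1 γ) {v φ : EV (n + 1) → ℝ}
    (hv : ContDiff ℝ 1 v) (hφ : ContDiff ℝ 1 φ) (hs : HasCompactSupport φ) (a : EV (n + 1)) :
    ∫ x in halfSpace γ, v x * fderiv ℝ φ x a = -(∫ x in halfSpace γ, fderiv ℝ v x a * φ x) -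
      ∫ y : EV n, inner ℝ (Nvec γ y) a * (v (snocE y (γ y)) * φ (snocE y (γ y))) := by
  have h := div_thm hγ (hv.mul hφ) (hs.mul_left (f := v)) a
  have e : ∀ x, fderiv ℝ (fun x => v x * φ x) x a = v x * fderiv ℝ φ x a + fderiv ℝ v x a * φ x := by
    intro x
    have h1 := (hv.differentiable (by norm_num) x).hasFDerivAt.mul
      (hφ.differentiable (by norm_num) x).hasFDerivAt
    have h2 := h1.fderiv
    have h3 : fderiv ℝ (fun x => v x * φ x) x = v x • fderiv ℝ φ x + φ x • fderiv ℝ v x := h2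
    rw [h3]
    simp [mul_comm]
  simp only [e] at h
  rw [integral_add] at h
  · linarith
  · exact ((hv.continuous.mul ((hφ.continuous_fderiv (by norm_num)).clm_apply
      continuous_const)).integrable_of_hasCompactSupport
      (hs.fderiv_apply (𝕜 := ℝ) a).mul_left).integrableOn
  · exact ((((hv.continuous_fderiv (by norm_num)).clm_apply
      continuous_const).mul hφ.continuous).integrable_of_hasCompactSupport hs.mul_left).integrableOn

theorem weak_of_smooth {n : ℕ} {γ : EV n → ℝ} (hγ : ContDiff ℝ 1 γ) {v : EV (n + 1) → ℝ}
    (hv : ContDiff ℝ 1 v) (i : Fin (n + 1)) :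
    WeakDerivOn (halfSpace γ) i v (partialD i v) := by
  intro φ hφ hs ht
  have h := int_parts hγ hv (hφ.of_le (by exact_mod_cast le_top)) hs (EuclideanSpace.single i 1)
  have h0 : ∀ y : EV n, φ (snocE y (γ y)) = 0 := by
    intro y
    by_contra hne
    have := ht (subset_tsupport _ hne)
    simp [halfSpace] at this
  simp only [h0, mul_zero, integral_zero, sub_zero] at h
  exact h

theorem sob_of_smooth {n : ℕ} {γ : EV n → ℝ} (hγ : ContDiff ℝ 1 γ) {v : EV (n + 1) → ℝ}
    (hv : ContDiff ℝ 2 v) (hs : HasCompactSupport v) (p : ℝ≥0∞) :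
    IsSobDerivs (halfSpace γ) 2 p v (fun l => partialDList l v) := by
  refine ⟨rfl, fun l hl i => ?_, fun l hl => ?_⟩
  · match l, hl with
    | [], _ => exact weak_of_smooth hγ (hv.of_le (by norm_num)) i
    | [j], _ => exact weak_of_smooth hγ (pd_c1 hv j) i
  · refine ((pd_cont hv l (mem_L2.2 hl)).memLp_of_hasCompactSupport ?_)
    have := L2_cases (P := fun l => HasCompactSupport (partialDList l v)) hs
      (fun i => hs.fderiv_apply (𝕜 := ℝ) _)
      (fun i j => (hs.fderiv_apply (𝕜 := ℝ) _).fderiv_apply (𝕜 := ℝ) _)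
    exact this l (mem_L2.2 hl)

/-- Green's formula without boundary term -/
def Green {m : ℕ} (Ω : Set (EV m)) (D : List (Fin m) → EV m → ℝ) : Prop :=
  ∀ φ : EV m → ℝ, ContDiff ℝ (⊤ : ℕ∞) φ → HasCompactSupport φ →
    ∑ i : Fin m, ∫ x in Ω, D [i, i] x * φ x = - ∑ i : Fin m, ∫ x in Ω, D [i] x * partialD i φ x

theorem one_sum {m : ℕ} (f : Fin m → Fin m → ℝ) :
    ∑ i, ∑ j, (1 : Matrix (Fin m) (Fin m) ℝ) i j * f i j = ∑ i, f i i := by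
  simp [Matrix.one_apply]

theorem green_of {m : ℕ} {Ω : Set (EV m)} {p : ℝ≥0∞} {u : EV m → ℝ}
    {D : List (Fin m) → EV m → ℝ} (h : NeumannBC Ω (1 : Matrix (Fin m) (Fin m) ℝ) p u)
    (hD : IsSobDerivs Ω 2 p u D) : Green Ω D := by
  intro φ hφ hs
  have := h D hD φ hφ hs
  rwa [one_sum (fun i j => ∫ x in Ω, D [i, j] x * φ x),
    one_sum (fun i j => ∫ x in Ω, D [j] x * partialD i φ x)] at this

theorem weak_unique {m : ℕ} {Ω : Set (EV m)} (hΩ : IsOpen Ω) {p : ℝ≥0∞} (hp1 : 1 ≤ p)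
    {i : Fin m} {f f' g g' : EV m → ℝ} (h : WeakDerivOn Ω i f g) (h' : WeakDerivOn Ω i f' g')
    (hf : f =ᵐ[volume.restrict Ω] f') (hg : MemLp g p (volume.restrict Ω))
    (hg' : MemLp g' p (volume.restrict Ω)) : g =ᵐ[volume.restrict Ω] g' := by
  have hl : LocallyIntegrableOn (fun x => g x - g' x) Ω volume :=
    locallyIntegrableOn_of_locallyIntegrable_restrict ((hg.sub hg').locallyIntegrable hp1)
  have := hΩ.ae_eq_zero_of_integral_contDiff_smul_eq_zero hl fun φ hφ hs ht => ?_
  · rw [EventuallyEq, ae_restrict_iff' hΩ.measurableSet]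
    filter_upwards [this] with x hx hxΩ
    linarith [hx hxΩ]
  · have h1 := h φ hφ hs ht
    have h2 := h' φ hφ hs ht
    have h3 : ∫ x in Ω, f x * partialD i φ x = ∫ x in Ω, f' x * partialD i φ x := by
      refine integral_congr_ae ?_
      filter_upwards [hf] with x hx
      rw [hx]
    have h4 : ∫ x in Ω, φ x • (g x - g' x) = 0 := by
      have : ∀ x, φ x • (g x - g' x) = g x * φ x - g' x * φ x := fun x => by
        rw [smul_eq_mul]; ring
      simp only [this]
      rw [integral_sub (int_mul_test hp1 hg hφ.continuous hs) (int_mul_test hp1 hg' hφ.continuous hs)]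
      linarith
    rw [← setIntegral_eq_integral_of_forall_compl_eq_zero (s := Ω), h4]
    intro x hx
    have : φ x = 0 := by
      by_contra hne
      exact hx (ht (subset_tsupport _ hne))
    rw [this, zero_smul]

theorem sob_unique {m : ℕ} {Ω : Set (EV m)} (hΩ : IsOpen Ω) {p : ℝ≥0∞} (hp1 : 1 ≤ p)
    {u : EV m → ℝ} {D D' : List (Fin m) → EV m → ℝ} (h : IsSobDerivs Ω 2 p u D)
    (h' : IsSobDerivs Ω 2 p u D') : ∀ l ∈ L2 m, D l =ᵐ[volume.restrict Ω] D' l := by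
  have h0 : D [] =ᵐ[volume.restrict Ω] D' [] := by rw [h.1, h'.1]
  have h1 : ∀ i, D [i] =ᵐ[volume.restrict Ω] D' [i] := fun i =>
    weak_unique hΩ hp1 (h.2.1 [] (by simp) i) (h'.2.1 [] (by simp) i) h0
      (h.2.2 [i] (by simp)) (h'.2.2 [i] (by simp))
  exact L2_cases h0 h1 fun i j =>
    weak_unique hΩ hp1 (h.2.1 [j] (by simp) i) (h'.2.1 [j] (by simp) i) (h1 j)
      (h.2.2 [i, j] (by simp)) (h'.2.2 [i, j] (by simp))

theorem neumann_of {m : ℕ} {Ω : Set (EV m)} (hΩ : IsOpen Ω) {p : ℝ≥0∞} (hp1 : 1 ≤ p)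
    {u : EV m → ℝ} {D : List (Fin m) → EV m → ℝ} (hD : IsSobDerivs Ω 2 p u D) (hG : Green Ω D) :
    MemWN Ω (1 : Matrix (Fin m) (Fin m) ℝ) 2 p u := by
  refine ⟨⟨D, hD⟩, fun D' hD' φ hφ hs => ?_⟩
  rw [one_sum (fun i j => ∫ x in Ω, D' [i, j] x * φ x),
    one_sum (fun i j => ∫ x in Ω, D' [j] x * partialD i φ x)]
  have hu := sob_unique hΩ hp1 hD hD'
  have e1 : ∀ i, ∫ x in Ω, D' [i, i] x * φ x = ∫ x in Ω, D [i, i] x * φ x := fun i => by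
    refine integral_congr_ae ?_
    filter_upwards [hu [i, i] (by simp [mem_L2])] with x hx
    rw [hx]
  have e2 : ∀ i, ∫ x in Ω, D' [i] x * partialD i φ x = ∫ x in Ω, D [i] x * partialD i φ x :=
    fun i => by
    refine integral_congr_ae ?_
    filter_upwards [hu [i] (by simp [mem_L2])] with x hx
    rw [hx]
  simp only [e1, e2]
  exact hG φ hφ hs

theorem pd_test_cont {m : ℕ} {φ : EV m → ℝ} (hφ : ContDiff ℝ (⊤ : ℕ∞) φ) (i : Fin m) :
    Continuous (partialD i φ) :=
  (hφ.continuous_fderiv (by simp)).clm_apply continuous_const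

theorem pd_test_cs {m : ℕ} {φ : EV m → ℝ} (hs : HasCompactSupport φ) (i : Fin m) :
    HasCompactSupport (partialD i φ) := hs.fderiv_apply (𝕜 := ℝ) _

theorem int_comb {m : ℕ} {Ω : Set (EV m)} {p : ℝ≥0∞} (hp1 : 1 ≤ p) {f g φ : EV m → ℝ}
    (hf : MemLp f p (volume.restrict Ω)) (hg : MemLp g p (volume.restrict Ω))
    (hφ : Continuous φ) (hs : HasCompactSupport φ) (a b : ℝ) :
    ∫ x in Ω, (a * f x + b * g x) * φ x = a * (∫ x in Ω, f x * φ x) + b * ∫ x in Ω, g x * φ x := by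
  have h1 := int_mul_test hp1 hf hφ hs
  have h2 := int_mul_test hp1 hg hφ hs
  rw [← integral_const_mul, ← integral_const_mul, ← integral_add (h1.const_mul a) (h2.const_mul b)]
  congr 1
  funext x
  ring

theorem sob_comb {m : ℕ} {Ω : Set (EV m)} {p : ℝ≥0∞} (hp1 : 1 ≤ p) {u v : EV m → ℝ}
    {D E : List (Fin m) → EV m → ℝ} (hD : IsSobDerivs Ω 2 p u D) (hE : IsSobDerivs Ω 2 p v E)
    (a b : ℝ) : IsSobDerivs Ω 2 p (fun x => a * u x + b * v x) (fun l x => a * D l x + b * E l x) := by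
  refine ⟨?_, fun l hl i φ hφ hs ht => ?_, fun l hl => ?_⟩
  · funext x
    show a * D [] x + b * E [] x = _
    rw [hD.1, hE.1]
  · have hl2 : l.length ≤ 2 := by omega
    have hl3 : (i :: l).length ≤ 2 := by simp; omega
    rw [int_comb hp1 (hD.2.2 l hl2) (hE.2.2 l hl2) (pd_test_cont hφ i) (pd_test_cs hs i),
      int_comb hp1 (hD.2.2 _ hl3) (hE.2.2 _ hl3) hφ.continuous hs, hD.2.1 l hl i φ hφ hs ht,
      hE.2.1 l hl i φ hφ hs ht]
    ring
  · exact ((hD.2.2 l hl).const_mul a).add ((hE.2.2 l hl).const_mul b)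

theorem green_comb {m : ℕ} {Ω : Set (EV m)} {p : ℝ≥0∞} (hp1 : 1 ≤ p) {u v : EV m → ℝ}
    {D E : List (Fin m) → EV m → ℝ} (hD : IsSobDerivs Ω 2 p u D) (hE : IsSobDerivs Ω 2 p v E)
    (gD : Green Ω D) (gE : Green Ω E)
    (a b : ℝ) : Green Ω (fun l x => a * D l x + b * E l x) := by
  intro φ hφ hs
  have e1 : ∀ i, ∫ x in Ω, (a * D [i, i] x + b * E [i, i] x) * φ x =
    a * (∫ x in Ω, D [i, i] x * φ x) + b * ∫ x in Ω, E [i, i] x * φ x := fun i =>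
    int_comb hp1 (hD.2.2 _ (by simp)) (hE.2.2 _ (by simp)) hφ.continuous hs a b
  have e2 : ∀ i, ∫ x in Ω, (a * D [i] x + b * E [i] x) * partialD i φ x =
    a * (∫ x in Ω, D [i] x * partialD i φ x) + b * ∫ x in Ω, E [i] x * partialD i φ x := fun i =>
    int_comb hp1 (hD.2.2 _ (by simp)) (hE.2.2 _ (by simp)) (pd_test_cont hφ i)
      (pd_test_cs hs i) a b
  simp only [e1, e2, Finset.sum_add_distrib, ← Finset.mul_sum]
  rw [gD φ hφ hs, gE φ hφ hs]
  ring

theorem graph_cs {n : ℕ} {φ : EV (n + 1) → ℝ} (hs : HasCompactSupport φ) (γ : EV n → ℝ) :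
    HasCompactSupport fun y : EV n => φ (snocE y (γ y)) := by
  refine HasCompactSupport.intro (hs.isCompact.image (fcL n).continuous) fun y hy => ?_
  by_contra hne
  exact hy ⟨_, subset_tsupport _ hne, by simp⟩

theorem green_parts {n : ℕ} {γ : EV n → ℝ} (hγ : ContDiff ℝ 1 γ) {v φ : EV (n + 1) → ℝ}
    (hv : ContDiff ℝ 2 v) (hφ : ContDiff ℝ 1 φ) (hs : HasCompactSupport φ) :
    ∑ i, ∫ x in halfSpace γ, partialD i v x * partialD i φ x =
      -(∑ i, ∫ x in halfSpace γ, partialD i (partialD i v) x * φ x) -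
      ∫ y : EV n, fderiv ℝ v (snocE y (γ y)) (Nvec γ y) * φ (snocE y (γ y)) := by
  have h := fun i => int_parts hγ (pd_c1 hv i) hφ hs (EuclideanSpace.single i 1)
  have e : ∑ i, ∫ x in halfSpace γ, partialD i v x * partialD i φ x = ∑ i,
    ∫ x in halfSpace γ, partialD i v x * fderiv ℝ φ x (EuclideanSpace.single i 1) := rfl
  rw [e, Finset.sum_congr rfl fun i _ => h i, Finset.sum_sub_distrib, Finset.sum_neg_distrib]
  congr 1
  have hgc : Continuous fun y : EV n => snocE y (γ y) :=
    (snocL n).continuous.comp (continuous_id.prodMk hγ.continuous)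
  rw [← integral_finsetSum]
  · congr 1
    funext y
    have h1 : fderiv ℝ v (snocE y (γ y)) (Nvec γ y) = ∑ i, Nvec γ y i * partialD i v (snocE y (γ y)) := by
      conv_lhs => rw [sum_single (Nvec γ y)]
      simp [partialD]
    rw [h1, Finset.sum_mul]
    refine Finset.sum_congr rfl fun i _ => ?_
    rw [EuclideanSpace.inner_single_right]
    simp
    ring
  · intro i _
    simp only [inner_Nvec]
    refine Continuous.integrable_of_hasCompactSupport ?_ ?_
    · exact (continuous_const.sub ((hγ.continuous_fderiv (by norm_num)).clm_apply
        continuous_const)).mul (((pd_c1 hv i).continuous.comp hgc).mul (hφ.continuous.comp hgc))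
    · exact ((graph_cs hs γ).mul_left).mul_left

theorem CN.green {n : ℕ} {γ : EV n → ℝ} (hγ : ContDiff ℝ 1 γ) {v : EV (n + 1) → ℝ}
    (hv : CN γ v) : Green (halfSpace γ) (fun l => partialDList l v) := by
  intro φ hφ hs
  have h := green_parts hγ hv.cd (hφ.of_le (by exact_mod_cast le_top)) hs
  simp only [hv.bc, zero_mul, integral_zero, sub_zero] at h
  show ∑ i, ∫ x in halfSpace γ, partialD i (partialD i v) x * φ x =
    -∑ i, ∫ x in halfSpace γ, partialD i v x * partialD i φ x
  rw [h, neg_neg]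

theorem CN.memWN {n : ℕ} {γ : EV n → ℝ} (hγ : ContDiff ℝ 1 γ) {v : EV (n + 1) → ℝ}
    (hv : CN γ v) {p : ℝ≥0∞} (hp1 : 1 ≤ p) :
    MemWN (halfSpace γ) (1 : Matrix (Fin (n + 1)) (Fin (n + 1)) ℝ) 2 p v :=
  neumann_of (halfSpace_open hγ.continuous) hp1 (sob_of_smooth hγ hv.cd hv.cs p) (hv.green hγ)

theorem CN.sub {n : ℕ} {γ : EV n → ℝ} {v w : EV (n + 1) → ℝ} (hv : CN γ v) (hw : CN γ w) :
    CN γ (v - w) where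
  cd := hv.cd.sub hw.cd
  cs := hv.cs.sub hw.cs
  bc := fun y => by
    rw [fderiv_sub (hv.cd.differentiable (by norm_num) _) (hw.cd.differentiable (by norm_num) _)]
    show fderiv ℝ v _ _ - fderiv ℝ w _ _ = 0
    rw [hv.bc, hw.bc, sub_zero]

/-! Mollification -/

theorem trans_cont {m : ℕ} {p : ℝ≥0∞} (hp1 : 1 ≤ p) (hp : p ≠ ⊤) {g : EV m → ℝ}
    (hg : MemLp g p volume) :
    Tendsto (fun t : EV m => eLpNorm (fun x => g (t + x) - g x) p volume) (𝓝 0) (𝓝 0) := by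
  haveI : Fact (1 ≤ p) := ⟨hp1⟩
  haveI : Fact (p ≠ ⊤) := ⟨hp⟩
  have hc : Continuous fun t : EV m => DomAddAct.mk t +ᵥ hg.toLp g :=
    continuous_vadd.comp ((DomAddAct.continuous_mk).prodMk continuous_const)
  have h0 := hc.tendsto 0
  have e0 : DomAddAct.mk (0 : EV m) +ᵥ hg.toLp g = hg.toLp g := by
    rw [DomAddAct.mk_zero, zero_vadd]
  simp only [e0] at h0
  rw [Lp.tendsto_Lp_iff_tendsto_eLpNorm'] at h0
  refine h0.congr fun t => eLpNorm_congr_ae ?_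
  rw [DomAddAct.mk_vadd_toLp]
  filter_upwards [hg.coeFn_toLp, MemLp.coeFn_toLp (hg.comp_measurePreserving
    (measurePreserving_vadd t (volume : Measure (EV m))))] with x h1 h2
  rw [Pi.sub_apply, h1]
  congr 1

/-- mollifying kernels -/
structure Moll {m : ℕ} (ζ : EV m → ℝ) (δ : ℝ) : Prop where
  cd : ContDiff ℝ (⊤ : ℕ∞) ζ
  nn : ∀ x, 0 ≤ ζ x
  int1 : ∫ x, ζ x = 1
  supp : ∀ x, ζ x ≠ 0 → ‖x‖ ≤ δ

theorem Moll.cs {m : ℕ} {ζ : EV m → ℝ} {δ : ℝ} (h : Moll ζ δ) : HasCompactSupport ζ :=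
  HasCompactSupport.intro (isCompact_closedBall (0 : EV m) δ) fun x hx => by
    by_contra hne
    exact hx (by simpa using h.supp x hne)

/-- mollification -/
def mol {m : ℕ} (ζ g : EV m → ℝ) (x : EV m) : ℝ := ∫ t, ζ t * g (x - t)

theorem mol_eq {m : ℕ} (ζ g : EV m → ℝ) :
    mol ζ g = convolution ζ g (ContinuousLinearMap.lsmul ℝ ℝ) volume := rfl

theorem mol_smooth {m : ℕ} {ζ g : EV m → ℝ} {k : ℕ∞} (hζ : ContDiff ℝ k ζ) (hs : HasCompactSupport ζ)
    (hg : LocallyIntegrable g volume) : ContDiff ℝ k (mol ζ g) := by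
  rw [mol_eq]
  exact hs.contDiff_convolution_left _ hζ hg

theorem mol_partial {m : ℕ} {ζ g : EV m → ℝ} (hζ : ContDiff ℝ 1 ζ) (hs : HasCompactSupport ζ)
    (hg : LocallyIntegrable g volume) (i : Fin m) (x : EV m) :
    partialD i (mol ζ g) x = mol (partialD i ζ) g x := by
  have h := hs.hasFDerivAt_convolution_left (ContinuousLinearMap.lsmul ℝ ℝ) hζ hg x
  unfold partialD
  rw [mol_eq, h.fderiv]
  have hi := (hs.fderiv (𝕜 := ℝ)).convolutionExists_left
    (ContinuousLinearMap.precompL (EV m) (ContinuousLinearMap.lsmul ℝ ℝ : ℝ →L[ℝ] ℝ →L[ℝ] ℝ))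
    (hζ.continuous_fderiv (by norm_num)) hg x
  unfold convolution
  rw [ContinuousLinearMap.integral_apply hi]
  rfl

theorem mol_swap {m : ℕ} (ζ g : EV m → ℝ) (x : EV m) : mol ζ g x = ∫ y, ζ (x - y) * g y := by
  unfold mol
  rw [← integral_sub_left_eq_self _ volume x]
  simp

theorem mol_int {m : ℕ} {ζ g : EV m → ℝ} (hζ : Continuous ζ) (hs : HasCompactSupport ζ)
    (hg : LocallyIntegrable g volume) (x : EV m) : Integrable fun t => ζ t * g (x - t) :=
  (hs.convolutionExists_left (ContinuousLinearMap.lsmul ℝ ℝ) hζ hg x : _)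

/-- mollification commutes with weak derivatives -/
theorem mol_weak {m : ℕ} {Ω : Set (EV m)} (hΩ : MeasurableSet Ω) {i : Fin m} {g g' : EV m → ℝ} (h : WeakDerivOn Ω i g g')
    {ζ : EV m → ℝ} (hζ : ContDiff ℝ (⊤ : ℕ∞) ζ) (hs : HasCompactSupport ζ)
    (hg : LocallyIntegrable (Ω.indicator g) volume) {x : EV m}
    (hx : tsupport (fun y => ζ (x - y)) ⊆ Ω) :
    partialD i (mol ζ (Ω.indicator g)) x = mol ζ (Ω.indicator g') x := by
  rw [mol_partial (hζ.of_le (by exact_mod_cast le_top)) hs hg, mol_swap, mol_swap]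
  have h1 := h (fun y => ζ (x - y)) (hζ.comp (contDiff_const.sub contDiff_id))
    (hs.comp_homeomorph (Homeomorph.subLeft x)) hx
  have e : ∀ y, partialD i (fun y => ζ (x - y)) y = - partialD i ζ (x - y) := by
    intro y
    unfold partialD
    have h2 := (hζ.differentiable (by simp) (x - y)).hasFDerivAt.comp y
      ((hasFDerivAt_id y).const_sub x)
    have h3 : fderiv ℝ (fun y => ζ (x - y)) y = _ := h2.fderiv
    rw [h3]
    simp
  simp only [e] at h1
  have e1 : ∀ f k : EV m → ℝ, ∫ y, f y * Ω.indicator k y = ∫ y in Ω, k y * f y := by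
    intro f k
    rw [← integral_indicator hΩ]
    congr 1
    funext y
    by_cases hy : y ∈ Ω <;> simp [hy, mul_comm]
  rw [e1 (fun y => partialD i ζ (x - y)), e1 (fun y => ζ (x - y))]
  simp only [mul_neg, integral_neg] at h1
  linarith

set_option maxHeartbeats 1000000 in
theorem mol_conv {m : ℕ} {p : ℝ≥0∞} (hp1 : 1 ≤ p) (hp : p ≠ ⊤) {g : EV m → ℝ}
    (hg : MemLp g p volume) {η : ℝ≥0∞} (hη : 0 < η) :
    ∃ δ > 0, ∀ ζ : EV m → ℝ, Moll ζ δ → eLpNorm (mol ζ g - g) p volume ≤ η := by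
  have ht := trans_cont hp1 hp hg
  rw [ENNReal.tendsto_nhds_zero] at ht
  obtain ⟨δ, hδ, hb⟩ := Metric.eventually_nhds_iff_ball.1 (ht η hη)
  refine ⟨δ / 2, by positivity, fun ζ hζ => ?_⟩
  set g' := hg.1.mk g with hg'd
  have hgg : g =ᵐ[volume] g' := hg.1.ae_eq_mk
  have hgm : StronglyMeasurable g' := hg.1.stronglyMeasurable_mk
  have hg' : MemLp g' p volume := hg.ae_eq hgg
  have hmol : mol ζ g = mol ζ g' := by
    funext x
    rw [mol_swap, mol_swap]
    refine integral_congr_ae ?_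
    filter_upwards [hgg] with y hy
    rw [hy]
  have e1 : eLpNorm (mol ζ g - g) p volume = eLpNorm (mol ζ g' - g') p volume := by
    refine eLpNorm_congr_ae ?_
    filter_upwards [hgg] with y hy
    simp [hmol, hy]
  have hq := one_le_toReal hp1 hp
  have hq0 : 0 < p.toReal := by linarith
  have hp0 : p ≠ 0 := (zero_lt_one.trans_le hp1).ne'
  have hb' : ∀ t : EV m, ‖t‖ ≤ δ / 2 →
      ∫⁻ x, ‖g' (x - t) - g' x‖ₑ ^ p.toReal ≤ η ^ p.toReal := by
    intro t htd
    have h1 := hb (-t) (by simp; linarith)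
    have h2 : eLpNorm (fun x => g (-t + x) - g x) p volume =
        eLpNorm (fun x => g' (x - t) - g' x) p volume := by
      refine eLpNorm_congr_ae ?_
      have h3 : ∀ᵐ x, g (-t + x) = g' (-t + x) :=
        (measurePreserving_add_left volume (-t)).quasiMeasurePreserving.ae hgg
      filter_upwards [hgg, h3] with x hx hx2
      rw [hx, hx2, neg_add_eq_sub]
    rw [h2, eLpNorm_eq_lintegral_rpow_enorm_toReal hp0 hp] at h1
    have h4 := ENNReal.rpow_le_rpow h1 hq0.le
    rwa [← ENNReal.rpow_mul, one_div, inv_mul_cancel₀ hq0.ne', ENNReal.rpow_one] at h4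
  rw [e1, eLpNorm_eq_lintegral_rpow_enorm_toReal hp0 hp]
  set ν := (volume : Measure (EV m)).withDensity (fun t => ENNReal.ofReal (ζ t)) with hν
  have hζm : Measurable fun t => ENNReal.ofReal (ζ t) := hζ.cd.continuous.measurable.ennreal_ofReal
  have hζi : Integrable ζ := hζ.cd.continuous.integrable_of_hasCompactSupport hζ.cs
  have hν1 : ν Set.univ = 1 := by
    rw [hν, withDensity_apply _ MeasurableSet.univ, Measure.restrict_univ,
      ← ofReal_integral_eq_lintegral_ofReal hζi (ae_of_all _ hζ.nn), hζ.int1, ENNReal.ofReal_one]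
  have hGm : Measurable fun q : EV m × EV m => ‖g' (q.1 - q.2) - g' q.1‖ₑ :=
    ((hgm.measurable.comp (measurable_fst.sub measurable_snd)).sub
      (hgm.measurable.comp measurable_fst)).enorm
  have hGx : ∀ x, Measurable fun t => ‖g' (x - t) - g' x‖ₑ := fun x =>
    hGm.comp (measurable_const.prodMk measurable_id)
  have hpt : ∀ x, ‖(mol ζ g' - g') x‖ₑ ^ p.toReal ≤ ∫⁻ t, ‖g' (x - t) - g' x‖ₑ ^ p.toReal ∂ν := by
    intro x
    have h1 : (mol ζ g' - g') x = ∫ t, ζ t * (g' (x - t) - g' x) := by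
      simp only [mul_sub]
      rw [integral_sub (mol_int hζ.cd.continuous hζ.cs (hg'.locallyIntegrable hp1) x)
        (hζi.mul_const _), integral_mul_const, hζ.int1, one_mul]
      rfl
    have h2 : ‖(mol ζ g' - g') x‖ₑ ≤ ∫⁻ t, ‖g' (x - t) - g' x‖ₑ ∂ν := by
      rw [h1, hν, lintegral_withDensity_eq_lintegral_mul _ hζm
        (hGx x)]
      refine (enorm_integral_le_lintegral_enorm _).trans (lintegral_mono fun t => ?_)
      simp only [Pi.mul_apply]
      rw [enorm_mul, ← ofReal_norm (ζ t), Real.norm_of_nonneg (hζ.nn t)]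
    have h3 := jensen_lint ν (h := fun t => ‖g' (x - t) - g' x‖ₑ)
      (hGx x).aemeasurable hq
    rw [hν1, ENNReal.one_rpow, one_mul] at h3
    exact (ENNReal.rpow_le_rpow h2 hq0.le).trans h3
  have hmain : ∫⁻ x, ‖(mol ζ g' - g') x‖ₑ ^ p.toReal ≤ η ^ p.toReal := by
    refine (lintegral_mono hpt).trans ?_
    rw [lintegral_lintegral_swap (hGm.pow_const _).aemeasurable]
    have hm2 : Measurable fun t => ∫⁻ x, ‖g' (x - t) - g' x‖ₑ ^ p.toReal :=
      ((hGm.pow_const p.toReal).comp measurable_swap).lintegral_prod_right'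
    rw [hν, lintegral_withDensity_eq_lintegral_mul _ hζm hm2]
    calc _ ≤ ∫⁻ t, ENNReal.ofReal (ζ t) * η ^ p.toReal := by
          refine lintegral_mono fun t => ?_
          simp only [Pi.mul_apply]
          by_cases h0 : ζ t = 0
          · simp [h0]
          · exact mul_le_mul' le_rfl (hb' t (hζ.supp t h0))
      _ = η ^ p.toReal := by
          rw [lintegral_mul_const _ hζm,
            ← ofReal_integral_eq_lintegral_ofReal hζi (ae_of_all _ hζ.nn), hζ.int1,
            ENNReal.ofReal_one, one_mul]
  calc _ ≤ (η ^ p.toReal) ^ (1 / p.toReal) := ENNReal.rpow_le_rpow hmain (by positivity)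
    _ = η := by rw [← ENNReal.rpow_mul, mul_one_div_cancel hq0.ne', ENNReal.rpow_one]

theorem exists_bump (m : ℕ) (c : EV m) {s : ℝ} (hs : 0 < s) :
    ∃ ζ : EV m → ℝ, Moll ζ (‖c‖ + s) ∧ tsupport ζ ⊆ Metric.closedBall c s := by
  let f : ContDiffBump c := ⟨s / 2, s, by positivity, by linarith⟩
  refine ⟨f.normed volume, ⟨f.contDiff_normed, f.nonneg_normed, f.integral_normed, fun x hx => ?_⟩,
    f.tsupport_normed_eq.subset⟩
  have : x ∈ Function.support (f.normed volume) := hx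
  rw [f.support_normed_eq, Metric.mem_ball, dist_eq_norm] at this
  have h2 := norm_add_le (x - c) c
  rw [sub_add_cancel] at h2
  have : ‖x - c‖ < s := this
  linarith

theorem Moll.mono {m : ℕ} {ζ : EV m → ℝ} {δ δ' : ℝ} (h : Moll ζ δ) (hd : δ ≤ δ') : Moll ζ δ' :=
  ⟨h.cd, h.nn, h.int1, fun x hx => (h.supp x hx).trans hd⟩

theorem mol_conv_all {m : ℕ} {p : ℝ≥0∞} (hp1 : 1 ≤ p) (hp : p ≠ ⊤) {G : List (Fin m) → EV m → ℝ}
    (hg : ∀ l ∈ L2 m, MemLp (G l) p volume) {η : ℝ≥0∞} (hη : 0 < η) :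
    ∃ δ > 0, ∀ ζ : EV m → ℝ, Moll ζ δ → ∀ l ∈ L2 m, eLpNorm (mol ζ (G l) - G l) p volume ≤ η := by
  have h1 : ∀ l ∈ L2 m, ∀ᶠ δ in 𝓝[>] (0 : ℝ), ∀ ζ : EV m → ℝ, Moll ζ δ →
      eLpNorm (mol ζ (G l) - G l) p volume ≤ η := by
    intro l hl
    obtain ⟨δ, hδ, hb⟩ := mol_conv hp1 hp (hg l hl) hη
    filter_upwards [Ioo_mem_nhdsGT hδ] with d hd ζ hζ
    exact hb ζ (hζ.mono hd.2.le)
  have h2 := (Filter.eventually_all_finset _).2 h1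
  obtain ⟨δ, hδ⟩ := (h2.and self_mem_nhdsWithin).exists
  exact ⟨δ, hδ.2, fun ζ hζ l hl => hδ.1 l hl ζ hζ⟩

theorem approx_one {n : ℕ} {γ : EV n → ℝ} {K : ℝ} (hg : GH γ K) {p : ℝ≥0∞} (hp1 : 1 ≤ p)
    (hp : p ≠ ⊤) {u : EV (n + 1) → ℝ} {D : List (Fin (n + 1)) → EV (n + 1) → ℝ}
    (hD : IsSobDerivs (halfSpace γ) 2 p u D) {η : ℝ≥0∞} (hη : 0 < η) :
    ∃ U : EV (n + 1) → ℝ, ContDiff ℝ 2 U ∧ ∀ l ∈ L2 (n + 1),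
      eLpNorm (partialDList l U - D l) p (volume.restrict (halfSpace γ)) ≤ η := by
  set Ω := halfSpace γ with hΩd
  have hΩo : IsOpen Ω := halfSpace_open hg.diff.continuous
  have hΩ : MeasurableSet Ω := hΩo.measurableSet
  have hG : ∀ l ∈ L2 (n + 1), MemLp (Ω.indicator (D l)) p volume := fun l hl =>
    (memLp_indicator_iff_restrict hΩ).2 (hD.2.2 l (mem_L2.1 hl))
  have hGl : ∀ l ∈ L2 (n + 1), LocallyIntegrable (Ω.indicator (D l)) volume := fun l hl =>
    (hG l hl).locallyIntegrable hp1
  obtain ⟨δ, hδ, hb⟩ := mol_conv_all hp1 hp hG hη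
  set s := δ / 3 with hs
  have hs0 : 0 < s := by positivity
  obtain ⟨ζ, hζ, ht⟩ := exists_bump (n + 1) (-((2 * s) • eN n)) hs0
  have hζ' : Moll ζ δ := hζ.mono (by
    rw [norm_neg, norm_smul, norm_eN, Real.norm_of_nonneg (by positivity)]
    linarith)
  have hx : ∀ x ∈ Ω, tsupport (fun y => ζ (x - y)) ⊆ Ω := by
    intro x hx y hy
    have e : tsupport (fun y => ζ (x - y)) = (Homeomorph.subLeft x) ⁻¹' tsupport ζ :=
      tsupport_comp_eq_preimage ζ (Homeomorph.subLeft x)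
    rw [e] at hy
    have hy2 : x - y ∈ Metric.closedBall (-((2 * s) • eN n)) s := ht hy
    rw [mem_closedBall_iff_norm, sub_neg_eq_add] at hy2
    set w := x - y + (2 * s) • eN n with hw
    have hy3 : y = (x - w) + (2 * s) • eN n := by rw [hw]; abel
    have hxm : γ (firstCoords x) < x (Fin.last n) := hx
    show γ (firstCoords y) < y (Fin.last n)
    have h1 : firstCoords y = firstCoords x - firstCoords w := by
      rw [hy3, firstCoords_add_smul]
      exact map_sub (fcL n) x w
    have h2 : y (Fin.last n) = x (Fin.last n) - w (Fin.last n) + 2 * s := by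
      rw [hy3]
      simp
    have h3 := hg.lip (firstCoords y) (firstCoords x)
    have h4 : ‖firstCoords y - firstCoords x‖ ≤ s := by
      rw [h1, sub_sub_cancel_left, norm_neg]
      exact (norm_firstCoords_le w).trans hy2
    have h5 := (abs_last_le w).trans hy2
    have h6 := abs_le.1 h5
    have h7 := abs_le.1 h3
    rw [h2]
    linarith
  have hm : ∀ l ∈ L2 (n + 1), ContDiff ℝ (⊤ : ℕ∞) (mol ζ (Ω.indicator (D l))) := fun l hl =>
    mol_smooth hζ.cd hζ.cs (hGl l hl)
  have hw : ∀ l, l.length < 2 → ∀ i, ∀ x ∈ Ω,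
      partialD i (mol ζ (Ω.indicator (D l))) x = mol ζ (Ω.indicator (D (i :: l))) x :=
    fun l hl i x hxx => mol_weak hΩ (hD.2.1 l hl i) hζ.cd hζ.cs
      (hGl l (mem_L2.2 (by omega))) (hx x hxx)
  have hmem0 : [] ∈ L2 (n + 1) := by simp [mem_L2]
  set U := mol ζ (Ω.indicator (D [])) with hU
  have key : ∀ l ∈ L2 (n + 1), ∀ x ∈ Ω, partialDList l U x = mol ζ (Ω.indicator (D l)) x := by
    refine L2_cases (fun x _ => rfl) (fun i x hxx => hw [] (by simp) i x hxx) fun i j x hxx => ?_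
    rw [pd_two]
    have h1 : partialD j U =ᶠ[𝓝 x] mol ζ (Ω.indicator (D [j])) := by
      filter_upwards [hΩo.mem_nhds hxx] with y hy
      exact hw [] (by simp) j y hy
    have h2 : partialD i (partialD j U) x = partialD i (mol ζ (Ω.indicator (D [j]))) x := by
      show fderiv ℝ (partialD j U) x _ = fderiv ℝ (mol ζ (Ω.indicator (D [j]))) x _
      rw [h1.fderiv_eq]
    rw [h2]
    exact hw [j] (by simp) i x hxx
  refine ⟨U, by exact_mod_cast contDiff_infty.1 (hm [] hmem0) 2, fun l hl => ?_⟩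
  have h1 := hb ζ hζ' l hl
  refine le_trans ?_ h1
  have h2 : eLpNorm (partialDList l U - D l) p (volume.restrict Ω) =
      eLpNorm (mol ζ (Ω.indicator (D l)) - Ω.indicator (D l)) p (volume.restrict Ω) := by
    refine eLpNorm_congr_ae ((ae_restrict_iff' hΩ).2 (ae_of_all _ fun x hxx => ?_))
    simp [key l hl x hxx, hxx]
  rw [h2]
  exact eLpNorm_mono_measure _ Measure.restrict_le_self

theorem approx_seq {n : ℕ} {γ : EV n → ℝ} {K : ℝ} (hg : GH γ K) {p : ℝ≥0∞} (hp1 : 1 ≤ p)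
    (hp : p ≠ ⊤) {u : EV (n + 1) → ℝ} {D : List (Fin (n + 1)) → EV (n + 1) → ℝ}
    (hD : IsSobDerivs (halfSpace γ) 2 p u D) :
    ∃ U : ℕ → EV (n + 1) → ℝ, (∀ k, ContDiff ℝ 2 (U k)) ∧
      (∀ k, ∀ l ∈ L2 (n + 1), MemLp (partialDList l (U k)) p (volume.restrict (halfSpace γ))) ∧
      ∀ l ∈ L2 (n + 1), Tendsto (fun k => eLpNorm (partialDList l (U k) - D l) p
        (volume.restrict (halfSpace γ))) atTop (𝓝 0) := by
  have hη : ∀ k : ℕ, (0 : ℝ≥0∞) < ((k : ℝ≥0∞) + 1)⁻¹ := fun k => by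
    simp
  choose U hU hb using fun k : ℕ => approx_one hg hp1 hp hD (hη k)
  refine ⟨U, hU, fun k l hl => ?_, fun l hl => ?_⟩
  · have h1 : MemLp (partialDList l (U k) - D l) p (volume.restrict (halfSpace γ)) := by
      refine ⟨(pd_cont (hU k) l hl).aestronglyMeasurable.sub (hD.2.2 l (mem_L2.1 hl)).1, ?_⟩
      refine (hb k l hl).trans_lt ?_
      simp
    have h2 := h1.add (hD.2.2 l (mem_L2.1 hl))
    rwa [sub_add_cancel] at h2
  · refine tendsto_of_tendsto_of_tendsto_of_le_of_le tendsto_const_nhds ?_ (fun _ => zero_le)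
      fun k => hb k l hl
    have := (ENNReal.tendsto_inv_nat_nhds_zero).comp (tendsto_add_atTop_nat 1)
    refine this.congr fun k => ?_
    simp

def grL (n : ℕ) : (EV n →L[ℝ] ℝ) →L[ℝ] EV n :=
  LinearMap.mkContinuous
    { toFun := fun l => (InnerProductSpace.toDual ℝ (EV n)).symm l
      map_add' := fun x y => map_add _ x y
      map_smul' := fun c x => by
        have := (InnerProductSpace.toDual ℝ (EV n)).symm.map_smulₛₗ c x
        simpa using this } 1 (fun l => by
      rw [one_mul]
      exact le_of_eq ((InnerProductSpace.toDual ℝ (EV n)).symm.norm_map l))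

theorem grL_apply {n : ℕ} (l : EV n →L[ℝ] ℝ) :
    grL n l = (InnerProductSpace.toDual ℝ (EV n)).symm l := rfl

theorem norm_grL {n : ℕ} (l : EV n →L[ℝ] ℝ) : ‖grL n l‖ = ‖l‖ := by
  rw [grL_apply, LinearIsometryEquiv.norm_map]

theorem norm_snocE_le {n : ℕ} (x : EV n) (t : ℝ) : ‖snocE x t‖ ≤ ‖x‖ + |t| := by
  have h := norm_snocE_sq x t
  have h2 : ‖snocE x t‖ ^ 2 ≤ (‖x‖ + |t|) ^ 2 := by
    rw [h]
    nlinarith [mul_nonneg (norm_nonneg x) (abs_nonneg t), sq_abs t]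
  exact le_of_sq_le_sq h2 (by positivity)
where
  le_of_sq_le_sq {a b : ℝ} (h : a ^ 2 ≤ b ^ 2) (hb : 0 ≤ b) : a ≤ b := by
    have := abs_le_abs_of_sq_le_sq h
    rw [abs_of_nonneg hb] at this
    exact (le_abs_self a).trans this
  abs_le_abs_of_sq_le_sq {a b : ℝ} (h : a ^ 2 ≤ b ^ 2) : |a| ≤ |b| := sq_le_sq.1 h

theorem lip_of_hn {E F : Type*} [NormedAddCommGroup E] [NormedSpace ℝ E] [NormedAddCommGroup F]
    [NormedSpace ℝ F] {f : E → F} (hf : ContDiff ℝ 2 f) {K : ℝ} (hK : ∀ x, hn f x ≤ K) (x y : E) :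
    ‖fderiv ℝ f x - fderiv ℝ f y‖ ≤ K * ‖x - y‖ := by
  have h1 : ContDiff ℝ 1 (fderiv ℝ f) := hf.fderiv_right (by norm_num)
  exact Convex.norm_image_sub_le_of_norm_fderiv_le (𝕜 := ℝ)
    (fun z _ => h1.differentiable (by norm_num) z) (fun z _ => by have := hK z; unfold hn nrm at this; exact this) convex_univ
    (Set.mem_univ _) (Set.mem_univ _)

def GG {n : ℕ} (γ : EV n → ℝ) (y : EV n) : EV n := grL n (fderiv ℝ γ y)

section
variable {n : ℕ} {γ : EV n → ℝ} {K : ℝ}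

theorem GH.fd_c2 (h : GH γ K) : ContDiff ℝ 2 (fderiv ℝ γ) := h.c3.fderiv_right (by norm_num)

theorem GH.GG_c2 (h : GH γ K) : ContDiff ℝ 2 (GG γ) := (grL n).contDiff.comp h.fd_c2

theorem GH.GG_norm (h : GH γ K) (y : EV n) : ‖GG γ y‖ ≤ 1 / 8 := by
  unfold GG; rw [norm_grL]; exact h.d1 y

theorem GH.GG_lip (h : GH γ K) (x y : EV n) : ‖GG γ x - GG γ y‖ ≤ K * ‖x - y‖ := by
  unfold GG; rw [← map_sub, norm_grL]
  exact lip_of_hn (h.c3.of_le (by norm_num)) h.d2 x y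

theorem GH.GG_fd (h : GH γ K) (y : EV n) (a : EV n) :
    fderiv ℝ (GG γ) y a = grL n (fderiv ℝ (fderiv ℝ γ) y a) := by
  have h1 := (grL n).hasFDerivAt.comp y ((h.fd_c2.differentiable (by norm_num) y).hasFDerivAt)
  have h2 : HasFDerivAt (GG γ) ((grL n).comp (fderiv ℝ (fderiv ℝ γ) y)) y := h1
  rw [h2.fderiv]; rfl

theorem GH.GG_fd_norm (h : GH γ K) (y : EV n) (a : EV n) : ‖fderiv ℝ (GG γ) y a‖ ≤ K * ‖a‖ := by
  rw [h.GG_fd, norm_grL]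
  refine ((fderiv ℝ (fderiv ℝ γ) y).le_opNorm a).trans ?_
  exact mul_le_mul_of_nonneg_right (by have := h.d2 y; unfold hn nrm at this; exact this) (norm_nonneg _)

theorem GH.GG_fd_lip (h : GH γ K) (x y : EV n) (a : EV n) :
    ‖fderiv ℝ (GG γ) x a - fderiv ℝ (GG γ) y a‖ ≤ K * ‖x - y‖ * ‖a‖ := by
  rw [h.GG_fd, h.GG_fd, ← map_sub, norm_grL]
  have e : fderiv ℝ (fderiv ℝ γ) x a - fderiv ℝ (fderiv ℝ γ) y a =
    (fderiv ℝ (fderiv ℝ γ) x - fderiv ℝ (fderiv ℝ γ) y) a := rfl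
  rw [e]
  refine ((fderiv ℝ (fderiv ℝ γ) x - fderiv ℝ (fderiv ℝ γ) y).le_opNorm a).trans ?_
  exact mul_le_mul_of_nonneg_right (lip_of_hn h.fd_c2 h.d3 x y) (norm_nonneg _)

/-- the change of variables straightening the boundary -/
def Psi {n : ℕ} (γ : EV n → ℝ) (κ : ℝ) (y : EV (n + 1)) : EV (n + 1) :=
  y + snocL n (-((κ * Real.sin (κ⁻¹ * lastL n y)) • GG γ (fcL n y)), γ (fcL n y))

theorem GH.Psi_c2 (h : GH γ K) (κ : ℝ) : ContDiff ℝ 2 (Psi γ κ) := by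
  unfold Psi
  refine contDiff_id.add ((snocL n).contDiff.comp (ContDiff.prodMk ?_ ?_))
  · refine ContDiff.neg (ContDiff.fun_smul ?_ (h.GG_c2.comp (fcL n).contDiff))
    exact contDiff_const.mul (Real.contDiff_sin.comp (contDiff_const.mul (lastL n).contDiff))
  · exact (h.c3.of_le (by norm_num)).comp (fcL n).contDiff

theorem GH.Psi_fd (h : GH γ K) {κ : ℝ} (hκ : κ ≠ 0) (y a : EV (n + 1)) :
    fderiv ℝ (Psi γ κ) y a = a + snocE
      (-((Real.cos (κ⁻¹ * y (Fin.last n)) * a (Fin.last n)) • GG γ (firstCoords y)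
        + (κ * Real.sin (κ⁻¹ * y (Fin.last n))) • fderiv ℝ (GG γ) (firstCoords y) (firstCoords a)))
      (fderiv ℝ γ (firstCoords y) (firstCoords a)) := by
  have h1 : HasFDerivAt (fun y => GG γ (fcL n y)) ((fderiv ℝ (GG γ) (fcL n y)).comp (fcL n)) y :=
    (h.GG_c2.differentiable (by norm_num) _).hasFDerivAt.comp y (fcL n).hasFDerivAt
  have h2 : HasFDerivAt (fun y => γ (fcL n y)) ((fderiv ℝ γ (fcL n y)).comp (fcL n)) y :=
    (h.c3.differentiable (by norm_num) _).hasFDerivAt.comp y (fcL n).hasFDerivAt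
  have h3 : HasFDerivAt (fun y => κ * Real.sin (κ⁻¹ * lastL n y))
      (κ • (Real.cos (κ⁻¹ * lastL n y) • κ⁻¹ • lastL n)) y := by
    have h30 : HasFDerivAt (fun y => κ⁻¹ * lastL n y) (κ⁻¹ • lastL n) y :=
      (lastL n).hasFDerivAt.const_mul κ⁻¹
    exact (h30.sin).const_mul κ
  have h4 := (h3.smul h1).neg
  have h5 := (hasFDerivAt_id y).add ((snocL n).hasFDerivAt.comp y (h4.prodMk h2))
  have h6 : HasFDerivAt (Psi γ κ) _ y := h5
  rw [h6.fderiv]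
  have e : ∀ z : EV (n + 1), lastL n z = z (Fin.last n) := fun z => rfl
  have e2 : ∀ z : EV (n + 1), fcL n z = firstCoords z := fun z => rfl
  have e3 : ∀ (z : EV n) (t : ℝ), snocL n (z, t) = snocE z t := fun z t => rfl
  simp only [ContinuousLinearMap.add_apply, ContinuousLinearMap.comp_apply,
    ContinuousLinearMap.prod_apply, ContinuousLinearMap.neg_apply, ContinuousLinearMap.smul_apply,
    ContinuousLinearMap.smulRight_apply, e, e2, e3, smul_eq_mul, ContinuousLinearMap.id_apply]
  have e4 : κ * (Real.cos (κ⁻¹ * y (Fin.last n)) * (κ⁻¹ * a (Fin.last n))) =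
    Real.cos (κ⁻¹ * y (Fin.last n)) * a (Fin.last n) := by field_simp
  rw [e4, add_comm ((κ * Real.sin (κ⁻¹ * y (Fin.last n))) • _)]

theorem sin_scaled {κ : ℝ} (hκ : 0 < κ) (t s : ℝ) :
    |κ * Real.sin (κ⁻¹ * t) - κ * Real.sin (κ⁻¹ * s)| ≤ |t - s| := by
  have h1 : |Real.sin (κ⁻¹ * t) - Real.sin (κ⁻¹ * s)| ≤ |κ⁻¹ * t - κ⁻¹ * s| := by
    have := Real.lipschitzWith_sin.dist_le_mul (κ⁻¹ * t) (κ⁻¹ * s)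
    simpa [Real.dist_eq] using this
  rw [← mul_sub, abs_mul, abs_of_pos hκ]
  rw [← mul_sub, abs_mul, abs_of_pos (inv_pos.2 hκ)] at h1
  calc _ ≤ κ * (κ⁻¹ * |t - s|) := mul_le_mul_of_nonneg_left h1 hκ.le
    _ = |t - s| := by field_simp

theorem cos_scaled {κ : ℝ} (hκ : 0 < κ) (t s : ℝ) :
    |Real.cos (κ⁻¹ * t) - Real.cos (κ⁻¹ * s)| ≤ κ⁻¹ * |t - s| := by
  have := Real.lipschitzWith_cos.dist_le_mul (κ⁻¹ * t) (κ⁻¹ * s)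
  rw [Real.dist_eq, Real.dist_eq, ← mul_sub, abs_mul κ⁻¹, abs_of_pos (inv_pos.2 hκ)] at this
  simpa using this

theorem sin_le {κ : ℝ} (hκ : 0 < κ) (t : ℝ) : |κ * Real.sin (κ⁻¹ * t)| ≤ κ := by
  rw [abs_mul, abs_of_pos hκ]
  nlinarith [Real.abs_sin_le_one (κ⁻¹ * t)]

theorem GH.Psi_near (h : GH γ K) {κ : ℝ} (hκ : 0 < κ) (hK : κ * K ≤ 1 / 8) (y a : EV (n + 1)) :
    ‖fderiv ℝ (Psi γ κ) y a - a‖ ≤ 1 / 2 * ‖a‖ := by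
  rw [h.Psi_fd hκ.ne', add_sub_cancel_left]
  have ha := norm_firstCoords_le a
  have hl := abs_last_le a
  have h1 := h.GG_norm (firstCoords y)
  have h2 := h.GG_fd_norm (firstCoords y) (firstCoords a)
  have h3 := (fderiv ℝ γ (firstCoords y)).le_opNorm (firstCoords a)
  have h4 := h.d1 (firstCoords y)
  have h5 := sin_le hκ (y (Fin.last n))
  have h6 := Real.abs_cos_le_one (κ⁻¹ * y (Fin.last n))
  rw [Real.norm_eq_abs] at h3
  refine (norm_snocE_le _ _).trans ?_
  rw [norm_neg]
  have t1 := norm_add_le ((Real.cos (κ⁻¹ * y (Fin.last n)) * a (Fin.last n)) • GG γ (firstCoords y))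
    ((κ * Real.sin (κ⁻¹ * y (Fin.last n))) • fderiv ℝ (GG γ) (firstCoords y) (firstCoords a))
  rw [norm_smul, norm_smul, Real.norm_eq_abs, Real.norm_eq_abs, abs_mul (Real.cos _)] at t1
  have t2 : |Real.cos (κ⁻¹ * y (Fin.last n))| * |a (Fin.last n)| * ‖GG γ (firstCoords y)‖ ≤
      1 * ‖a‖ * (1 / 8) := by gcongr
  have t3 : |κ * Real.sin (κ⁻¹ * y (Fin.last n))| *
      ‖fderiv ℝ (GG γ) (firstCoords y) (firstCoords a)‖ ≤ κ * (K * ‖a‖) := by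
    refine mul_le_mul h5 (h2.trans ?_) (norm_nonneg _) hκ.le
    exact mul_le_mul_of_nonneg_left ha h.K0
  have t4 : |fderiv ℝ γ (firstCoords y) (firstCoords a)| ≤ 1 / 8 * ‖a‖ :=
    h3.trans (mul_le_mul h4 ha (norm_nonneg _) (by norm_num))
  have t5 : κ * (K * ‖a‖) ≤ 1 / 8 * ‖a‖ := by
    rw [← mul_assoc]; exact mul_le_mul_of_nonneg_right hK (norm_nonneg _)
  have := norm_nonneg a
  linarith

theorem GH.Psi_lip (h : GH γ K) {κ : ℝ} (hκ : 0 < κ) (y z a : EV (n + 1)) :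
    ‖fderiv ℝ (Psi γ κ) y a - fderiv ℝ (Psi γ κ) z a‖ ≤
      (κ⁻¹ + 3 * K + κ * K) * ‖y - z‖ * ‖a‖ := by
  rw [h.Psi_fd hκ.ne', h.Psi_fd hκ.ne', add_sub_add_left_eq_sub]
  have e3 : ∀ (z : EV n) (t : ℝ), snocL n (z, t) = snocE z t := fun z t => rfl
  rw [← e3, ← e3, ← map_sub, Prod.mk_sub_mk, e3]
  have ha := norm_firstCoords_le a
  have hl := abs_last_le a
  have hyz : ‖firstCoords y - firstCoords z‖ ≤ ‖y - z‖ := by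
    have := norm_firstCoords_le (y - z)
    have e : firstCoords (y - z) = firstCoords y - firstCoords z := map_sub (fcL n) y z
    rwa [e] at this
  have hyl : |y (Fin.last n) - z (Fin.last n)| ≤ ‖y - z‖ := by
    have := abs_last_le (y - z); simpa using this
  set c1 := Real.cos (κ⁻¹ * y (Fin.last n))
  set c2 := Real.cos (κ⁻¹ * z (Fin.last n))
  set s1 := κ * Real.sin (κ⁻¹ * y (Fin.last n))
  set s2 := κ * Real.sin (κ⁻¹ * z (Fin.last n))
  have hc : |c1 - c2| ≤ κ⁻¹ * ‖y - z‖ := (cos_scaled hκ _ _).trans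
    (mul_le_mul_of_nonneg_left hyl (inv_pos.2 hκ).le)
  have hs : |s1 - s2| ≤ ‖y - z‖ := (sin_scaled hκ _ _).trans hyl
  have hs2 : |s2| ≤ κ := sin_le hκ _
  have hc2 : |c2| ≤ 1 := Real.abs_cos_le_one _
  have g1 := h.GG_norm (firstCoords y)
  have g2 := (h.GG_lip (firstCoords y) (firstCoords z)).trans (mul_le_mul_of_nonneg_left hyz h.K0)
  have g3 := (h.GG_fd_norm (firstCoords y) (firstCoords a)).trans (mul_le_mul_of_nonneg_left ha h.K0)
  have g4 : ‖fderiv ℝ (GG γ) (firstCoords y) (firstCoords a) -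
      fderiv ℝ (GG γ) (firstCoords z) (firstCoords a)‖ ≤ K * ‖y - z‖ * ‖a‖ :=
    (h.GG_fd_lip (firstCoords y) (firstCoords z) (firstCoords a)).trans
    (mul_le_mul (mul_le_mul_of_nonneg_left hyz h.K0) ha (norm_nonneg _)
      (mul_nonneg h.K0 (norm_nonneg _)))
  have g5 : |fderiv ℝ γ (firstCoords y) (firstCoords a) - fderiv ℝ γ (firstCoords z) (firstCoords a)|
      ≤ K * ‖y - z‖ * ‖a‖ := by
    have := (fderiv ℝ γ (firstCoords y) - fderiv ℝ γ (firstCoords z)).le_opNorm (firstCoords a)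
    refine this.trans ?_
    have l1 := lip_of_hn (h.c3.of_le (by norm_num)) h.d2 (firstCoords y) (firstCoords z)
    exact mul_le_mul (l1.trans (mul_le_mul_of_nonneg_left hyz h.K0)) ha (norm_nonneg _)
      (mul_nonneg h.K0 (norm_nonneg _))
  set p1 := GG γ (firstCoords y)
  set p2 := GG γ (firstCoords z)
  set q1 := fderiv ℝ (GG γ) (firstCoords y) (firstCoords a)
  set q2 := fderiv ℝ (GG γ) (firstCoords z) (firstCoords a)
  have e : -((c1 * a (Fin.last n)) • p1 + s1 • q1) - -((c2 * a (Fin.last n)) • p2 + s2 • q2) =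
      -((((c1 - c2) * a (Fin.last n)) • p1 + (c2 * a (Fin.last n)) • (p1 - p2)) +
        ((s1 - s2) • q1 + s2 • (q1 - q2))) := by
    simp only [sub_mul, sub_smul, smul_sub]; abel
  rw [e]
  refine (norm_snocE_le _ _).trans ?_
  rw [norm_neg]
  have n1 := norm_add₃_le (a := ((c1 - c2) * a (Fin.last n)) • p1) (b := (c2 * a (Fin.last n)) • (p1 - p2))
    (c := (s1 - s2) • q1 + s2 • (q1 - q2))
  have n2 := norm_add_le ((s1 - s2) • q1) (s2 • (q1 - q2))
  have m1 : ‖((c1 - c2) * a (Fin.last n)) • p1‖ ≤ (κ⁻¹ * ‖y - z‖) * ‖a‖ * (1 / 8) := by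
    rw [norm_smul, norm_mul, Real.norm_eq_abs, Real.norm_eq_abs]
    gcongr
  have m2 : ‖(c2 * a (Fin.last n)) • (p1 - p2)‖ ≤ 1 * ‖a‖ * (K * ‖y - z‖) := by
    rw [norm_smul, norm_mul, Real.norm_eq_abs, Real.norm_eq_abs]
    gcongr
  have m3 : ‖(s1 - s2) • q1‖ ≤ ‖y - z‖ * (K * ‖a‖) := by
    rw [norm_smul, Real.norm_eq_abs]
    gcongr
  have m4 : ‖s2 • (q1 - q2)‖ ≤ κ * (K * ‖y - z‖ * ‖a‖) := by
    rw [norm_smul, Real.norm_eq_abs]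
    gcongr
  have hp : 0 ≤ κ⁻¹ * ‖y - z‖ * ‖a‖ := by positivity
  nlinarith

end

theorem det_ne {m : ℕ} {T : EV m →L[ℝ] EV m} (hT : ∀ a, ‖T a - a‖ ≤ 1 / 2 * ‖a‖) : T.det ≠ 0 := by
  intro h0
  have h1 := LinearMap.bot_lt_ker_of_det_eq_zero (f := (T : EV m →ₗ[ℝ] EV m)) h0
  obtain ⟨a, ha, hne⟩ := (Submodule.ne_bot_iff _).1 h1.ne'
  have h2 := hT a
  have h3 : T a = 0 := ha
  rw [h3, zero_sub, norm_neg] at h2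
  have : 0 < ‖a‖ := norm_pos_iff.2 hne
  linarith

theorem det_bound (m : ℕ) : ∃ A : ℝ, 0 < A ∧ ∀ T : EV m →L[ℝ] EV m, (∀ a, ‖T a - a‖ ≤ 1 / 2 * ‖a‖) →
    |T.det| ≤ A ∧ |T.det|⁻¹ ≤ A := by
  haveI : ProperSpace (EV m →L[ℝ] EV m) := FiniteDimensional.proper ℝ _
  have hc : IsCompact (Metric.closedBall (ContinuousLinearMap.id ℝ (EV m)) (1 / 2)) :=
    isCompact_closedBall _ _
  have hmem : ∀ T : EV m →L[ℝ] EV m, T ∈ Metric.closedBall (ContinuousLinearMap.id ℝ (EV m)) (1 / 2) ↔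
      ∀ a, ‖T a - a‖ ≤ 1 / 2 * ‖a‖ := by
    intro T
    rw [mem_closedBall_iff_norm, ContinuousLinearMap.opNorm_le_iff (by norm_num)]
    rfl
  have hd : Continuous fun T : EV m →L[ℝ] EV m => T.det := ContinuousLinearMap.continuous_det
  obtain ⟨A, hA⟩ := hc.exists_bound_of_continuousOn hd.continuousOn
  have hdi : ContinuousOn (fun T : EV m →L[ℝ] EV m => (T.det)⁻¹)
      (Metric.closedBall (ContinuousLinearMap.id ℝ (EV m)) (1 / 2)) :=
    hd.continuousOn.inv₀ fun T hT => det_ne ((hmem T).1 hT)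
  obtain ⟨A', hA'⟩ := hc.exists_bound_of_continuousOn hdi
  refine ⟨max 1 (max A A'), by positivity, fun T hT => ⟨?_, ?_⟩⟩
  · exact (hA T ((hmem T).2 hT)).trans ((le_max_left _ _).trans (le_max_right _ _))
  · rw [← abs_inv]
    exact (hA' T ((hmem T).2 hT)).trans ((le_max_right _ _).trans (le_max_right _ _))

theorem diffeo_near {n : ℕ} {F : EV (n + 1) → EV (n + 1)} (hF : ContDiff ℝ 2 F)
    (hn : ∀ y a, ‖fderiv ℝ F y a - a‖ ≤ 1 / 2 * ‖a‖) :
    ∃ Φ : EV (n + 1) → EV (n + 1), ContDiff ℝ 2 Φ ∧ (∀ x, F (Φ x) = x) ∧ ∀ y, Φ (F y) = y := by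
  have hd := hF.differentiable (by norm_num)
  have hap : ApproximatesLinearOn F
      ((ContinuousLinearEquiv.refl ℝ (EV (n + 1)) : EV (n + 1) ≃L[ℝ] EV (n + 1)) : EV (n + 1) →L[ℝ] EV (n + 1))
      Set.univ (1 / 2) := by
    rw [ApproximatesLinearOn.approximatesLinearOn_iff_lipschitzOnWith]
    refine Convex.lipschitzOnWith_of_nnnorm_hasFDerivWithin_le (𝕜 := ℝ)
      (f' := fun y => fderiv ℝ F y - ContinuousLinearMap.id ℝ _) (fun x _ => ?_) (fun x _ => ?_) convex_univ
    · exact ((hd x).hasFDerivAt.sub (hasFDerivAt_id x)).hasFDerivWithinAt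
    · have : ‖fderiv ℝ F x - ContinuousLinearMap.id ℝ _‖ ≤ 1 / 2 := by
        rw [ContinuousLinearMap.opNorm_le_iff (by norm_num)]
        exact hn x
      exact_mod_cast this
  have hN : Subsingleton (EV (n + 1)) ∨ (1 / 2 : NNReal) <
      ‖((ContinuousLinearEquiv.refl ℝ (EV (n + 1)) : EV (n + 1) ≃L[ℝ] EV (n + 1)).symm : EV (n + 1) →L[ℝ] EV (n + 1))‖₊⁻¹ := by
    right
    have : ((ContinuousLinearEquiv.refl ℝ (EV (n + 1)) : EV (n + 1) ≃L[ℝ] EV (n + 1)).symm : EV (n + 1) →L[ℝ] EV (n + 1))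
      = ContinuousLinearMap.id ℝ _ := rfl
    have h1 : ‖ContinuousLinearMap.id ℝ (EV (n + 1))‖₊ = 1 := by
      apply NNReal.eq
      simp
    rw [this, h1, inv_one]
    exact NNReal.half_lt_self one_ne_zero
  let e := hap.toHomeomorph F hN
  have he : (e : EV (n + 1) → EV (n + 1)) = F := rfl
  refine ⟨e.symm, ?_, fun x => e.apply_symm_apply x, fun y => e.symm_apply_apply y⟩
  refine e.contDiff_symm (f₀' := fun a => ContinuousLinearMap.toContinuousLinearEquivOfDetNeZero
    (fderiv ℝ F a) (det_ne (hn a))) (fun a => ?_) hF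
  exact (hd a).hasFDerivAt

/-- straightening diffeomorphism package -/
structure DF {n : ℕ} (γ : EV n → ℝ) (Ψ Φ : EV (n + 1) → EV (n + 1)) (B : ℝ) : Prop where
  c2 : ContDiff ℝ 2 Ψ
  c2' : ContDiff ℝ 2 Φ
  rinv : ∀ x, Ψ (Φ x) = x
  linv : ∀ y, Φ (Ψ y) = y
  near : ∀ y a, ‖fderiv ℝ Ψ y a - a‖ ≤ 1 / 2 * ‖a‖
  B0 : 0 ≤ B
  hess : ∀ y, hn Ψ y ≤ B
  mem : ∀ y, Ψ y ∈ halfSpace γ ↔ 0 < y (Fin.last n)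
  bdry : ∀ y, Ψ (snocE y 0) = snocE y (γ y)
  nor : ∀ y, fderiv ℝ Ψ (snocE y 0) (eN n) = Nvec γ y

theorem GH.exists_DF {n : ℕ} {γ : EV n → ℝ} {K : ℝ} (h : GH γ K) : ∃ Ψ Φ B, DF γ Ψ Φ B := by
  have hK1 : 0 < K + 1 := by have := h.K0; linarith
  set κ := 1 / (8 * (K + 1)) with hκd
  have hκ : 0 < κ := by positivity
  have hκK : κ * K ≤ 1 / 8 := by
    rw [hκd, div_mul_eq_mul_div, div_le_div_iff₀ (by positivity) (by norm_num)]
    nlinarith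
  have hc2 := h.Psi_c2 κ
  have hnear := h.Psi_near hκ hκK
  obtain ⟨Φ, hΦ, hr, hl⟩ := diffeo_near hc2 hnear
  have hB0 : 0 ≤ κ⁻¹ + 3 * K + κ * K := by have := h.K0; positivity
  refine ⟨Psi γ κ, Φ, κ⁻¹ + 3 * K + κ * K, hc2, hΦ, hr, hl, hnear, hB0, fun y => ?_, fun y => ?_,
    fun y => ?_, fun y => ?_⟩
  · have hlip : LipschitzWith ⟨κ⁻¹ + 3 * K + κ * K, hB0⟩ (fderiv ℝ (Psi γ κ)) := by
      refine LipschitzWith.of_dist_le_mul fun y z => ?_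
      rw [dist_eq_norm, dist_eq_norm]
      refine ContinuousLinearMap.opNorm_le_bound _ (mul_nonneg hB0 (norm_nonneg _)) fun a => ?_
      exact h.Psi_lip hκ y z a
    have := norm_fderiv_le_of_lipschitz ℝ hlip (x₀ := y)
    unfold hn nrm
    exact this
  · have e : Psi γ κ y = snocE (firstCoords y - (κ * Real.sin (κ⁻¹ * y (Fin.last n))) • GG γ (firstCoords y))
      (y (Fin.last n) + γ (firstCoords y)) := by
      ext i
      refine Fin.lastCases ?_ (fun j => ?_) i
      · simp [Psi]
      · simp [Psi, sub_eq_add_neg]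
    rw [e]
    show γ (firstCoords (snocE _ _)) < (snocE _ _) (Fin.last n) ↔ _
    rw [firstCoords_snocE, snocE_last]
    have h1 := h.lip (firstCoords y - (κ * Real.sin (κ⁻¹ * y (Fin.last n))) • GG γ (firstCoords y)) (firstCoords y)
    rw [sub_sub_cancel_left, norm_neg, norm_smul, Real.norm_eq_abs] at h1
    have h2 := sin_scaled hκ (y (Fin.last n)) 0
    rw [mul_zero, Real.sin_zero, mul_zero, sub_zero, sub_zero] at h2
    have h3 := h.GG_norm (firstCoords y)
    have h4 := mul_le_mul h2 h3 (norm_nonneg _) (abs_nonneg _)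
    have h5 := abs_le.1 (h1.trans (mul_le_mul_of_nonneg_left h4 (by norm_num : (0:ℝ) ≤ 1 / 8)))
    constructor
    · intro h6
      by_contra h7
      rw [abs_of_nonpos (not_lt.1 h7)] at h5
      linarith [h5.1, h5.2]
    · intro h6
      rw [abs_of_pos h6] at h5
      linarith [h5.1, h5.2]
  · ext i
    refine Fin.lastCases ?_ (fun j => ?_) i
    · simp [Psi]
    · simp [Psi]
  · rw [h.Psi_fd hκ.ne']
    ext i
    refine Fin.lastCases ?_ (fun j => ?_) i
    · simp [Nvec]
    · simp [Nvec, GG, grL_apply]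

section
variable {n : ℕ} {γ : EV n → ℝ} {Ψ Φ : EV (n + 1) → EV (n + 1)} {B : ℝ}

theorem DF.fd_comp (h : DF γ Ψ Φ B) {f : EV (n + 1) → ℝ} (hf : ContDiff ℝ 2 f) (y a : EV (n + 1)) :
    fderiv ℝ (fun z => f (Ψ z)) y a = fderiv ℝ f (Ψ y) (fderiv ℝ Ψ y a) := by
  have h1 := (hf.differentiable (by norm_num) (Ψ y)).hasFDerivAt.comp y
    (h.c2.differentiable (by norm_num) y).hasFDerivAt
  have h2 : HasFDerivAt (fun z => f (Ψ z)) _ y := h1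
  rw [h2.fderiv]; rfl

theorem fderiv_apply_const {m k : ℕ} {F : Type*} [NormedAddCommGroup F] [NormedSpace ℝ F]
    {c : EV m → EV k →L[ℝ] F} (hc : Differentiable ℝ c) (y : EV m) (a : EV m) (b : EV k) :
    fderiv ℝ (fun z => c z b) y a = fderiv ℝ c y a b := by
  have h1 := (hc y).hasFDerivAt.clm_apply (hasFDerivAt_const b y)
  rw [h1.fderiv]
  simp

theorem DF.hess_comp (h : DF γ Ψ Φ B) {f : EV (n + 1) → ℝ} (hf : ContDiff ℝ 2 f) (y a b : EV (n + 1)) :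
    fderiv ℝ (fderiv ℝ (fun z => f (Ψ z))) y a b =
      fderiv ℝ (fderiv ℝ f) (Ψ y) (fderiv ℝ Ψ y a) (fderiv ℝ Ψ y b) +
      fderiv ℝ f (Ψ y) (fderiv ℝ (fderiv ℝ Ψ) y a b) := by
  have hc : ContDiff ℝ 2 (fun z => f (Ψ z)) := hf.comp h.c2
  have hc1 : ContDiff ℝ 1 (fderiv ℝ (fun z => f (Ψ z))) := hc.fderiv_right (by norm_num)
  rw [← fderiv_apply_const (hc1.differentiable (by norm_num))]
  have e : (fun z => fderiv ℝ (fun z => f (Ψ z)) z b) = fun z => fderiv ℝ f (Ψ z) (fderiv ℝ Ψ z b) := by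
    funext z; exact h.fd_comp hf z b
  rw [e]
  have hf1 : ContDiff ℝ 1 (fderiv ℝ f) := hf.fderiv_right (by norm_num)
  have hΨ1 : ContDiff ℝ 1 (fderiv ℝ Ψ) := h.c2.fderiv_right (by norm_num)
  have h1 : HasFDerivAt (fun z => fderiv ℝ f (Ψ z)) ((fderiv ℝ (fderiv ℝ f) (Ψ y)).comp (fderiv ℝ Ψ y)) y :=
    (hf1.differentiable (by norm_num) (Ψ y)).hasFDerivAt.comp y
    (h.c2.differentiable (by norm_num) y).hasFDerivAt
  have h2 : HasFDerivAt (fun z => fderiv ℝ Ψ z b) ((fderiv ℝ (fderiv ℝ Ψ) y).flip b) y := by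
    have h3 := (hΨ1.differentiable (by norm_num) y).hasFDerivAt.clm_apply (hasFDerivAt_const b y)
    rw [ContinuousLinearMap.comp_zero, zero_add] at h3
    exact h3
  rw [(h1.clm_apply h2).fderiv]
  simp [add_comm]

theorem DF.up (h : DF γ Ψ Φ B) (y a : EV (n + 1)) : ‖fderiv ℝ Ψ y a‖ ≤ 3 / 2 * ‖a‖ := by
  have := h.near y a
  have h2 := norm_sub_norm_le (fderiv ℝ Ψ y a) a
  linarith

theorem DF.low (h : DF γ Ψ Φ B) (y a : EV (n + 1)) : ‖a‖ ≤ 2 * ‖fderiv ℝ Ψ y a‖ := by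
  have := h.near y a
  have h2 := norm_sub_norm_le a (fderiv ℝ Ψ y a)
  rw [norm_sub_rev] at h2
  linarith

theorem DF.surj (h : DF γ Ψ Φ B) (y b : EV (n + 1)) : ∃ a, fderiv ℝ Ψ y a = b ∧ ‖a‖ ≤ 2 * ‖b‖ := by
  set e := ContinuousLinearMap.toContinuousLinearEquivOfDetNeZero
    (fderiv ℝ Ψ y) (det_ne (h.near y))
  have : fderiv ℝ Ψ y (e.symm b) = b := e.apply_symm_apply b
  refine ⟨e.symm b, this, ?_⟩
  have h1 := h.low y (e.symm b)
  rwa [this] at h1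

theorem hn_le_of {m : ℕ} {u : EV m → ℝ} {x : EV m} {C : ℝ} (hC : 0 ≤ C)
    (h : ∀ a b, ‖fderiv ℝ (fderiv ℝ u) x a b‖ ≤ C * ‖a‖ * ‖b‖) : hn u x ≤ C := by
  unfold hn nrm
  exact ContinuousLinearMap.opNorm_le_bound₂ _ hC h

theorem hn_bil {m : ℕ} {F : Type*} [NormedAddCommGroup F] [NormedSpace ℝ F] (u : EV m → F) (x a b : EV m) :
    ‖fderiv ℝ (fderiv ℝ u) x a b‖ ≤ hn u x * ‖a‖ * ‖b‖ := by
  unfold hn nrm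
  exact (fderiv ℝ (fderiv ℝ u) x).le_opNorm₂ a b

theorem hnn {m : ℕ} {F : Type*} [NormedAddCommGroup F] [NormedSpace ℝ F] (u : EV m → F) (x : EV m) : 0 ≤ hn u x := by
  unfold hn
  apply nrm_nonneg

theorem DF.j2_comp_le (h : DF γ Ψ Φ B) {f : EV (n + 1) → ℝ} (hf : ContDiff ℝ 2 f) (y : EV (n + 1)) :
    j2 (fun z => f (Ψ z)) y ≤ (9 + 8 * B) * j2 f (Ψ y) := by
  have hB := h.B0
  have hnf := hnn f (Ψ y)
  have h1 : ‖fderiv ℝ (fun z => f (Ψ z)) y‖ ≤ 3 / 2 * ‖fderiv ℝ f (Ψ y)‖ := by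
    refine ContinuousLinearMap.opNorm_le_bound _ (by positivity) fun a => ?_
    rw [h.fd_comp hf]
    refine ((fderiv ℝ f (Ψ y)).le_opNorm _).trans ?_
    have := mul_le_mul_of_nonneg_left (h.up y a) (norm_nonneg (fderiv ℝ f (Ψ y)))
    linarith
  have h2 : hn (fun z => f (Ψ z)) y ≤ 9 / 4 * hn f (Ψ y) + B * ‖fderiv ℝ f (Ψ y)‖ := by
    refine hn_le_of (by positivity) fun a b => ?_
    rw [h.hess_comp hf]
    refine (norm_add_le _ _).trans ?_
    have t1 : ‖fderiv ℝ (fderiv ℝ f) (Ψ y) (fderiv ℝ Ψ y a) (fderiv ℝ Ψ y b)‖ ≤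
        hn f (Ψ y) * (3 / 2 * ‖a‖) * (3 / 2 * ‖b‖) := by
      refine (hn_bil f _ _ _).trans ?_
      have := h.up y a
      have := h.up y b
      gcongr
    have t2 : ‖fderiv ℝ f (Ψ y) (fderiv ℝ (fderiv ℝ Ψ) y a b)‖ ≤ ‖fderiv ℝ f (Ψ y)‖ * (B * ‖a‖ * ‖b‖) := by
      refine ((fderiv ℝ f (Ψ y)).le_opNorm _).trans ?_
      refine mul_le_mul_of_nonneg_left ?_ (norm_nonneg _)
      refine (hn_bil Ψ y a b).trans ?_
      have := h.hess y
      gcongr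
    linarith
  have h3 := abs_nonneg (f (Ψ y))
  have h4 := norm_nonneg (fderiv ℝ f (Ψ y))
  unfold j2
  nlinarith [mul_nonneg hB h3, mul_nonneg hB h4, mul_nonneg hB hnf]

theorem DF.j2_le_comp (h : DF γ Ψ Φ B) {f : EV (n + 1) → ℝ} (hf : ContDiff ℝ 2 f) (y : EV (n + 1)) :
    j2 f (Ψ y) ≤ (9 + 8 * B) * j2 (fun z => f (Ψ z)) y := by
  have hB := h.B0
  set g := fun z => f (Ψ z) with hg
  have hnf := hnn g y
  have h1 : ‖fderiv ℝ f (Ψ y)‖ ≤ 2 * ‖fderiv ℝ g y‖ := by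
    refine ContinuousLinearMap.opNorm_le_bound _ (by positivity) fun b => ?_
    obtain ⟨a, rfl, ha⟩ := h.surj y b
    rw [← h.fd_comp hf]
    refine ((fderiv ℝ g y).le_opNorm _).trans ?_
    have := mul_le_mul_of_nonneg_left ha (norm_nonneg (fderiv ℝ g y))
    linarith
  have h2 : hn f (Ψ y) ≤ 4 * hn g y + 8 * B * ‖fderiv ℝ g y‖ := by
    refine hn_le_of (by positivity) fun b b' => ?_
    obtain ⟨a, hae, ha⟩ := h.surj y b
    obtain ⟨a', hae', ha'⟩ := h.surj y b'
    have e := h.hess_comp hf y a a'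
    rw [hae, hae'] at e
    have e2 : fderiv ℝ (fderiv ℝ f) (Ψ y) b b' = fderiv ℝ (fderiv ℝ g) y a a' -
      fderiv ℝ f (Ψ y) (fderiv ℝ (fderiv ℝ Ψ) y a a') := by rw [hg, e]; ring
    rw [e2]
    refine (norm_sub_le _ _).trans ?_
    have t1 : ‖fderiv ℝ (fderiv ℝ g) y a a'‖ ≤ hn g y * (2 * ‖b‖) * (2 * ‖b'‖) := by
      refine (hn_bil g _ _ _).trans ?_
      gcongr
    have t2 : ‖fderiv ℝ f (Ψ y) (fderiv ℝ (fderiv ℝ Ψ) y a a')‖ ≤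
        (2 * ‖fderiv ℝ g y‖) * (B * (2 * ‖b‖) * (2 * ‖b'‖)) := by
      refine ((fderiv ℝ f (Ψ y)).le_opNorm _).trans ?_
      refine mul_le_mul h1 ?_ (norm_nonneg _) (by positivity)
      refine (hn_bil Ψ y a a').trans ?_
      have := h.hess y
      gcongr
    linarith
  have e0 : f (Ψ y) = g y := rfl
  have h3 := abs_nonneg (g y)
  have h4 := norm_nonneg (fderiv ℝ g y)
  unfold j2
  rw [e0]
  nlinarith [mul_nonneg hB h3, mul_nonneg hB h4, mul_nonneg hB hnf]

theorem DF.image_half (h : DF γ Ψ Φ B) : Ψ '' halfSpace (fun _ => 0) = halfSpace γ := by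
  ext x
  constructor
  · rintro ⟨y, hy, rfl⟩
    exact (h.mem y).2 hy
  · intro hx
    refine ⟨Φ x, ?_, h.rinv x⟩
    have := (h.mem (Φ x)).1 (by rwa [h.rinv])
    exact this

theorem DF.image_univ (h : DF γ Ψ Φ B) : Ψ '' Set.univ = Set.univ := by
  ext x
  simp only [Set.image_univ, Set.mem_range, Set.mem_univ, iff_true]
  exact ⟨Φ x, h.rinv x⟩

theorem DF.lint (h : DF γ Ψ Φ B) : ∃ A : ℝ≥0∞, A ≠ ⊤ ∧ ∀ s : Set (EV (n + 1)), MeasurableSet s →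
    ∀ g : EV (n + 1) → ℝ≥0∞, ∫⁻ x in Ψ '' s, g x ≤ A * ∫⁻ y in s, g (Ψ y) ∧
      ∫⁻ y in s, g (Ψ y) ≤ A * ∫⁻ x in Ψ '' s, g x := by
  obtain ⟨A, hA, hb⟩ := det_bound (n + 1)
  refine ⟨ENNReal.ofReal A, ENNReal.ofReal_ne_top, fun s hs g => ?_⟩
  have hinj : Function.Injective Ψ := fun x y hxy => by rw [← h.linv x, hxy, h.linv]
  have e := lintegral_image_eq_lintegral_abs_det_fderiv_mul volume hs
    (fun x _ => (h.c2.differentiable (by norm_num) x).hasFDerivAt.hasFDerivWithinAt) hinj.injOn g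
  rw [e, ← lintegral_const_mul' _ _ ENNReal.ofReal_ne_top, ← lintegral_const_mul' _ _ ENNReal.ofReal_ne_top]
  constructor
  · refine lintegral_mono fun y => mul_le_mul' ?_ le_rfl
    exact ENNReal.ofReal_le_ofReal (hb _ (h.near y)).1
  · refine lintegral_mono fun y => ?_
    rw [← mul_assoc, ← ENNReal.ofReal_mul hA.le]
    have h1 := (hb _ (h.near y)).2
    have h2 : 0 < |(fderiv ℝ Ψ y).det| := abs_pos.2 (det_ne (h.near y))
    have h3 : 1 ≤ A * |(fderiv ℝ Ψ y).det| := by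
      rw [inv_le_iff_one_le_mul₀ h2] at h1
      linarith
    calc g (Ψ y) = ENNReal.ofReal 1 * g (Ψ y) := by simp
      _ ≤ _ := mul_le_mul' (ENNReal.ofReal_le_ofReal h3) le_rfl

theorem DF.cmp (h : DF γ Ψ Φ B) {p : ℝ≥0∞} (hp1 : 1 ≤ p) (hp : p ≠ ⊤) : ∃ C : ℝ≥0∞, C ≠ ⊤ ∧
    ∀ s : Set (EV (n + 1)), MeasurableSet s → ∀ f : EV (n + 1) → ℝ, ContDiff ℝ 2 f →
      eLpNorm (j2 f) p (volume.restrict (Ψ '' s)) ≤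
        C * eLpNorm (j2 fun z => f (Ψ z)) p (volume.restrict s) ∧
      eLpNorm (j2 fun z => f (Ψ z)) p (volume.restrict s) ≤
        C * eLpNorm (j2 f) p (volume.restrict (Ψ '' s)) := by
  obtain ⟨A, hA, hb⟩ := h.lint
  have hA' : A ^ (1 / p.toReal) ≠ ⊤ := ENNReal.rpow_ne_top_of_nonneg (by positivity) hA
  have hB := h.B0
  refine ⟨A ^ (1 / p.toReal) * ENNReal.ofReal (9 + 8 * B), ENNReal.mul_ne_top hA' ENNReal.ofReal_ne_top,
    fun s hs f hf => ⟨?_, ?_⟩⟩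
  · have h1 := eLpNorm_le_of_lint (f := j2 f) (g := fun y => j2 f (Ψ y)) hp1 hp
      (hb s hs fun x => ‖j2 f x‖ₑ ^ p.toReal).1
    refine h1.trans ?_
    rw [mul_assoc]
    refine mul_le_mul' le_rfl ?_
    refine eLpNorm_le_mul_eLpNorm_of_ae_le_mul (Eventually.of_forall fun y => ?_) p
    rw [Real.norm_of_nonneg (j2_nonneg _ _), Real.norm_of_nonneg (j2_nonneg _ _)]
    exact h.j2_le_comp hf y
  · have h1 := eLpNorm_le_of_lint (f := fun y => j2 f (Ψ y)) (g := j2 f) hp1 hp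
      (hb s hs fun x => ‖j2 f x‖ₑ ^ p.toReal).2
    rw [mul_comm (A ^ _), mul_assoc]
    refine le_trans ?_ (mul_le_mul' le_rfl h1)
    refine eLpNorm_le_mul_eLpNorm_of_ae_le_mul (Eventually.of_forall fun y => ?_) p
    rw [Real.norm_of_nonneg (j2_nonneg _ _), Real.norm_of_nonneg (j2_nonneg _ _)]
    exact h.j2_comp_le hf y
end

/-- reflection in the last coordinate -/
def RR (n : ℕ) : EV (n + 1) ≃ₗᵢ[ℝ] EV (n + 1) where
  toLinearEquiv := LinearEquiv.ofInvolutive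
    { toFun := fun y => y - (2 * y (Fin.last n)) • eN n
      map_add' := fun x y => by
        ext i; refine Fin.lastCases ?_ (fun j => ?_) i <;> simp; ring
      map_smul' := fun c x => by
        ext i; refine Fin.lastCases ?_ (fun j => ?_) i <;> simp; ring }
    (fun y => by ext i; refine Fin.lastCases ?_ (fun j => ?_) i <;> simp; ring)
  norm_map' := fun y => by
    have h1 := norm_sq_split y
    have h2 := norm_sq_split (y - (2 * y (Fin.last n)) • eN n)
    have e1 : firstCoords (y - (2 * y (Fin.last n)) • eN n) = firstCoords y := by
      ext j; simp
    have e2 : (y - (2 * y (Fin.last n)) • eN n) (Fin.last n) = - y (Fin.last n) := by simp; ring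
    rw [e1, e2, neg_sq, ← h1] at h2
    have h3 := (sq_eq_sq₀ (norm_nonneg _) (norm_nonneg _)).1 h2
    exact h3

theorem RR_apply {n : ℕ} (y : EV (n + 1)) : RR n y = y - (2 * y (Fin.last n)) • eN n := rfl

@[simp] theorem RR_last {n : ℕ} (y : EV (n + 1)) : RR n y (Fin.last n) = - y (Fin.last n) := by
  rw [RR_apply]; simp; ring

@[simp] theorem RR_castSucc {n : ℕ} (y : EV (n + 1)) (j : Fin n) : RR n y j.castSucc = y j.castSucc := by
  rw [RR_apply]; simp

@[simp] theorem RR_RR {n : ℕ} (y : EV (n + 1)) : RR n (RR n y) = y := by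
  ext i; refine Fin.lastCases ?_ (fun j => ?_) i <;> simp

@[simp] theorem RR_zero {n : ℕ} (y : EV n) : RR n (snocE y 0) = snocE y 0 := by
  ext i; refine Fin.lastCases ?_ (fun j => ?_) i <;> simp

theorem RR_eN {n : ℕ} : RR n (eN n) = - eN n := by
  ext i; refine Fin.lastCases ?_ (fun j => ?_) i <;> simp

theorem RR_mp (n : ℕ) : MeasurePreserving (RR n) := (RR n).measurePreserving

theorem RR_int {n : ℕ} (g : EV (n + 1) → ℝ) : ∫ x, g (RR n x) = ∫ x, g x :=
  (RR_mp n).integral_comp (RR n).toHomeomorph.measurableEmbedding g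

/-- sign of a direction under reflection -/
def sg {n : ℕ} (i : Fin (n + 1)) : ℝ := if i = Fin.last n then -1 else 1

theorem RR_single {n : ℕ} (i : Fin (n + 1)) :
    RR n (EuclideanSpace.single i 1) = sg i • EuclideanSpace.single i 1 := by
  refine Fin.lastCases ?_ (fun j => ?_) i
  · have := RR_eN (n := n)
    unfold eN at this
    rw [this]; simp [sg]
  · rw [RR_apply]
    have : (EuclideanSpace.single j.castSucc (1 : ℝ) : EV (n + 1)) (Fin.last n) = 0 := by
      simp [Fin.castSucc_ne_last, (Fin.castSucc_ne_last j).symm]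
    rw [this]; simp [sg, Fin.castSucc_ne_last]

theorem partialD_RR {n : ℕ} {φ : EV (n + 1) → ℝ} (hφ : Differentiable ℝ φ) (i : Fin (n + 1)) (x : EV (n + 1)) :
    partialD i (fun z => φ (RR n z)) x = sg i * partialD i φ (RR n x) := by
  unfold partialD
  have h1 : HasFDerivAt (fun z => φ (RR n z)) _ x := (hφ (RR n x)).hasFDerivAt.comp x
    (RR n).toContinuousLinearEquiv.hasFDerivAt
  rw [h1.fderiv]
  show fderiv ℝ φ (RR n x) (RR n (EuclideanSpace.single i 1)) = _
  rw [RR_single, map_smul, smul_eq_mul]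

/-- sign of a multi-index under reflection -/
def sgl {n : ℕ} (l : List (Fin (n + 1))) : ℝ := (l.map sg).prod

@[simp] theorem sgl_nil {n : ℕ} : sgl ([] : List (Fin (n + 1))) = 1 := rfl
theorem sgl_cons {n : ℕ} (i : Fin (n + 1)) (l : List (Fin (n + 1))) : sgl (i :: l) = sg i * sgl l := by
  simp [sgl]

/-- reflected extension -/
def Wx {n : ℕ} (s : ℝ) (F : EV (n + 1) → ℝ) (x : EV (n + 1)) : ℝ :=
  (halfSpace fun _ => 0).indicator F x + s * (halfSpace fun _ => 0).indicator F (RR n x)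

abbrev H0s (n : ℕ) : Set (EV (n + 1)) := halfSpace fun _ => 0

theorem H0_open (n : ℕ) : IsOpen (H0s n) := halfSpace_open continuous_const

theorem Wx_on {n : ℕ} (s : ℝ) (F : EV (n + 1) → ℝ) {x : EV (n + 1)} (hx : x ∈ H0s n) : Wx s F x = F x := by
  unfold Wx
  rw [Set.indicator_of_mem hx, Set.indicator_of_notMem, mul_zero, add_zero]
  intro h
  have h1 : (0 : ℝ) < RR n x (Fin.last n) := h
  have h2 : (0 : ℝ) < x (Fin.last n) := hx
  rw [RR_last] at h1
  linarith

theorem Wx_even {n : ℕ} (F : EV (n + 1) → ℝ) (x : EV (n + 1)) : Wx 1 F (RR n x) = Wx 1 F x := by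
  unfold Wx
  rw [RR_RR]; ring

theorem Wx_memLp {n : ℕ} (s : ℝ) {F : EV (n + 1) → ℝ} {p : ℝ≥0∞}
    (hF : MemLp F p (volume.restrict (H0s n))) : MemLp (Wx s F) p volume := by
  have h1 := (memLp_indicator_iff_restrict (H0_open n).measurableSet).2 hF
  exact h1.add ((h1.comp_measurePreserving (RR_mp n)).const_mul s)

theorem Wx_int {n : ℕ} (s : ℝ) {F : EV (n + 1) → ℝ} {p : ℝ≥0∞} (hp1 : 1 ≤ p)
    (hF : MemLp F p (volume.restrict (H0s n))) {g : EV (n + 1) → ℝ} (hg : Continuous g)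
    (hs : HasCompactSupport g) :
    ∫ x, Wx s F x * g x = ∫ x in H0s n, F x * (g x + s * g (RR n x)) := by
  have h1 := (memLp_indicator_iff_restrict (H0_open n).measurableSet).2 hF
  have hg2 : Continuous fun x => g (RR n x) := hg.comp (RR n).continuous
  have hs2 : HasCompactSupport fun x => g (RR n x) := hs.comp_homeomorph (RR n).toHomeomorph
  have i1 : Integrable (fun x => (H0s n).indicator F x * g x) volume := by
    have := int_mul_test hp1 (μ := volume) h1 hg hs
    exact this
  have i3 : Integrable (fun x => (H0s n).indicator F x * g (RR n x)) volume := by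
    have := int_mul_test hp1 (μ := volume) h1 hg2 hs2
    exact this
  have i2 : Integrable (fun x => s * ((H0s n).indicator F (RR n x) * g x)) volume := by
    refine Integrable.const_mul ?_ s
    have := (RR_mp n).integrable_comp_of_integrable i3
    refine this.congr (Eventually.of_forall fun x => ?_)
    simp [Function.comp]
  have e1 : ∫ x, Wx s F x * g x = (∫ x, (H0s n).indicator F x * g x) +
      ∫ x, s * ((H0s n).indicator F (RR n x) * g x) := by
    rw [← integral_add i1 i2]
    refine integral_congr_ae (Eventually.of_forall fun x => ?_)
    show Wx s F x * g x = _
    unfold Wx; ring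
  have e2 : ∫ x, (H0s n).indicator F (RR n x) * g x = ∫ x, (H0s n).indicator F x * g (RR n x) := by
    rw [← RR_int fun x => (H0s n).indicator F x * g (RR n x)]
    simp
  rw [e1, integral_const_mul, e2, ← integral_const_mul, ← integral_add i1 (i3.const_mul s),
    ← integral_indicator (H0_open n).measurableSet]
  refine integral_congr_ae (Eventually.of_forall fun x => ?_)
  show _ = (H0s n).indicator (fun x => F x * (g x + s * g (RR n x))) x
  by_cases hx : x ∈ H0s n
  · simp only [Set.indicator_of_mem hx]; ring
  · simp only [Set.indicator_of_notMem hx]; ring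

theorem pd_c1' {m : ℕ} {u : EV m → ℝ} (hu : ContDiff ℝ 2 u) (l : List (Fin m)) (hl : l.length < 2) :
    ContDiff ℝ 1 (partialDList l u) := by
  match l, hl with
  | [], _ => exact hu.of_le (by norm_num)
  | [j], _ => exact pd_c1 hu j

theorem sg_last {n : ℕ} : sg (Fin.last n) = -1 := by simp [sg]

theorem inner_N0 {n : ℕ} (y : EV n) (i : Fin (n + 1)) :
    inner ℝ (Nvec (fun _ : EV n => (0 : ℝ)) y) (EuclideanSpace.single i (1 : ℝ)) =
      if i = Fin.last n then 1 else 0 := by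
  rw [inner_Nvec, fderiv_fun_const]
  simp [Pi.single_apply, eq_comm]

theorem bd_zero {n : ℕ} {f : ℕ → EV (n + 1) → ℝ}
    (hb : ∀ φ : EV (n + 1) → ℝ, ContDiff ℝ (⊤ : ℕ∞) φ → HasCompactSupport φ →
      Tendsto (fun k => ∫ y : EV n, partialD (Fin.last n) (f k) (snocE y 0) * φ (snocE y 0)) atTop (𝓝 0))
    (l : List (Fin (n + 1))) (hl : l.length < 2) (i : Fin (n + 1)) {φ : EV (n + 1) → ℝ}
    (hφ : ContDiff ℝ (⊤ : ℕ∞) φ) (hs : HasCompactSupport φ) :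
    Tendsto (fun k => ∫ y : EV n, inner ℝ (Nvec (fun _ : EV n => (0 : ℝ)) y) (EuclideanSpace.single i (1 : ℝ)) *
      (partialDList l (f k) (snocE y 0) * (φ (snocE y 0) + sgl (i :: l) * φ (RR n (snocE y 0)))))
      atTop (𝓝 0) := by
  by_cases hi : i = Fin.last n
  · subst hi
    match l, hl with
    | [], _ => 
      simp [inner_N0, sgl_cons, sg_last]
    | [j], _ =>
      by_cases hj : j = Fin.last n
      · subst hj
        have h1 := (hb φ hφ hs).const_mul 2
        rw [mul_zero] at h1
        refine h1.congr fun k => ?_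
        rw [← integral_const_mul]
        refine integral_congr_ae (Eventually.of_forall fun y => ?_)
        simp only [inner_N0, sgl_cons, sg_last, RR_zero, sgl_nil, pd_one, if_true]
        ring
      · have : sg j = 1 := by simp [sg, hj]
        simp [inner_N0, sgl_cons, sg_last, this]
  · simp [inner_N0, hi]

theorem refl_weak {n : ℕ} {p : ℝ≥0∞} (hp1 : 1 ≤ p) {f : ℕ → EV (n + 1) → ℝ}
    {F : List (Fin (n + 1)) → EV (n + 1) → ℝ} (hf : ∀ k, ContDiff ℝ 2 (f k))
    (hfm : ∀ k, ∀ l ∈ L2 (n + 1), MemLp (partialDList l (f k)) p (volume.restrict (H0s n)))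
    (hF : ∀ l ∈ L2 (n + 1), MemLp (F l) p (volume.restrict (H0s n)))
    (hc : ∀ l ∈ L2 (n + 1), Tendsto (fun k => eLpNorm (partialDList l (f k) - F l) p
      (volume.restrict (H0s n))) atTop (𝓝 0))
    (hb : ∀ φ : EV (n + 1) → ℝ, ContDiff ℝ (⊤ : ℕ∞) φ → HasCompactSupport φ →
      Tendsto (fun k => ∫ y : EV n, partialD (Fin.last n) (f k) (snocE y 0) * φ (snocE y 0)) atTop (𝓝 0))
    (l : List (Fin (n + 1))) (hl : l.length < 2) (i : Fin (n + 1)) :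
    WeakDerivOn Set.univ i (Wx (sgl l) (F l)) (Wx (sgl (i :: l)) (F (i :: l))) := by
  intro φ hφ hs _
  have hl1 : l ∈ L2 (n + 1) := mem_L2.2 (by omega)
  have hl2 : i :: l ∈ L2 (n + 1) := mem_L2.2 (by simp; omega)
  rw [Measure.restrict_univ, Wx_int _ hp1 (hF l hl1) (pd_test_cont hφ i) (pd_test_cs hs i),
    Wx_int _ hp1 (hF _ hl2) hφ.continuous hs]
  set ψ : EV (n + 1) → ℝ := fun x => φ x + sgl (i :: l) * φ (RR n x) with hψ
  have hR : ContDiff ℝ (⊤ : ℕ∞) fun x => φ (RR n x) := hφ.comp (RR n).toContinuousLinearEquiv.contDiff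
  have hRs : HasCompactSupport fun x => φ (RR n x) := hs.comp_homeomorph (RR n).toHomeomorph
  have hψc : ContDiff ℝ (⊤ : ℕ∞) ψ := hφ.add (contDiff_const.mul hR)
  have hψs : HasCompactSupport ψ := hs.add (hRs.mul_left (f := fun _ => sgl (i :: l)))
  have hsg : sg i * sg i = 1 := by unfold sg; split_ifs <;> norm_num
  have e1 : ∀ x, partialD i φ x + sgl l * partialD i φ (RR n x) = partialD i ψ x := by
    intro x
    have hd1 : DifferentiableAt ℝ φ x := (hφ.differentiable (by simp)) x
    have hd2 : DifferentiableAt ℝ (fun x => φ (RR n x)) x := (hR.differentiable (by simp)) x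
    have h1 := (hd1.hasFDerivAt.add (hd2.hasFDerivAt.const_mul (sgl (i :: l)))).fderiv
    have h2 : partialD i ψ x = partialD i φ x + sgl (i :: l) * partialD i (fun x => φ (RR n x)) x := by
      have h3 : fderiv ℝ ψ x = _ := h1
      unfold partialD
      rw [h3]
      rfl
    rw [h2, partialD_RR (hφ.differentiable (by simp)), sgl_cons]
    linear_combination -(sgl l * partialD i φ (RR n x)) * hsg
  simp only [e1]
  have hγ : ContDiff ℝ 1 (fun _ : EV n => (0 : ℝ)) := contDiff_const
  have hip : ∀ k, ∫ x in H0s n, partialDList l (f k) x * partialD i ψ x =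
      -(∫ x in H0s n, partialDList (i :: l) (f k) x * ψ x) -
      ∫ y : EV n, inner ℝ (Nvec (fun _ : EV n => (0 : ℝ)) y) (EuclideanSpace.single i (1 : ℝ)) *
      (partialDList l (f k) (snocE y 0) * (φ (snocE y 0) + sgl (i :: l) * φ (RR n (snocE y 0)))) := fun k =>
    int_parts hγ (pd_c1' (hf k) l hl) (hψc.of_le (by exact_mod_cast le_top)) hψs
      (EuclideanSpace.single i 1)
  have t1 := tendsto_int_test hp1 (pd_test_cont hψc i) (pd_test_cs hψs i) (fun k => hfm k l hl1)
    (hF l hl1) (hc l hl1)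
  have t2 := tendsto_int_test hp1 hψc.continuous hψs (fun k => hfm k _ hl2) (hF _ hl2) (hc _ hl2)
  have t3 := bd_zero hb l hl i hφ hs
  have t4 := t2.neg.sub t3
  rw [sub_zero] at t4
  exact tendsto_nhds_unique t1 (t4.congr fun k => (hip k).symm)

theorem bdry_tendsto {n : ℕ} {γ : EV n → ℝ} {K : ℝ} (hg : GH γ K) {p : ℝ≥0∞} (hp1 : 1 ≤ p)
    {D : List (Fin (n + 1)) → EV (n + 1) → ℝ} (hG : Green (halfSpace γ) D)
    (hD : ∀ l ∈ L2 (n + 1), MemLp (D l) p (volume.restrict (halfSpace γ)))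
    {U : ℕ → EV (n + 1) → ℝ} (hU : ∀ k, ContDiff ℝ 2 (U k))
    (hUm : ∀ k, ∀ l ∈ L2 (n + 1), MemLp (partialDList l (U k)) p (volume.restrict (halfSpace γ)))
    (hc : ∀ l ∈ L2 (n + 1), Tendsto (fun k => eLpNorm (partialDList l (U k) - D l) p
        (volume.restrict (halfSpace γ))) atTop (𝓝 0))
    {φ : EV (n + 1) → ℝ} (hφ : ContDiff ℝ (⊤ : ℕ∞) φ) (hs : HasCompactSupport φ) :
    Tendsto (fun k => ∫ y : EV n, fderiv ℝ (U k) (snocE y (γ y)) (Nvec γ y) * φ (snocE y 0))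
      atTop (𝓝 0) := by
  let b : ContDiffBump (0 : ℝ) := ⟨1, 2, by norm_num, by norm_num⟩
  set ψ : EV (n + 1) → ℝ := fun x => φ (snocL n (fcL n x, 0)) * b (lastL n x) with hψ
  have hψc : ContDiff ℝ (⊤ : ℕ∞) ψ := by
    refine ContDiff.mul ?_ ?_
    · exact hφ.comp ((snocL n).contDiff.comp ((fcL n).contDiff.prodMk contDiff_const))
    · exact b.contDiff.comp (lastL n).contDiff
  have hψs : HasCompactSupport ψ := by
    refine HasCompactSupport.intro (K := snocL n '' ((fcL n '' tsupport φ) ×ˢ tsupport b))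
      (((hs.isCompact.image (fcL n).continuous).prod b.hasCompactSupport.isCompact).image
        (snocL n).continuous) fun x hx => ?_
    by_contra hne
    have h1 := left_ne_zero_of_mul hne
    have h2 := right_ne_zero_of_mul hne
    refine hx ⟨(fcL n x, lastL n x), ⟨⟨_, subset_tsupport _ h1, ?_⟩, subset_tsupport _ h2⟩, ?_⟩
    · show firstCoords (snocE _ _) = _
      rw [firstCoords_snocE]
    · show snocE (firstCoords x) (x (Fin.last n)) = x
      exact snocE_firstCoords x
  have hv : ∀ y, ψ (snocE y (γ y)) = φ (snocE y 0) := by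
    intro y
    have e1 : fcL n (snocE y (γ y)) = y := firstCoords_snocE _ _
    have e2 : lastL n (snocE y (γ y)) = γ y := snocE_last _ _
    have e3 : b (γ y) = 1 := by
      refine b.one_of_mem_closedBall ?_
      rw [mem_closedBall_zero_iff, Real.norm_eq_abs]
      exact (hg.bd y).trans (by show (1 / 8 : ℝ) ≤ 1; norm_num)
    rw [hψ]
    simp only [e1, e2, e3, mul_one]
    rfl
  have hk : ∀ k, ∫ y : EV n, fderiv ℝ (U k) (snocE y (γ y)) (Nvec γ y) * φ (snocE y 0) =
      -(∑ i, ∫ x in halfSpace γ, partialDList [i, i] (U k) x * ψ x) -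
      ∑ i, ∫ x in halfSpace γ, partialDList [i] (U k) x * partialD i ψ x := by
    intro k
    have h := green_parts (hg.c3.of_le (by norm_num)) (hU k) (hψc.of_le (by exact_mod_cast le_top)) hψs
    simp only [hv] at h
    simp only [pd_one, pd_two]
    linarith
  simp only [hk]
  have t1 : Tendsto (fun k => ∑ i, ∫ x in halfSpace γ, partialDList [i, i] (U k) x * ψ x) atTop
      (𝓝 (∑ i, ∫ x in halfSpace γ, D [i, i] x * ψ x)) := by
    refine tendsto_finsetSum _ fun i _ => ?_
    have hl : [i, i] ∈ L2 (n + 1) := by simp [mem_L2]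
    exact tendsto_int_test hp1 hψc.continuous hψs (fun k => hUm k _ hl) (hD _ hl) (hc _ hl)
  have t2 : Tendsto (fun k => ∑ i, ∫ x in halfSpace γ, partialDList [i] (U k) x * partialD i ψ x) atTop
      (𝓝 (∑ i, ∫ x in halfSpace γ, D [i] x * partialD i ψ x)) := by
    refine tendsto_finsetSum _ fun i _ => ?_
    have hl : [i] ∈ L2 (n + 1) := by simp [mem_L2]
    exact tendsto_int_test hp1 (pd_test_cont hψc i) (pd_test_cs hψs i) (fun k => hUm k _ hl)
      (hD _ hl) (hc _ hl)
  have t3 := t1.neg.sub t2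
  rw [hG ψ hψc hψs, neg_neg, sub_self] at t3
  exact t3

/-- even mollifiers -/
theorem exists_even_moll (n : ℕ) {δ : ℝ} (hδ : 0 < δ) : ∃ ζ : EV (n + 1) → ℝ, Moll ζ δ ∧
    ∀ x, ζ (RR n x) = ζ x := by
  obtain ⟨ζ, hζ, -⟩ := exists_bump (n + 1) (0 : EV (n + 1)) hδ
  rw [norm_zero, zero_add] at hζ
  have hR : ContDiff ℝ (⊤ : ℕ∞) fun x => ζ (RR n x) :=
    hζ.cd.comp (RR n).toContinuousLinearEquiv.contDiff
  have hRs : HasCompactSupport fun x => ζ (RR n x) := hζ.cs.comp_homeomorph (RR n).toHomeomorph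
  have hi1 : Integrable ζ := hζ.cd.continuous.integrable_of_hasCompactSupport hζ.cs
  have hi2 : Integrable fun x => ζ (RR n x) := hR.continuous.integrable_of_hasCompactSupport hRs
  refine ⟨fun x => 1 / 2 * (ζ x + ζ (RR n x)), ⟨?_, ?_, ?_, ?_⟩, fun x => ?_⟩
  · exact contDiff_const.mul (hζ.cd.add hR)
  · intro x
    have := hζ.nn x
    have := hζ.nn (RR n x)
    positivity
  · rw [integral_const_mul, integral_add hi1 hi2, RR_int, hζ.int1]
    norm_num
  · intro x hx
    by_contra hlt
    have h1 : ζ x = 0 := by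
      by_contra h; exact hlt (hζ.supp x h)
    have h2 : ζ (RR n x) = 0 := by
      by_contra h
      have := hζ.supp _ h
      rw [(RR n).norm_map] at this
      exact hlt this
    exact hx (by rw [h1, h2]; ring)
  · show 1 / 2 * (ζ (RR n x) + ζ (RR n (RR n x))) = 1 / 2 * (ζ x + ζ (RR n x))
    rw [RR_RR]; ring

theorem mol_even {n : ℕ} {ζ g : EV (n + 1) → ℝ} (hζ : ∀ x, ζ (RR n x) = ζ x)
    (hg : ∀ x, g (RR n x) = g x) (x : EV (n + 1)) : mol ζ g (RR n x) = mol ζ g x := by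
  unfold mol
  rw [← RR_int]
  refine integral_congr_ae (Eventually.of_forall fun t => ?_)
  show ζ (RR n t) * g (RR n x - RR n t) = ζ t * g (x - t)
  rw [← map_sub, hζ, hg]

theorem mol_pd {m : ℕ} {p : ℝ≥0∞} (hp1 : 1 ≤ p) {W : List (Fin m) → EV m → ℝ}
    (hW : ∀ l ∈ L2 m, MemLp (W l) p volume)
    (hw : ∀ l : List (Fin m), l.length < 2 → ∀ i, WeakDerivOn Set.univ i (W l) (W (i :: l)))
    {ζ : EV m → ℝ} {δ : ℝ} (hζ : Moll ζ δ) :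
    ∀ l ∈ L2 m, partialDList l (mol ζ (W [])) = mol ζ (W l) := by
  have h1 : ∀ l : List (Fin m), l.length < 2 → ∀ i, partialD i (mol ζ (W l)) = mol ζ (W (i :: l)) := by
    intro l hl i
    funext x
    have hli := (hW l (mem_L2.2 hl.le)).locallyIntegrable hp1
    have := mol_weak MeasurableSet.univ (hw l hl i) hζ.cd hζ.cs (by rwa [Set.indicator_univ])
      (x := x) (Set.subset_univ _)
    rwa [Set.indicator_univ, Set.indicator_univ] at this
  refine L2_cases rfl (fun i => ?_) fun i j => ?_
  · rw [pd_one]; exact h1 [] (by simp) i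
  · rw [pd_two, h1 [] (by simp) j]; exact h1 [j] (by simp) i

theorem j2_congr {m : ℕ} {u v : EV m → ℝ} {x : EV m} (h : u =ᶠ[𝓝 x] v) : j2 u x = j2 v x := by
  have h1 : fderiv ℝ u =ᶠ[𝓝 x] fderiv ℝ v := h.fderiv
  unfold j2 hn
  rw [h.eq_of_nhds, h1.eq_of_nhds, h1.fderiv_eq]

theorem j2_const {m : ℕ} (a : ℝ) (x : EV m) : j2 (fun _ : EV m => a) x = |a| := by
  have h1 : fderiv ℝ (fun _ : EV m => a) = fun _ => 0 := by
    funext x; simp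
  have h2 : hn (fun _ : EV m => a) x ≤ 0 := by
    refine hn_le_of le_rfl fun c d => ?_
    rw [h1]; simp
  have h3 := hnn (fun _ : EV m => a) x
  unfold j2
  rw [h1, norm_zero]
  linarith

theorem j2_mul {m : ℕ} {f g : EV m → ℝ} (hf : ContDiff ℝ 2 f) (hg : ContDiff ℝ 2 g) (x : EV m) :
    j2 (fun z => f z * g z) x ≤ 2 * j2 f x * j2 g x := by
  have df := hf.differentiable (by norm_num)
  have dg := hg.differentiable (by norm_num)
  have df1 : Differentiable ℝ (fderiv ℝ f) := (hf.fderiv_right (m := 1) (by norm_num)).differentiable (by norm_num)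
  have dg1 : Differentiable ℝ (fderiv ℝ g) := (hg.fderiv_right (m := 1) (by norm_num)).differentiable (by norm_num)
  have hfg : ContDiff ℝ 2 (fun z => f z * g z) := hf.mul hg
  have dfg1 : Differentiable ℝ (fderiv ℝ (fun z => f z * g z)) :=
    (hfg.fderiv_right (m := 1) (by norm_num)).differentiable (by norm_num)
  have e1 : ∀ z b, fderiv ℝ (fun z => f z * g z) z b = f z * fderiv ℝ g z b + g z * fderiv ℝ f z b := by
    intro z b
    rw [((df z).hasFDerivAt.fun_mul (dg z).hasFDerivAt).fderiv]
    simp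
  have e2 : ∀ a b, fderiv ℝ (fderiv ℝ (fun z => f z * g z)) x a b =
      f x * fderiv ℝ (fderiv ℝ g) x a b + fderiv ℝ g x b * fderiv ℝ f x a +
      (g x * fderiv ℝ (fderiv ℝ f) x a b + fderiv ℝ f x b * fderiv ℝ g x a) := by
    intro a b
    rw [← fderiv_apply_const dfg1]
    simp_rw [e1]
    have ag : HasFDerivAt (fun z => fderiv ℝ g z b) (fderiv ℝ (fun z => fderiv ℝ g z b) x) x :=
      ((dg1 x).clm_apply (differentiableAt_const b)).hasFDerivAt
    have af : HasFDerivAt (fun z => fderiv ℝ f z b) (fderiv ℝ (fun z => fderiv ℝ f z b) x) x :=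
      ((df1 x).clm_apply (differentiableAt_const b)).hasFDerivAt
    rw [(((df x).hasFDerivAt.fun_mul ag).fun_add ((dg x).hasFDerivAt.fun_mul af)).fderiv]
    simp only [ContinuousLinearMap.add_apply, ContinuousLinearMap.smul_apply, smul_eq_mul,
      fderiv_apply_const dg1, fderiv_apply_const df1]
  have b0 : ∀ (c : EV m →L[ℝ] ℝ) a, |c a| ≤ ‖c‖ * ‖a‖ := fun c a => c.le_opNorm a
  have h1 : ‖fderiv ℝ (fun z => f z * g z) x‖ ≤ |f x| * ‖fderiv ℝ g x‖ + |g x| * ‖fderiv ℝ f x‖ := by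
    refine ContinuousLinearMap.opNorm_le_bound _ (by positivity) fun a => ?_
    rw [e1, Real.norm_eq_abs]
    refine (abs_add_le _ _).trans ?_
    rw [abs_mul, abs_mul]
    have i1 := mul_le_mul_of_nonneg_left (b0 (fderiv ℝ g x) a) (abs_nonneg (f x))
    have i2 := mul_le_mul_of_nonneg_left (b0 (fderiv ℝ f x) a) (abs_nonneg (g x))
    linarith
  have nf := hnn f x
  have ng := hnn g x
  have h2 : hn (fun z => f z * g z) x ≤ |f x| * hn g x + 2 * (‖fderiv ℝ g x‖ * ‖fderiv ℝ f x‖)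
      + |g x| * hn f x := by
    refine hn_le_of (by positivity) fun a b => ?_
    rw [e2, Real.norm_eq_abs]
    have i1 : |f x * fderiv ℝ (fderiv ℝ g) x a b| ≤ |f x| * (hn g x * ‖a‖ * ‖b‖) := by
      rw [abs_mul]
      exact mul_le_mul_of_nonneg_left (hn_bil g x a b) (abs_nonneg _)
    have i2 : |g x * fderiv ℝ (fderiv ℝ f) x a b| ≤ |g x| * (hn f x * ‖a‖ * ‖b‖) := by
      rw [abs_mul]
      exact mul_le_mul_of_nonneg_left (hn_bil f x a b) (abs_nonneg _)
    have i3 : |fderiv ℝ g x b * fderiv ℝ f x a| ≤ (‖fderiv ℝ g x‖ * ‖b‖) * (‖fderiv ℝ f x‖ * ‖a‖) := by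
      rw [abs_mul]
      exact mul_le_mul (b0 _ b) (b0 _ a) (abs_nonneg _) (by positivity)
    have i4 : |fderiv ℝ f x b * fderiv ℝ g x a| ≤ (‖fderiv ℝ f x‖ * ‖b‖) * (‖fderiv ℝ g x‖ * ‖a‖) := by
      rw [abs_mul]
      exact mul_le_mul (b0 _ b) (b0 _ a) (abs_nonneg _) (by positivity)
    refine (abs_add_le _ _).trans ?_
    have := abs_add_le (f x * fderiv ℝ (fderiv ℝ g) x a b) (fderiv ℝ g x b * fderiv ℝ f x a)
    have := abs_add_le (g x * fderiv ℝ (fderiv ℝ f) x a b) (fderiv ℝ f x b * fderiv ℝ g x a)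
    nlinarith
  unfold j2
  rw [abs_mul]
  have q0 := abs_nonneg (f x)
  have q1 := abs_nonneg (g x)
  have q2 := norm_nonneg (fderiv ℝ f x)
  have q3 := norm_nonneg (fderiv ℝ g x)
  refine (add_le_add (add_le_add le_rfl h1) h2).trans ?_
  have r1 := mul_nonneg q0 q1
  have r2 := mul_nonneg q0 q3
  have r3 := mul_nonneg q0 ng
  have r4 := mul_nonneg q2 q1
  have r5 := mul_nonneg q2 q3
  have r6 := mul_nonneg q2 ng
  have r7 := mul_nonneg nf q1
  have r8 := mul_nonneg nf q3
  have r9 := mul_nonneg nf ng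
  nlinarith

theorem j2_scale {m : ℕ} {c : EV m → ℝ} (hc : ContDiff ℝ 2 c) {s : ℝ} (h0 : 0 ≤ s) (h1 : s ≤ 1) (x : EV m) :
    j2 (fun z => c (s • z)) x ≤ j2 c (s • x) := by
  have e1 : ∀ z b, fderiv ℝ (fun z => c (s • z)) z b = s * fderiv ℝ c (s • z) b := by
    intro z b
    rw [fderiv_comp_smul]
    rfl
  have dc : Differentiable ℝ (fderiv ℝ c) := (hc.fderiv_right (m := 1) (by norm_num)).differentiable (by norm_num)
  have hcs : ContDiff ℝ 2 (fun z => c (s • z)) := hc.comp (contDiff_const_smul s)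
  have dcs : Differentiable ℝ (fderiv ℝ (fun z => c (s • z))) :=
    (hcs.fderiv_right (m := 1) (by norm_num)).differentiable (by norm_num)
  have e2 : ∀ a b, fderiv ℝ (fderiv ℝ (fun z => c (s • z))) x a b =
      s * (s * fderiv ℝ (fderiv ℝ c) (s • x) a b) := by
    intro a b
    rw [← fderiv_apply_const dcs]
    simp_rw [e1]
    have hd : Differentiable ℝ (fun w => fderiv ℝ c w b) := dc.clm_apply (differentiable_const b)
    have hd2 : DifferentiableAt ℝ (fun z => fderiv ℝ c (s • z) b) x :=
      (hd (s • x)).comp x (differentiableAt_id.const_smul s)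
    rw [fderiv_const_mul hd2]
    have h9 : fderiv ℝ (fun z => fderiv ℝ c (s • z) b) x =
      s • fderiv ℝ (fun w => fderiv ℝ c w b) (s • x) :=
      fderiv_comp_smul (f := fun w => fderiv ℝ c w b) ..
    show s * fderiv ℝ (fun z => fderiv ℝ c (s • z) b) x a = _
    rw [h9]
    show s * (s * fderiv ℝ (fun w => fderiv ℝ c w b) (s • x) a) = _
    rw [fderiv_apply_const dc]
  have nc := hnn c (s • x)
  have i1 : ‖fderiv ℝ (fun z => c (s • z)) x‖ ≤ ‖fderiv ℝ c (s • x)‖ := by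
    refine ContinuousLinearMap.opNorm_le_bound _ (by positivity) fun a => ?_
    rw [e1, norm_mul, Real.norm_of_nonneg h0]
    have := (fderiv ℝ c (s • x)).le_opNorm a
    have h3 := norm_nonneg (fderiv ℝ c (s • x) a)
    nlinarith
  have i2 : hn (fun z => c (s • z)) x ≤ hn c (s • x) := by
    refine hn_le_of nc fun a b => ?_
    rw [e2, norm_mul, norm_mul, Real.norm_of_nonneg h0]
    have := hn_bil c (s • x) a b
    have h3 := norm_nonneg (fderiv ℝ (fderiv ℝ c) (s • x) a b)
    have h4 : s * ‖fderiv ℝ (fderiv ℝ c) (s • x) a b‖ ≤ ‖fderiv ℝ (fderiv ℝ c) (s • x) a b‖ := by nlinarith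
    have h5 : 0 ≤ s * ‖fderiv ℝ (fderiv ℝ c) (s • x) a b‖ := by positivity
    nlinarith
  unfold j2
  linarith

/-- radial cutoff -/
def cutb {m : ℕ} (x : EV m) : ℝ := Real.smoothTransition (2 - ‖x‖ ^ 2)

theorem cutb_cd {m : ℕ} : ContDiff ℝ 2 (cutb (m := m)) :=
  Real.smoothTransition.contDiff.comp (contDiff_const.sub (contDiff_norm_sq ℝ))

theorem cutb_one {m : ℕ} {x : EV m} (h : ‖x‖ ≤ 1) : cutb x = 1 := by
  refine Real.smoothTransition.one_of_one_le ?_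
  nlinarith [norm_nonneg x]

theorem cutb_zero {m : ℕ} {x : EV m} (h : 2 ≤ ‖x‖) : cutb x = 0 := by
  refine Real.smoothTransition.zero_of_nonpos ?_
  nlinarith [norm_nonneg x]

theorem cutb_bd (m : ℕ) : ∃ C, 0 ≤ C ∧ ∀ x : EV m, j2 (fun z => 1 - cutb z) x ≤ C := by
  have hc : ContDiff ℝ 2 (fun z : EV m => 1 - cutb z) := contDiff_const.sub cutb_cd
  obtain ⟨C, hC⟩ := (isCompact_closedBall (0 : EV m) 2).exists_bound_of_continuousOn (j2_cont hc).continuousOn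
  refine ⟨max C 1, by positivity, fun x => ?_⟩
  by_cases hx : ‖x‖ ≤ 2
  · have := hC x (by simpa using hx)
    exact ((le_abs_self _).trans this).trans (le_max_left _ _)
  · have : (fun z : EV m => 1 - cutb z) =ᶠ[𝓝 x] fun _ => 1 := by
      have ho : IsOpen {z : EV m | 2 < ‖z‖} := isOpen_lt continuous_const continuous_norm
      filter_upwards [ho.mem_nhds (show x ∈ {z : EV m | 2 < ‖z‖} from not_le.1 hx)] with z hz
      have hz' : 2 < ‖z‖ := hz
      rw [cutb_zero hz'.le, sub_zero]
    rw [j2_congr this, j2_const, abs_one]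
    exact le_max_right _ _

theorem cut_approx {n : ℕ} {p : ℝ≥0∞} (hp1 : 1 ≤ p) (hp : p ≠ ⊤) {g : EV (n + 1) → ℝ}
    (hg : ContDiff ℝ 2 g) (he : ∀ x, g (RR n x) = g x) (hm : eLpNorm (j2 g) p volume ≠ ⊤)
    {η : ℝ≥0∞} (hη : 0 < η) : ∃ f : EV (n + 1) → ℝ, ContDiff ℝ 2 f ∧ HasCompactSupport f ∧
      (∀ x, f (RR n x) = f x) ∧ eLpNorm (j2 (g - f)) p volume ≤ η := by
  obtain ⟨C, hC0, hC⟩ := cutb_bd (n + 1)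
  have hq : 0 < p.toReal := by have := one_le_toReal hp1 hp; linarith
  have hp0 : p ≠ 0 := (lt_of_lt_of_le one_pos hp1).ne'
  set s : ℕ → ℝ := fun N => ((N : ℝ) + 1)⁻¹ with hs
  have hs0 : ∀ N, 0 < s N := fun N => by positivity
  have hs1 : ∀ N, s N ≤ 1 := fun N => inv_le_one_of_one_le₀ (by linarith [Nat.cast_nonneg (α := ℝ) N])
  have hbc : ∀ N, ContDiff ℝ 2 (fun x : EV (n + 1) => cutb (s N • x)) := fun N =>
    cutb_cd.comp (contDiff_const_smul (s N))
  have hcc : ContDiff ℝ 2 (fun z : EV (n + 1) => 1 - cutb z) := contDiff_const.sub cutb_cd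
  have hcN : ∀ N, ContDiff ℝ 2 (fun x : EV (n + 1) => 1 - cutb (s N • x)) := fun N =>
    contDiff_const.sub (hbc N)
  have heq : ∀ N, (g - fun x => g x * cutb (s N • x)) = fun x => g x * (1 - cutb (s N • x)) := by
    intro N; funext x; simp only [Pi.sub_apply]; ring
  have hle : ∀ N x, j2 (g - fun x => g x * cutb (s N • x)) x ≤ 2 * C * j2 g x := by
    intro N x
    rw [heq]
    refine (j2_mul hg (hcN N) x).trans ?_
    have h1 := (j2_scale hcc (hs0 N).le (hs1 N) x).trans (hC _)
    have h2 := j2_nonneg g x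
    have h3 := mul_le_mul_of_nonneg_left h1 h2
    linarith
  have hcont : ∀ N, Continuous (j2 (g - fun x => g x * cutb (s N • x))) := fun N =>
    j2_cont (hg.sub (hg.mul (hbc N)))
  have hlim : Tendsto (fun N => ∫⁻ x, ‖j2 (g - fun x => g x * cutb (s N • x)) x‖ₑ ^ p.toReal) atTop
      (𝓝 (∫⁻ _ : EV (n + 1), 0)) := by
    refine tendsto_lintegral_of_dominated_convergence (fun x => ‖2 * C * j2 g x‖ₑ ^ p.toReal)
      (fun N => ((hcont N).enorm.measurable.pow_const _)) (fun N => Eventually.of_forall fun x => ?_) ?_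
      (Eventually.of_forall fun x => ?_)
    · refine ENNReal.rpow_le_rpow ?_ hq.le
      rw [Real.enorm_of_nonneg (j2_nonneg _ _), Real.enorm_of_nonneg
        (mul_nonneg (by positivity) (j2_nonneg _ _))]
      exact ENNReal.ofReal_le_ofReal (hle N x)
    · have h1 : eLpNorm (fun x => 2 * C * j2 g x) p volume ≠ ⊤ := by
        have := eLpNorm_const_smul (2 * C) (j2 g) p (volume : Measure (EV (n + 1)))
        have h2 : (2 * C) • j2 g = fun x => 2 * C * j2 g x := rfl
        rw [h2] at this
        rw [this]
        exact ENNReal.mul_ne_top enorm_ne_top hm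
      exact (lintegral_rpow_enorm_lt_top_of_eLpNorm_lt_top hp0 hp (lt_top_iff_ne_top.2 h1)).ne
    · refine tendsto_const_nhds.congr' ?_
      obtain ⟨N0, hN0⟩ := exists_nat_gt ‖x‖
      filter_upwards [eventually_ge_atTop N0] with N hN
      have hev : (g - fun x => g x * cutb (s N • x)) =ᶠ[𝓝 x] fun _ => 0 := by
        have ho : IsOpen {z : EV (n + 1) | ‖z‖ < N0} := isOpen_lt continuous_norm continuous_const
        filter_upwards [ho.mem_nhds (show x ∈ {z : EV (n + 1) | ‖z‖ < N0} from hN0)] with z hz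
        have hz' : ‖z‖ < N0 := hz
        have hN' : (N0 : ℝ) ≤ N := by exact_mod_cast hN
        rw [heq]
        show g z * (1 - cutb (s N • z)) = 0
        rw [cutb_one, sub_self, mul_zero]
        rw [norm_smul, Real.norm_of_nonneg (hs0 N).le, hs, inv_mul_le_iff₀ (by positivity)]
        linarith
      rw [j2_congr hev, j2_const, abs_zero, enorm_zero, ENNReal.zero_rpow_of_pos hq]
  rw [lintegral_zero] at hlim
  have hlim2 := hlim.ennrpow_const (1 / p.toReal)
  rw [ENNReal.zero_rpow_of_pos (by positivity)] at hlim2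
  obtain ⟨N, hN⟩ := (hlim2.eventually_le_const hη).exists
  refine ⟨fun x => g x * cutb (s N • x), hg.mul (hbc N), ?_, fun x => ?_, ?_⟩
  · refine HasCompactSupport.intro (isCompact_closedBall (0 : EV (n + 1)) (2 * (N + 1))) fun x hx => ?_
    rw [cutb_zero, mul_zero]
    have : 2 * ((N : ℝ) + 1) < ‖x‖ := by simpa using hx
    rw [norm_smul, Real.norm_of_nonneg (hs0 N).le, hs, le_inv_mul_iff₀ (by positivity)]
    linarith
  · show g (RR n x) * cutb (s N • RR n x) = g x * cutb (s N • x)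
    rw [he]
    unfold cutb
    rw [← map_smul, (RR n).norm_map]
  · rw [eLpNorm_eq_lintegral_rpow_enorm_toReal hp0 hp]
    exact hN

theorem even_approx_one {n : ℕ} {p : ℝ≥0∞} (hp1 : 1 ≤ p) (hp : p ≠ ⊤)
    {W : List (Fin (n + 1)) → EV (n + 1) → ℝ} (hW : ∀ l ∈ L2 (n + 1), MemLp (W l) p volume)
    (hw : ∀ l : List (Fin (n + 1)), l.length < 2 → ∀ i, WeakDerivOn Set.univ i (W l) (W (i :: l)))
    (he : ∀ x, W [] (RR n x) = W [] x) {η : ℝ≥0∞} (hη : 0 < η) (hη1 : η ≠ ⊤) :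
    ∃ f : EV (n + 1) → ℝ, ContDiff ℝ 2 f ∧ HasCompactSupport f ∧
      (∀ x, f (RR n x) = f x) ∧ ∀ l ∈ L2 (n + 1), eLpNorm (partialDList l f - W l) p volume ≤ η := by
  have hη2 : 0 < η / 2 := ENNReal.half_pos hη.ne'
  obtain ⟨δ, hδ, hb⟩ := mol_conv_all hp1 hp hW hη2
  obtain ⟨ζ, hζ, hze⟩ := exists_even_moll n hδ
  have hpd := mol_pd hp1 hW hw hζ
  have hg : ContDiff ℝ 2 (mol ζ (W [])) := by
    have := mol_smooth hζ.cd hζ.cs ((hW [] (by simp [mem_L2])).locallyIntegrable hp1)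
    exact_mod_cast contDiff_infty.1 this 2
  have hfin : eLpNorm (j2 (mol ζ (W []))) p volume ≠ ⊤ := by
    refine ((eLp_j2_le hg hp1 _).trans_lt (ENNReal.mul_lt_top ENNReal.ofReal_lt_top
      (ENNReal.sum_lt_top.2 fun l hl => ?_))).ne
    have hs1 : AEStronglyMeasurable (partialDList l (mol ζ (W []))) volume := (pd_cont hg l hl).aestronglyMeasurable
    have e : partialDList l (mol ζ (W [])) = (partialDList l (mol ζ (W [])) - W l) + W l := by simp
    rw [e]
    refine (eLpNorm_add_le (hs1.sub (hW l hl).1) (hW l hl).1 hp1).trans_lt ?_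
    rw [hpd l hl]
    refine ENNReal.add_lt_top.2 ⟨(hb ζ hζ l hl).trans_lt ?_, (hW l hl).2⟩
    exact lt_of_le_of_lt ENNReal.half_le_self (lt_top_iff_ne_top.2 hη1)
  obtain ⟨f, hf, hfs, hfe, hfa⟩ := cut_approx hp1 hp hg (mol_even hze he) hfin hη2
  refine ⟨f, hf, hfs, hfe, fun l hl => ?_⟩
  have hs1 : AEStronglyMeasurable (partialDList l (mol ζ (W []))) volume := (pd_cont hg l hl).aestronglyMeasurable
  have hs2 : AEStronglyMeasurable (partialDList l f) volume := (pd_cont hf l hl).aestronglyMeasurable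
  have e : partialDList l f - W l = (partialDList l f - partialDList l (mol ζ (W []))) +
    (partialDList l (mol ζ (W [])) - W l) := by simp
  rw [e]
  refine (eLpNorm_add_le (hs2.sub hs1) (hs1.sub (hW l hl).1) hp1).trans ?_
  rw [← ENNReal.add_halves η]
  refine add_le_add ?_ ?_
  · rw [eLpNorm_sub_comm, ← pd_sub hg hf l hl]
    exact (eLp_pd_le (hg.sub hf) _ l hl).trans hfa
  · rw [hpd l hl]
    exact hb ζ hζ l hl

theorem even_approx {n : ℕ} {p : ℝ≥0∞} (hp1 : 1 ≤ p) (hp : p ≠ ⊤)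
    {W : List (Fin (n + 1)) → EV (n + 1) → ℝ} (hW : ∀ l ∈ L2 (n + 1), MemLp (W l) p volume)
    (hw : ∀ l : List (Fin (n + 1)), l.length < 2 → ∀ i, WeakDerivOn Set.univ i (W l) (W (i :: l)))
    (he : ∀ x, W [] (RR n x) = W [] x) :
    ∃ g : ℕ → EV (n + 1) → ℝ, (∀ k, ContDiff ℝ 2 (g k)) ∧ (∀ k, HasCompactSupport (g k)) ∧
      (∀ k x, g k (RR n x) = g k x) ∧
      ∀ l ∈ L2 (n + 1), Tendsto (fun k => eLpNorm (partialDList l (g k) - W l) p volume) atTop (𝓝 0) := by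
  have hη : ∀ k : ℕ, (0 : ℝ≥0∞) < ((k : ℝ≥0∞) + 1)⁻¹ := fun k => by
    simp
  have hη1 : ∀ k : ℕ, ((k : ℝ≥0∞) + 1)⁻¹ ≠ ⊤ := fun k => by
    simp
  choose g h1 h2 h3 h4 using fun k : ℕ => even_approx_one hp1 hp hW hw he (hη k) (hη1 k)
  refine ⟨g, h1, h2, h3, fun l hl => ?_⟩
  have ht : Tendsto (fun k : ℕ => ((k : ℝ≥0∞) + 1)⁻¹) atTop (𝓝 0) := by
    have := ENNReal.tendsto_inv_nat_nhds_zero.comp (tendsto_add_atTop_nat 1)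
    refine this.congr fun k => ?_
    simp
  exact tendsto_of_tendsto_of_tendsto_of_le_of_le tendsto_const_nhds ht (fun _ => zero_le)
    (fun k => h4 k l hl)

theorem j2_tend {m : ℕ} {p : ℝ≥0∞} (hp1 : 1 ≤ p) {μ : Measure (EV m)} {ι : Type*} {F : Filter ι}
    {a b : ι → EV m → ℝ} (ha : ∀ k, ContDiff ℝ 2 (a k)) (hb : ∀ k, ContDiff ℝ 2 (b k))
    {X : List (Fin m) → EV m → ℝ} (hX : ∀ l ∈ L2 m, AEStronglyMeasurable (X l) μ)
    (h1 : ∀ l ∈ L2 m, Tendsto (fun k => eLpNorm (partialDList l (a k) - X l) p μ) F (𝓝 0))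
    (h2 : ∀ l ∈ L2 m, Tendsto (fun k => eLpNorm (partialDList l (b k) - X l) p μ) F (𝓝 0)) :
    Tendsto (fun k => eLpNorm (j2 (a k - b k)) p μ) F (𝓝 0) := by
  have hs : Tendsto (fun k => ENNReal.ofReal (1 + m + m * m) * ∑ l ∈ L2 m,
      (eLpNorm (partialDList l (a k) - X l) p μ + eLpNorm (partialDList l (b k) - X l) p μ)) F (𝓝 0) := by
    have : Tendsto (fun k => ∑ l ∈ L2 m,
      (eLpNorm (partialDList l (a k) - X l) p μ + eLpNorm (partialDList l (b k) - X l) p μ)) F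
      (𝓝 (∑ l ∈ L2 m, (0 + 0))) := tendsto_finsetSum _ fun l hl => (h1 l hl).add (h2 l hl)
    have h3 := ENNReal.Tendsto.const_mul (a := ENNReal.ofReal (1 + m + m * m)) this
      (Or.inr ENNReal.ofReal_ne_top)
    simpa using h3
  refine tendsto_of_tendsto_of_tendsto_of_le_of_le tendsto_const_nhds hs (fun _ => zero_le) fun k => ?_
  refine (eLp_j2_le ((ha k).sub (hb k)) hp1 μ).trans (mul_le_mul' le_rfl (Finset.sum_le_sum fun l hl => ?_))
  show eLpNorm (partialDList l (a k - b k)) p μ ≤ _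
  rw [pd_sub (ha k) (hb k) l hl]
  have m1 : AEStronglyMeasurable (partialDList l (a k)) μ := (pd_cont (ha k) l hl).aestronglyMeasurable
  have m2 : AEStronglyMeasurable (partialDList l (b k)) μ := (pd_cont (hb k) l hl).aestronglyMeasurable
  have e : partialDList l (a k) - partialDList l (b k) =
    (partialDList l (a k) - X l) - (partialDList l (b k) - X l) := by simp
  rw [e]
  exact eLpNorm_sub_le (m1.sub (hX l hl)) (m2.sub (hX l hl)) hp1

theorem tend_fst : Tendsto (Prod.fst : ℕ × ℕ → ℕ) atTop atTop := by
  rw [← prod_atTop_atTop_eq]; exact tendsto_fst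

theorem tend_snd : Tendsto (Prod.snd : ℕ × ℕ → ℕ) atTop atTop := by
  rw [← prod_atTop_atTop_eq]; exact tendsto_snd

theorem tend_dom {ι : Type*} {F : Filter ι} {f g : ι → ℝ≥0∞} {C : ℝ≥0∞} (hC : C ≠ ⊤)
    (hg : Tendsto g F (𝓝 0)) (h : ∀ k, f k ≤ C * g k) : Tendsto f F (𝓝 0) := by
  have h3 := ENNReal.Tendsto.const_mul (a := C) hg (Or.inr hC)
  rw [mul_zero] at h3
  exact tendsto_of_tendsto_of_tendsto_of_le_of_le tendsto_const_nhds h3 (fun _ => zero_le) h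

theorem density {n : ℕ} {γ : EV n → ℝ} {K : ℝ} (hg : GH γ K) {p : ℝ≥0∞} (hp1 : 1 ≤ p)
    (hp : p ≠ ⊤) {u : EV (n + 1) → ℝ} {D : List (Fin (n + 1)) → EV (n + 1) → ℝ}
    (hD : IsSobDerivs (halfSpace γ) 2 p u D) (hG : Green (halfSpace γ) D) :
    ∃ v : ℕ → EV (n + 1) → ℝ, (∀ k, CN γ (v k)) ∧
      Tendsto (fun q : ℕ × ℕ => eLpNorm (j2 (v q.1 - v q.2)) p volume) atTop (𝓝 0) ∧
      ∀ l ∈ L2 (n + 1), Tendsto (fun k => eLpNorm (partialDList l (v k) - D l) p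
        (volume.restrict (halfSpace γ))) atTop (𝓝 0) := by
  have hDm : ∀ l ∈ L2 (n + 1), MemLp (D l) p (volume.restrict (halfSpace γ)) := fun l hl =>
    hD.2.2 l (mem_L2.1 hl)
  obtain ⟨U, hU, hUm, hUc⟩ := approx_seq hg hp1 hp hD
  obtain ⟨Ψ, Φ, B, hF⟩ := hg.exists_DF
  obtain ⟨C, hC, hcmp⟩ := hF.cmp hp1 hp
  have hHm := (H0_open n).measurableSet
  have cmpH : ∀ f : EV (n + 1) → ℝ, ContDiff ℝ 2 f →
      eLpNorm (j2 f) p (volume.restrict (halfSpace γ)) ≤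
        C * eLpNorm (j2 fun z => f (Ψ z)) p (volume.restrict (H0s n)) ∧
      eLpNorm (j2 fun z => f (Ψ z)) p (volume.restrict (H0s n)) ≤
        C * eLpNorm (j2 f) p (volume.restrict (halfSpace γ)) := by
    intro f hf
    have := hcmp (H0s n) hHm f hf
    rw [hF.image_half] at this
    exact this
  have cmpU : ∀ f : EV (n + 1) → ℝ, ContDiff ℝ 2 f →
      eLpNorm (j2 f) p volume ≤ C * eLpNorm (j2 fun z => f (Ψ z)) p volume := by
    intro f hf
    have := (hcmp Set.univ MeasurableSet.univ f hf).1
    rw [hF.image_univ, Measure.restrict_univ] at this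
    exact this
  set f : ℕ → EV (n + 1) → ℝ := fun k z => U k (Ψ z) with hfd
  have hf : ∀ k, ContDiff ℝ 2 (f k) := fun k => (hU k).comp hF.c2
  -- Cauchy property of the pulled back sequence
  have hUcau : Tendsto (fun q : ℕ × ℕ => eLpNorm (j2 (U q.1 - U q.2)) p
      (volume.restrict (halfSpace γ))) atTop (𝓝 0) :=
    j2_tend hp1 (a := fun q : ℕ × ℕ => U q.1) (b := fun q : ℕ × ℕ => U q.2) (fun q => hU q.1) (fun q => hU q.2)
      (fun l hl => (hDm l hl).1)
      (fun l hl => (hUc l hl).comp tend_fst) (fun l hl => (hUc l hl).comp tend_snd)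
  have hfcau : Tendsto (fun q : ℕ × ℕ => eLpNorm (j2 (f q.1 - f q.2)) p
      (volume.restrict (H0s n))) atTop (𝓝 0) :=
    tend_dom hC hUcau fun q => (cmpH (U q.1 - U q.2) ((hU q.1).sub (hU q.2))).2
  have hfm : ∀ k, ∀ l ∈ L2 (n + 1), MemLp (partialDList l (f k)) p (volume.restrict (H0s n)) := by
    intro k l hl
    refine ⟨(pd_cont (hf k) l hl).aestronglyMeasurable, ?_⟩
    refine (eLp_pd_le (hf k) _ l hl).trans_lt ?_
    refine ((cmpH (U k) (hU k)).2).trans_lt (ENNReal.mul_lt_top (lt_top_iff_ne_top.2 hC) ?_)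
    refine (eLp_j2_le (hU k) hp1 _).trans_lt (ENNReal.mul_lt_top ENNReal.ofReal_lt_top
      (ENNReal.sum_lt_top.2 fun l hl => (hUm k l hl).2))
  have hlim : ∀ l : List (Fin (n + 1)), ∃ F : EV (n + 1) → ℝ, l ∈ L2 (n + 1) →
      MemLp F p (volume.restrict (H0s n)) ∧ Tendsto (fun k => eLpNorm (partialDList l (f k) - F) p
        (volume.restrict (H0s n))) atTop (𝓝 0) := by
    intro l
    by_cases hl : l ∈ L2 (n + 1)
    · obtain ⟨F, h1, h2⟩ := lp_complete hp1 (fun k => hfm k l hl)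
        (tendsto_of_tendsto_of_tendsto_of_le_of_le tendsto_const_nhds hfcau (fun _ => zero_le)
          (fun q => by
            show eLpNorm (partialDList l (f q.1) - partialDList l (f q.2)) p _ ≤ _
            rw [← pd_sub (hf q.1) (hf q.2) l hl]
            exact eLp_pd_le ((hf q.1).sub (hf q.2)) _ l hl))
      exact ⟨F, fun _ => ⟨h1, h2⟩⟩
    · exact ⟨0, fun h => absurd h hl⟩
  choose F hFF using hlim
  have hFm := fun l hl => (hFF l hl).1
  have hFc := fun l hl => (hFF l hl).2
  -- boundary condition in the limit
  have hb : ∀ φ : EV (n + 1) → ℝ, ContDiff ℝ (⊤ : ℕ∞) φ → HasCompactSupport φ →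
      Tendsto (fun k => ∫ y : EV n, partialD (Fin.last n) (f k) (snocE y 0) * φ (snocE y 0)) atTop (𝓝 0) := by
    intro φ hφ hs
    refine (bdry_tendsto hg hp1 hG hDm hU hUm hUc hφ hs).congr fun k => ?_
    refine integral_congr_ae (Eventually.of_forall fun y => ?_)
    have h1 := hF.fd_comp (hU k) (snocE y 0) (eN n)
    rw [hF.bdry, hF.nor] at h1
    show fderiv ℝ (U k) (snocE y (γ y)) (Nvec γ y) * φ (snocE y 0) =
      fderiv ℝ (fun z => U k (Ψ z)) (snocE y 0) (eN n) * φ (snocE y 0)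
    rw [h1]
  have hw := refl_weak hp1 hf hfm hFm hFc hb
  obtain ⟨g, hg2, hgs, hge, hgc⟩ := even_approx hp1 hp (W := fun l => Wx (sgl l) (F l))
    (fun l hl => Wx_memLp _ (hFm l hl)) hw (fun x => Wx_even _ x)
  have hv2 : ∀ k, ContDiff ℝ 2 (fun x => g k (Φ x)) := fun k => (hg2 k).comp hF.c2'
  have hvg : ∀ k, (fun z => (fun x => g k (Φ x)) (Ψ z)) = g k := fun k => by
    funext z; show g k (Φ (Ψ z)) = _; rw [hF.linv]
  have hWm : ∀ l ∈ L2 (n + 1), AEStronglyMeasurable (Wx (sgl l) (F l)) volume := fun l hl =>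
    (Wx_memLp _ (hFm l hl)).1
  refine ⟨fun k x => g k (Φ x), fun k => ⟨hv2 k, ?_, fun y => ?_⟩, ?_, ?_⟩
  · refine HasCompactSupport.intro ((hgs k).image hF.c2.continuous) fun x hx => ?_
    by_contra hne
    exact hx ⟨Φ x, subset_tsupport _ hne, hF.rinv x⟩
  · have h1 := hF.fd_comp (hv2 k) (snocE y 0) (eN n)
    rw [hF.bdry, hF.nor, hvg] at h1
    rw [← h1]
    have h2 := partialD_RR ((hg2 k).differentiable (by norm_num)) (Fin.last n) (snocE y 0)
    have e : (fun z => g k (RR n z)) = g k := funext (hge k)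
    rw [e, RR_zero] at h2
    have h3 : partialD (Fin.last n) (g k) (snocE y 0) = 0 := by
      simp only [sg, if_true] at h2
      linarith
    exact h3
  · have hgcau : Tendsto (fun q : ℕ × ℕ => eLpNorm (j2 (g q.1 - g q.2)) p volume) atTop (𝓝 0) :=
      j2_tend hp1 (a := fun q : ℕ × ℕ => g q.1) (b := fun q : ℕ × ℕ => g q.2) (fun q => hg2 q.1)
        (fun q => hg2 q.2) hWm (fun l hl => (hgc l hl).comp tend_fst) (fun l hl => (hgc l hl).comp tend_snd)
    refine tend_dom hC hgcau fun q => ?_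
    have h1 := cmpU ((fun x => g q.1 (Φ x)) - fun x => g q.2 (Φ x)) ((hv2 q.1).sub (hv2 q.2))
    have e : (fun z => ((fun x => g q.1 (Φ x)) - fun x => g q.2 (Φ x)) (Ψ z)) = g q.1 - g q.2 := by
      funext z
      show g q.1 (Φ (Ψ z)) - g q.2 (Φ (Ψ z)) = _
      rw [hF.linv]; rfl
    rw [e] at h1
    exact h1
  · have hgf : Tendsto (fun k => eLpNorm (j2 (g k - f k)) p (volume.restrict (H0s n))) atTop (𝓝 0) := by
      refine j2_tend hp1 hg2 hf (X := F) (fun l hl => (hFm l hl).1) (fun l hl => ?_) hFc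
      refine tendsto_of_tendsto_of_tendsto_of_le_of_le tendsto_const_nhds (hgc l hl) (fun _ => zero_le)
        fun k => ?_
      refine le_trans (le_of_eq ?_) (eLpNorm_mono_measure _
        (Measure.restrict_le_self (μ := volume) (s := H0s n)))
      refine eLpNorm_congr_ae ?_
      filter_upwards [ae_restrict_mem hHm] with x hx
      simp only [Pi.sub_apply, Wx_on _ _ hx]
    have hvU : Tendsto (fun k => eLpNorm (j2 ((fun x => g k (Φ x)) - U k)) p
        (volume.restrict (halfSpace γ))) atTop (𝓝 0) := by
      refine tend_dom hC hgf fun k => ?_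
      have h1 := (cmpH ((fun x => g k (Φ x)) - U k) ((hv2 k).sub (hU k))).1
      have e : (fun z => ((fun x => g k (Φ x)) - U k) (Ψ z)) = g k - f k := by
        funext z
        show g k (Φ (Ψ z)) - U k (Ψ z) = _
        rw [hF.linv]; rfl
      rw [e] at h1
      exact h1
    intro l hl
    have hs := hvU.add (hUc l hl)
    rw [add_zero] at hs
    refine tendsto_of_tendsto_of_tendsto_of_le_of_le tendsto_const_nhds hs (fun _ => zero_le) fun k => ?_
    have m1 : AEStronglyMeasurable (partialDList l (fun x => g k (Φ x))) (volume.restrict (halfSpace γ)) :=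
      (pd_cont (hv2 k) l hl).aestronglyMeasurable
    have m2 := (hUm k l hl).1
    have e : partialDList l (fun x => g k (Φ x)) - D l = (partialDList l (fun x => g k (Φ x)) -
      partialDList l (U k)) + (partialDList l (U k) - D l) := by simp
    show eLpNorm (partialDList l (fun x => g k (Φ x)) - D l) p _ ≤ _
    rw [e]
    refine (eLpNorm_add_le (m1.sub m2) (m2.sub (hDm l hl).1) hp1).trans (add_le_add ?_ le_rfl)
    rw [← pd_sub (hv2 k) (hU k) l hl]
    exact eLp_pd_le ((hv2 k).sub (hU k)) _ l hl

theorem GH.of_Ckb {n : ℕ} {γ : EV n → ℝ} (h : Ckb 3 γ) (hb : ∀ x : EV n, |γ x| ≤ 1 / 8 ∧ ‖fderiv ℝ γ x‖ ≤ 1 / 8) :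
    ∃ K, GH γ K := by
  obtain ⟨C2, h2⟩ := h.2 2 (by norm_num)
  obtain ⟨C3, h3⟩ := h.2 3 (by norm_num)
  refine ⟨max 0 (max C2 C3), by exact_mod_cast h.1, le_max_left _ _, fun x => (hb x).1, fun x => (hb x).2,
    fun x => ?_, fun x => ?_⟩
  · have e : hn γ x = ‖iteratedFDeriv ℝ 2 γ x‖ := by
      rw [← norm_iteratedFDeriv_fderiv, norm_iteratedFDeriv_one]; unfold hn nrm; rfl
    rw [e]
    exact (h2 x).trans ((le_max_left _ _).trans (le_max_right _ _))
  · have e : hn (fderiv ℝ γ) x = ‖iteratedFDeriv ℝ 3 γ x‖ := by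
      rw [← norm_iteratedFDeriv_fderiv, ← norm_iteratedFDeriv_fderiv, norm_iteratedFDeriv_one]; unfold hn nrm; rfl
    rw [e]
    exact (h3 x).trans ((le_max_right _ _).trans (le_max_right _ _))

theorem ext_eq {n : ℕ} {ρ : EV (n + 1) → ℝ} (h1 : A1 ρ) {γ : EV n → ℝ} (hγ : ContDiff ℝ 1 γ)
    {p : ℝ≥0∞} (hp1 : 1 ≤ p) {ε c : ℝ} (hε : 0 < ε) {L : (EV (n + 1) → ℝ) → EV (n + 1) → ℝ}
    (hL : IsNLExtOn (halfSpace γ) (1 : Matrix (Fin (n + 1)) (Fin (n + 1)) ℝ) ρ p ε c L)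
    {v : EV (n + 1) → ℝ} (hv : CN γ v) :
    L v =ᵐ[volume.restrict (halfSpace γ)] fun x => opR (halfSpace γ) (scaled ρ ε) v x -
      opB (halfSpace γ) (scaled ρ ε) v x := by
  have hΩ := halfSpace_open hγ.continuous
  filter_upwards [hL.1 v hv.cd hv.cs (hv.memWN hγ hp1), ae_restrict_mem hΩ.measurableSet] with x hx hxΩ
  exact tendsto_nhds_unique hx (pv_formula (ker_scaled h1 hε) hΩ hv.cd hv.cs hxΩ)

theorem ext_close {n : ℕ} {ρ : EV (n + 1) → ℝ} (h1 : A1 ρ) {γ : EV n → ℝ} (hγ : ContDiff ℝ 1 γ)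
    {p : ℝ≥0∞} (hp1 : 1 ≤ p) {C : ℝ≥0∞}
    (hC : ∀ ε : ℝ, 0 < ε → ∀ v, CN γ v →
      eLpNorm (fun x => opR (halfSpace γ) (scaled ρ ε) v x - opB (halfSpace γ) (scaled ρ ε) v x) p
        (volume.restrict (halfSpace γ)) ≤ C * eLpNorm (j2 v) p volume)
    {ε c : ℝ} (hε : 0 < ε) {L : (EV (n + 1) → ℝ) → EV (n + 1) → ℝ}
    (hL : IsNLExtOn (halfSpace γ) (1 : Matrix (Fin (n + 1)) (Fin (n + 1)) ℝ) ρ p ε c L)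
    {u : EV (n + 1) → ℝ} {D : List (Fin (n + 1)) → EV (n + 1) → ℝ}
    (hD : IsSobDerivs (halfSpace γ) 2 p u D) (hG : Green (halfSpace γ) D)
    {v : ℕ → EV (n + 1) → ℝ} (hv : ∀ k, CN γ (v k))
    (hvc : ∀ l ∈ L2 (n + 1), Tendsto (fun k => eLpNorm (partialDList l (v k) - D l) p
        (volume.restrict (halfSpace γ))) atTop (𝓝 0)) (k : ℕ) {η : ℝ≥0∞}
    (hη : ∀ᶠ j in atTop, C * eLpNorm (j2 (v j - v k)) p volume ≤ η) :
    eLpNorm (L u - L (v k)) p (volume.restrict (halfSpace γ)) ≤ η := by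
  have hΩ := halfSpace_open hγ.continuous
  have hu := neumann_of hΩ hp1 hD hG
  have hvW := fun j => (hv j).memWN hγ hp1
  have hvS := fun j => sob_of_smooth hγ (hv j).cd (hv j).cs p
  have hW : Tendsto (fun j => ENNReal.ofReal c * ∑ l ∈ L2 (n + 1), eLpNorm (partialDList l (v j) - D l) p
      (volume.restrict (halfSpace γ))) atTop (𝓝 0) := by
    have h2 : Tendsto (fun j => ∑ l ∈ L2 (n + 1), eLpNorm (partialDList l (v j) - D l) p
      (volume.restrict (halfSpace γ))) atTop (𝓝 (∑ l ∈ L2 (n + 1), 0)) :=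
      tendsto_finsetSum _ fun l hl => hvc l hl
    have h3 := ENNReal.Tendsto.const_mul (a := ENNReal.ofReal c) h2 (Or.inr ENNReal.ofReal_ne_top)
    simpa using h3
  have hlim := hW.add_const η
  rw [zero_add] at hlim
  refine ge_of_tendsto hlim ?_
  filter_upwards [hη] with j hj
  have mu := (hL.2.2.1 u hu).1
  have mv := fun j => (hL.2.2.1 (v j) (hvW j)).1
  have e : L u - L (v k) = (L u - L (v j)) + (L (v j) - L (v k)) := by simp
  rw [e]
  refine (eLpNorm_add_le (mu.sub (mv j)) ((mv j).sub (mv k)) hp1).trans (add_le_add ?_ ?_)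
  · have hS := sob_comb hp1 hD (hvS j) 1 (-1)
    have hN := neumann_of hΩ hp1 hS (green_comb hp1 hD (hvS j) hG ((hv j).green hγ) 1 (-1))
    have hb := hL.2.2.2 _ _ hN hS
    rw [WNormD_eq] at hb
    have hae := hL.2.1 u (v j) hu (hvW j) 1 (-1)
    rw [eLpNorm_congr_ae hae] at hb
    have e2 : (fun x => 1 * L u x + -1 * L (v j) x) = L u - L (v j) := by
      funext x; simp only [Pi.sub_apply]; ring
    rw [e2] at hb
    refine hb.trans (mul_le_mul' le_rfl (Finset.sum_le_sum fun l hl => ?_))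
    rw [eLpNorm_sub_comm]
    refine le_of_eq (congrArg (fun f => eLpNorm f p _) ?_)
    funext x; simp only [Pi.sub_apply]; ring
  · have hae := hL.2.1 (v j) (v k) (hvW j) (hvW k) 1 (-1)
    have e3 : (fun x => 1 * v j x + -1 * v k x) = v j - v k := by
      funext x; simp only [Pi.sub_apply]; ring
    have e2 : (fun x => 1 * L (v j) x + -1 * L (v k) x) = L (v j) - L (v k) := by
      funext x; simp only [Pi.sub_apply]; ring
    rw [e2, e3] at hae
    rw [← eLpNorm_congr_ae hae, eLpNorm_congr_ae (ext_eq h1 hγ hp1 hε hL ((hv j).sub (hv k)))]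
    exact (hC ε hε _ ((hv j).sub (hv k))).trans hj

/-- nonlocal-to-local convergence on a curved half space: let
`γ ∈ C³_b(ℝ^{n-1})`, `p ∈ [1,∞)`, and let `ρ` satisfy (A1) and (A2) with `M = I`, with
`‖γ‖_{C¹_b}` sufficiently small. Then for every `u ∈ W^{2,p}_I(ℝⁿ_γ)`,
`L_ε^{ℝⁿ_γ} u → -Δu` strongly in `L^p(ℝⁿ_γ)` as `ε → 0`, where `L_ε^{ℝⁿ_γ}` is (any
choice of) the bounded linear extension of the nonlocal operator and `Δu = ∑ᵢ ∂ᵢ∂ᵢ u`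
is expressed through the weak derivatives `D`. -/
theorem nlOp_convergence_half_space (n : ℕ) (ρ : EV (n + 1) → ℝ)
    (hρ1 : A1 ρ) (hρ2 : A2 ρ) (hM : momentum ρ = 1)
    (p : ℝ≥0∞) (hp1 : 1 ≤ p) (hp : p ≠ ⊤) :
    ∃ δ : ℝ, 0 < δ ∧ ∀ γ : EV n → ℝ, Ckb 3 γ →
      (∀ x : EV n, |γ x| ≤ δ ∧ ‖fderiv ℝ γ x‖ ≤ δ) →
      ∀ L : ℝ → (EV (n + 1) → ℝ) → EV (n + 1) → ℝ,
        (∀ ε : ℝ, 0 < ε → ε ≤ 1 → ∃ c : ℝ, 0 < c ∧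
          IsNLExtOn (halfSpace γ) (1 : Matrix (Fin (n + 1)) (Fin (n + 1)) ℝ) ρ p ε c (L ε)) →
        ∀ (u : EV (n + 1) → ℝ) (D : List (Fin (n + 1)) → EV (n + 1) → ℝ),
          NeumannBC (halfSpace γ) (1 : Matrix (Fin (n + 1)) (Fin (n + 1)) ℝ) p u →
          IsSobDerivs (halfSpace γ) 2 p u D →
          Tendsto
            (fun ε : ℝ =>
              eLpNorm (fun x => L ε u x + ∑ i : Fin (n + 1), D [i, i] x) p
                (volume.restrict (halfSpace γ)))
            (𝓝[>] 0) (𝓝 0) := by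

  refine ⟨1 / 8, by norm_num, fun γ hγ hsm L hL u D hN hD => ?_⟩
  obtain ⟨K, hg⟩ := GH.of_Ckb hγ hsm
  have hγ1 : ContDiff ℝ 1 γ := hg.c3.of_le (by norm_num)
  have hG := green_of hN hD
  have hΩ := halfSpace_open hγ1.continuous
  have hu := neumann_of hΩ hp1 hD hG
  obtain ⟨v, hv, hvcau, hvc⟩ := density hg hp1 hp hD hG
  obtain ⟨C, hC, hb⟩ := op_bound hρ1 hρ2 hM hg hp1 hp
  have hDm : ∀ l ∈ L2 (n + 1), MemLp (D l) p (volume.restrict (halfSpace γ)) := fun l hl =>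
    hD.2.2 l (mem_L2.1 hl)
  have hii : ∀ i : Fin (n + 1), [i, i] ∈ L2 (n + 1) := fun i => by simp [mem_L2]
  have hlapm : ∀ k, AEStronglyMeasurable (lap (v k)) (volume.restrict (halfSpace γ)) := fun k => by
    have h1 : Continuous fun x => ∑ i : Fin (n + 1), partialDList [i, i] (v k) x :=
      continuous_finsetSum _ fun i _ => pd_cont (hv k).cd _ (hii i)
    exact h1.aestronglyMeasurable
  have hDs : AEStronglyMeasurable (fun x => ∑ i : Fin (n + 1), D [i, i] x) (volume.restrict (halfSpace γ)) :=
    Finset.aestronglyMeasurable_fun_sum _ fun i _ => (hDm _ (hii i)).1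
  have hlap : Tendsto (fun k => eLpNorm (fun x => (∑ i : Fin (n + 1), D [i, i] x) - lap (v k) x) p
      (volume.restrict (halfSpace γ))) atTop (𝓝 0) := by
    have h2 : Tendsto (fun k => ∑ i : Fin (n + 1), eLpNorm (partialDList [i, i] (v k) - D [i, i]) p
      (volume.restrict (halfSpace γ))) atTop (𝓝 (∑ i : Fin (n + 1), 0)) :=
      tendsto_finsetSum _ fun i _ => hvc _ (hii i)
    rw [Finset.sum_const_zero] at h2
    refine tendsto_of_tendsto_of_tendsto_of_le_of_le tendsto_const_nhds h2 (fun _ => zero_le) fun k => ?_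
    have e : (fun x => (∑ i : Fin (n + 1), D [i, i] x) - lap (v k) x) =
        ∑ i : Fin (n + 1), (D [i, i] - partialDList [i, i] (v k)) := by
      funext x
      rw [Finset.sum_apply]
      unfold lap
      rw [← Finset.sum_sub_distrib]
      rfl
    show eLpNorm (fun x => (∑ i : Fin (n + 1), D [i, i] x) - lap (v k) x) p _ ≤ _
    rw [e]
    refine (eLpNorm_sum_le (fun i _ => (hDm _ (hii i)).1.sub
      (pd_cont (hv k).cd _ (hii i)).aestronglyMeasurable) hp1).trans (Finset.sum_le_sum fun i _ => ?_)
    rw [eLpNorm_sub_comm]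
  have hcau : Tendsto (fun q : ℕ × ℕ => C * eLpNorm (j2 (v q.1 - v q.2)) p volume) atTop (𝓝 0) :=
    tend_dom hC hvcau fun q => le_rfl
  rw [ENNReal.tendsto_nhds_zero]
  intro η hη
  have hη3 : 0 < η / 3 := ENNReal.div_pos hη.ne' (by norm_num)
  obtain ⟨⟨a, b⟩, hab⟩ := (hcau.eventually_le_const hη3).exists_forall_of_atTop
  obtain ⟨k, hk1, hk2⟩ := ((hlap.eventually_le_const hη3).and (eventually_ge_atTop b)).exists
  have hηk : ∀ᶠ j in atTop, C * eLpNorm (j2 (v j - v k)) p volume ≤ η / 3 := by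
    filter_upwards [eventually_ge_atTop a] with j hj
    exact hab (j, k) ⟨hj, hk2⟩
  filter_upwards [(op_conv hρ1 hρ2 hM hg hp1 hp (hv k)).eventually_le_const hη3,
    Ioc_mem_nhdsGT (show (0 : ℝ) < 1 from one_pos)] with ε hε1 hε
  obtain ⟨c, -, hLε⟩ := hL ε hε.1 hε.2
  have hclose := ext_close hρ1 hγ1 hp1 hb hε.1 hLε hD hG hv hvc k hηk
  have hae := ext_eq hρ1 hγ1 hp1 hε.1 hLε (hv k)
  have mu := (hLε.2.2.1 u hu).1
  have mv := (hLε.2.2.1 (v k) ((hv k).memWN hγ1 hp1)).1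
  have e : (fun x => L ε u x + ∑ i : Fin (n + 1), D [i, i] x) =
      (L ε u - L ε (v k)) + (L ε (v k) + lap (v k)) +
      (fun x => (∑ i : Fin (n + 1), D [i, i] x) - lap (v k) x) := by
    funext x
    simp only [Pi.add_apply, Pi.sub_apply]
    ring
  rw [e, ← ENNReal.add_thirds η]
  refine (eLpNorm_add_le ((mu.sub mv).add (mv.add (hlapm k))) (hDs.sub (hlapm k)) hp1).trans
    (add_le_add ((eLpNorm_add_le (mu.sub mv) (mv.add (hlapm k)) hp1).trans (add_le_add hclose ?_)) hk1)
  refine le_trans (le_of_eq (eLpNorm_congr_ae ?_)) hε1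
  filter_upwards [hae] with x hx
  rw [Pi.add_apply, hx]
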